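/- For every odd natural number n with 35 ≤ n ≤ 75000, there are exactly two indices i with 0 ≤ i ≤ n(n+1)/2 and |a(n,i)| = M_n. -/

import Mathlib

open Polynomial

/-- `a n i` is the coefficient of `q^i` in `(q;q)_n = ∏_{k=1}^n (1 - q^k)` over `ℤ`. -/
noncomputable def a (n i : ℕ) : ℤ :=
  (∏ k ∈ Finset.Icc 1 n, (1 - (X : Polynomial ℤ) ^ k)).coeff i

/-- `M n` is the maximum of `|a n i|` over `0 ≤ i ≤ n(n+1)/2`. -/
noncomputable def M (n : ℕ) : ℕ :=
  (Finset.range (n * (n + 1) / 2 + 1)).sup fun i => (a n i).natAbs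

/-- `L n` is the least index `i` with `|a n i| = M n`. -/
noncomputable def L (n : ℕ) : ℕ :=
  sInf {i : ℕ | (a n i).natAbs = M n}



namespace QP

/-! ### Basic facts about the coefficients -/

lemma a_zero_left (i : ℕ) : a 0 i = if i = 0 then 1 else 0 := by
  simp [a, Polynomial.coeff_one]

lemma a_succ (n i : ℕ) : a (n+1) i = a n i - (if n + 1 ≤ i then a n (i - (n+1)) else 0) := by
  unfold a
  rw [Finset.prod_Icc_succ_top (by omega), mul_sub, mul_one, Polynomial.coeff_sub,
    Polynomial.coeff_mul_X_pow']

lemma tri_succ (n : ℕ) : (n+1) * (n+1+1) / 2 = n * (n+1) / 2 + (n+1) := by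
  have : (n+1) * (n+1+1) = n * (n+1) + (n+1) * 2 := by ring
  rw [this, Nat.add_mul_div_right _ _ (by norm_num)]

lemma a_eq_zero (n : ℕ) : ∀ i, n * (n+1) / 2 < i → a n i = 0 := by
  induction n with
  | zero => intro i hi; rw [a_zero_left]; simp at hi; simp; omega
  | succ n ih =>
    intro i hi
    rw [tri_succ] at hi
    rw [a_succ, ih i (by omega), if_pos (by omega), ih _ (by omega)]; simp

lemma a_symm (n : ℕ) : ∀ i, i ≤ n * (n+1) / 2 → a n (n * (n+1) / 2 - i) = (-1)^n * a n i := by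
  induction n with
  | zero => intro i hi; simp at hi; subst hi; simp
  | succ n ih =>
    intro i hi
    rw [tri_succ] at hi ⊢
    set N := n * (n+1) / 2 with hN
    rw [a_succ, a_succ]
    have h1 : a n (N + (n+1) - i) = (-1)^n * (if n + 1 ≤ i then a n (i - (n+1)) else 0) := by
      split_ifs with h
      · rw [← ih (i - (n+1)) (by omega)]; congr 1; omega
      · rw [a_eq_zero n _ (by omega)]; simp
    have h2 : (if n + 1 ≤ N + (n+1) - i then a n (N + (n+1) - i - (n+1)) else 0)
        = (-1)^n * a n i := by
      split_ifs with h
      · rw [← ih i (by omega)]; congr 1; omega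
      · rw [a_eq_zero n i (by omega)]; simp
    rw [h1, h2]; ring

lemma a_bound_succ (n : ℕ) (B : ℤ) (h : ∀ i, |a n i| ≤ B) : ∀ i, |a (n+1) i| ≤ 2 * B := by
  intro i
  rw [a_succ]
  have h1 := h i
  have hB : 0 ≤ B := le_trans (abs_nonneg _) h1
  split_ifs
  · have h2 := h (i - (n+1))
    have := abs_sub (a n i) (a n (i - (n+1)))
    linarith
  · simp; linarith

/-- A unique strict maximum in the lower half. -/
def Good (n : ℕ) : Prop :=
  ∃ i0, i0 ≤ n * (n+1) / 4 ∧ ∀ i, i ≤ n * (n+1) / 4 → i ≠ i0 → |a n i| < |a n i0|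

lemma good_ncard (n : ℕ) (hodd : Odd n) (hn : 1 ≤ n) (hg : Good n) :
    {i : ℕ | i ≤ n * (n + 1) / 2 ∧ (a n i).natAbs = M n}.ncard = 2 := by
  obtain ⟨i0, hi0, h⟩ := hg
  set N := n * (n+1) / 2 with hN
  have h4 : n * (n+1) / 4 = N / 2 := by rw [hN, Nat.div_div_eq_div_mul]
  rw [h4] at hi0 h
  have hNpos : 1 ≤ N := by
    rw [hN]
    have : 1 * 2 ≤ n * (n+1) := Nat.mul_le_mul hn (by omega)
    omega
  have hsym : ∀ i, i ≤ N → |a n (N - i)| = |a n i| := by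
    intro i hi
    rw [a_symm n i hi, abs_mul, abs_pow]; simp
  have hmid : i0 ≠ N - i0 := by
    intro he
    have h1 := a_symm n i0 (by omega)
    rw [← hN, ← he, hodd.neg_one_pow] at h1
    have h0 : a n i0 = 0 := by omega
    by_cases hz : i0 = 0
    · omega
    · have := h 0 (by omega) (by omega)
      rw [h0] at this; simp at this
      exact absurd this (not_lt.mpr (abs_nonneg _))
  have key : ∀ i, i ≤ N → i ≠ i0 → i ≠ N - i0 → |a n i| < |a n i0| := by
    intro i hi h1 h2
    by_cases hlow : i ≤ N / 2
    · exact h i hlow h1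
    · rw [← hsym i hi]; exact h (N - i) (by omega) (by omega)
  have hM : M n = (a n i0).natAbs := by
    unfold M
    apply le_antisymm
    · apply Finset.sup_le
      intro i hi
      rw [Finset.mem_range] at hi
      have : |a n i| ≤ |a n i0| := by
        by_cases h1 : i = i0
        · rw [h1]
        · by_cases h2 : i = N - i0
          · rw [h2, hsym i0 (by omega)]
          · exact (key i (by omega) h1 h2).le
      show (a n i).natAbs ≤ _
      rw [Int.abs_eq_natAbs, Int.abs_eq_natAbs] at this
      exact_mod_cast this
    · exact Finset.le_sup (f := fun i => (a n i).natAbs) (Finset.mem_range.mpr (by omega))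
  have hset : {i : ℕ | i ≤ N ∧ (a n i).natAbs = M n} = {i0, N - i0} := by
    ext i
    simp only [Set.mem_ofPred_eq, Set.mem_insert_iff, Set.mem_singleton_iff]
    constructor
    · rintro ⟨hi, he⟩
      by_contra hc
      push Not at hc
      have := key i hi hc.1 hc.2
      rw [Int.abs_eq_natAbs, Int.abs_eq_natAbs] at this
      omega
    · rintro (rfl | rfl)
      · exact ⟨by omega, hM.symm⟩
      · refine ⟨by omega, ?_⟩
        have := hsym i0 (by omega)
        rw [Int.abs_eq_natAbs, Int.abs_eq_natAbs] at this
        omega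
  rw [hset, Set.ncard_pair hmid]

end QP

namespace QP

/-! ### Packed kernel computation for small `n` -/

/-- product of `2^(w k) - 1` over `lo ≤ k < lo + len` -/
def pk_tree (w : Nat) : Nat → Nat → Nat → Nat
  | 0, lo, _ => Nat.sub (Nat.shiftLeft 1 (Nat.mul w lo)) 1
  | f+1, lo, len => bif Nat.ble len 1 then Nat.sub (Nat.shiftLeft 1 (Nat.mul w lo)) 1 else
      Nat.mul (pk_tree w f lo (Nat.div len 2))
        (pk_tree w f (Nat.add lo (Nat.div len 2)) (Nat.sub len (Nat.div len 2)))

/-- repunit with `2^K` digits -/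
def pk_rep (w : Nat) : Nat → Nat
  | 0 => 1
  | f+1 => Nat.add (pk_rep w f) (Nat.shiftLeft (pk_rep w f) (Nat.mul w (Nat.pow 2 f)))

/-- multiplication by `1 - q^n` modulo `F` -/
def pk_step (w F Mk n V : Nat) : Nat :=
  Nat.land (Nat.sub (Nat.add V F) (Nat.land (Nat.shiftLeft V (Nat.mul w n)) Mk)) Mk

/-- all digits are in absolute value below `m` -/
def pk_test (V' R H m : Nat) : Bool :=
  Nat.beq (Nat.land (Nat.add V' (Nat.mul R (Nat.sub H m))) (Nat.mul R H)) 0 &&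
  Nat.beq (Nat.land (Nat.add V' (Nat.mul R (Nat.sub (Nat.add H m) 1))) (Nat.mul R H)) (Nat.mul R H)

/-- the digit `i` is the unique largest one -/
def pk_chk (w R0 n V0 i m : Nat) : Bool :=
    (fun Mk => (fun V =>
       pk_test
        (bif Nat.beq (Nat.mod n 4) 3 then
           Nat.add V (Nat.shiftLeft (Nat.sub (Nat.mul 2 m) 1) (Nat.mul w i)) else
           Nat.sub (Nat.add V (Nat.add Mk 1))
             (Nat.shiftLeft (Nat.sub (Nat.mul 2 m) 1) (Nat.mul w i)))
        (Nat.land R0 Mk) (Nat.shiftLeft 1 (Nat.sub w 1)) m)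
      (Nat.land V0 Mk))
    (Nat.sub (Nat.shiftLeft 1 (Nat.mul w (Nat.add (Nat.div (Nat.mul n (Nat.add n 1)) 4) 1))) 1)

/-- side conditions of a check -/
def pk_side (w T n B i m : Nat) : Bool :=
  Nat.ble (8 * (4 * B + 2 * m)) (2 ^ w) && (Nat.ble 1 m &&
    (Nat.ble i (Nat.div (Nat.mul n (Nat.add n 1)) 4) &&
     Nat.ble (Nat.add (Nat.div (Nat.mul n (Nat.add n 1)) 4) 1) T))

/-- run over odd `n` -/
def pk_loop (w T F Mk R0 : Nat) : List (Nat × Nat) → Nat → Nat → Nat → Bool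
  | [], _, _, _ => true
  | im :: l, B, n, V => pk_side w T n B im.1 im.2 && (pk_chk w R0 n V im.1 im.2 &&
       pk_loop w T F Mk R0 l (3 * im.2) (Nat.add n 2)
       (pk_step w F Mk (Nat.add n 2) (pk_step w F Mk (Nat.add n 1) V)))

/-- one block -/
def pk_block (w n1 T K B : Nat) (l : List (Nat × Nat)) : Bool :=
  Nat.ble T (2 ^ K) && ((fun F => (fun Mk => pk_loop w T F Mk (pk_rep w K) l B n1
     (Nat.land (Nat.sub F (Nat.land (pk_tree w 12 1 n1) Mk)) Mk)) (Nat.sub F 1))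
       (Nat.shiftLeft 1 (Nat.mul w T)))

lemma zmod_of_eq {m x y : ℤ} (h : x = y) : x ≡ y [ZMOD m] := by rw [h]

lemma nmod_of_eq {m x y : ℕ} (h : x = y) : x ≡ y [MOD m] := by rw [h]

lemma pk_tree_eq (w f : ℕ) : ∀ lo len, 1 ≤ len → len ≤ 2 ^ f →
    (pk_tree w f lo len : ℤ) = ∏ k ∈ Finset.range len, (((2:ℤ)^w)^(lo + k) - 1) := by
  induction f with
  | zero =>
    intro lo len h1 h2
    obtain rfl : len = 1 := by simpa using le_antisymm h2 h1
    simp only [pk_tree, Nat.sub_eq, Nat.mul_eq, Nat.shiftLeft_eq', Nat.shiftLeft_eq]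
    rw [Nat.cast_sub (by simpa using Nat.one_le_two_pow)]
    simp [pow_mul]
  | succ f ih =>
    intro lo len h1 h2
    rw [pk_tree]
    by_cases h : len ≤ 1
    · obtain rfl : len = 1 := le_antisymm h h1
      simp only [Nat.ble_eq_true_of_le, Nat.sub_eq, Nat.mul_eq, Nat.shiftLeft_eq', Nat.shiftLeft_eq, le_refl, cond_true]
      rw [Nat.cast_sub (by simpa using Nat.one_le_two_pow)]
      simp [pow_mul]
    · have hb : Nat.ble len 1 = false := by
        rw [← Bool.not_eq_true, Nat.ble_eq]; exact h
      rw [hb, cond_false]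
      have hd : Nat.div len 2 = len / 2 := rfl
      simp only [Nat.mul_eq, Nat.sub_eq, Nat.add_eq, hd]
      rw [pow_succ] at h2
      rw [Nat.cast_mul, ih _ _ (by omega) (by omega), ih _ _ (by omega) (by omega)]
      have : len = len / 2 + (len - len / 2) := by omega
      conv_rhs => rw [this, Finset.prod_range_add]
      simp only [add_assoc]

lemma pk_rep_eq (w f : ℕ) : pk_rep w f = ∑ i ∈ Finset.range (2^f), (2^w)^i := by
  induction f with
  | zero => simp [pk_rep]
  | succ f ih =>
    rw [pk_rep, ih, pow_succ, mul_two, Finset.sum_range_add]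
    simp only [Nat.add_eq, Nat.mul_eq, Nat.shiftLeft_eq', Nat.shiftLeft_eq, Nat.pow_eq]
    rw [Finset.sum_mul]
    congr 1
    apply Finset.sum_congr rfl
    intro i _
    rw [pow_mul, ← pow_add, add_comm]

/-- value of the polynomial -/
lemma eval_mod (n T : ℕ) (W : ℤ) :
    (∏ k ∈ Finset.Icc 1 n, (1 - W ^ k)) ≡ ∑ i ∈ Finset.range T, a n i * W^i [ZMOD W^T] := by
  have h : (∏ k ∈ Finset.Icc 1 n, (1 - W ^ k)) =
      ((∏ k ∈ Finset.Icc 1 n, (1 - (X : Polynomial ℤ) ^ k))).eval W := by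
    rw [Polynomial.eval_prod]; simp
  rw [h, Polynomial.eval_eq_sum_range' (n := T + ((∏ k ∈ Finset.Icc 1 n, (1 - (X : Polynomial ℤ) ^ k)).natDegree + 1)) (by omega),
    Finset.sum_range_add]
  apply Int.ModEq.symm
  rw [Int.modEq_iff_dvd]
  have : ∀ x y z : ℤ, x = z → x + y - z = y := by intros; subst_vars; ring
  rw [this _ _ _ (by rfl)]
  apply Finset.dvd_sum
  intro i _
  rw [pow_add]
  exact Dvd.dvd.mul_left (Dvd.intro _ rfl) _

/-- extraction of the bits of a packed number -/
lemma bit_extract (w : ℕ) (hw : 1 ≤ w) : ∀ (T i : ℕ) (e : ℕ → ℕ) (U : ℕ), i < T →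
    (∀ j, j < T → e j < 2^w) → U ≡ ∑ j ∈ Finset.range T, e j * (2^w)^j [MOD (2^w)^T] →
    U.testBit (w * i + (w-1)) = (e i).testBit (w-1) := by
  intro T
  induction T with
  | zero => intro i e U h; omega
  | succ T ih =>
    intro i e U hi he hU
    rw [Finset.sum_range_succ'] at hU
    simp only [pow_zero, mul_one] at hU
    set S := ∑ j ∈ Finset.range T, e (j+1) * (2^w)^j with hS
    have hS' : ∑ k ∈ Finset.range T, e (k + 1) * (2 ^ w) ^ (k + 1) = 2^w * S := by
      rw [hS, Finset.mul_sum]; apply Finset.sum_congr rfl; intros; ring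
    rw [hS'] at hU
    have he0 := he 0 (by omega)
    have hWpos : 0 < 2^w := by positivity
    have h0 : U % 2^w = e 0 := by
      have h1 : U ≡ 2^w * S + e 0 [MOD 2^w] := hU.of_dvd (Dvd.intro_left ((2^w)^T) (by ring))
      have h2 : U % 2^w = (2^w * S + e 0) % 2^w := h1
      rw [h2, Nat.mul_add_mod, Nat.mod_eq_of_lt he0]
    have h1 : U / 2^w ≡ S [MOD (2^w)^T] := by
      have h3 : 2^w * (U / 2^w) + e 0 ≡ 2^w * S + e 0 [MOD (2^w)^(T+1)] := by
        have := Nat.div_add_mod U (2^w)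
        rw [h0] at this
        rw [this]; exact hU
      have h4 := Nat.ModEq.add_right_cancel' _ h3
      rw [pow_succ'] at h4
      exact Nat.ModEq.mul_left_cancel' hWpos.ne' h4
    rcases Nat.eq_zero_or_pos i with rfl | hpos
    · rw [mul_zero, zero_add, ← h0, Nat.testBit_mod_two_pow]
      simp; omega
    · obtain ⟨k, rfl⟩ : ∃ k, i = k + 1 := ⟨i - 1, by omega⟩
      have := ih k (fun j => e (j+1)) (U / 2^w) (by omega) (fun j hj => he _ (by omega)) h1
      rw [← this, Nat.testBit_div_two_pow]
      congr 1; ring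

lemma testBit_top (w e : ℕ) (he : e < 2^w) (hw : 1 ≤ w) :
    (e.testBit (w-1) = true ↔ 2^(w-1) ≤ e) := by
  have h2 : 2^w = 2 * 2^(w-1) := by
    conv_lhs => rw [show w = (w-1)+1 by omega]
    ring
  rw [Nat.testBit_eq_decide_div_mod_eq]
  simp only [decide_eq_true_eq]
  constructor
  · intro h
    by_contra hc
    rw [Nat.div_eq_of_lt (by omega)] at h
    omega
  · intro h
    have : e / 2^(w-1) = 1 := by
      apply Nat.div_eq_of_lt_le <;> omega
    rw [this]

lemma zmod_to_nat (U F : ℕ) (S : ℕ) (h : (U:ℤ) ≡ (S:ℤ) [ZMOD (F:ℤ)]) : U ≡ S [MOD F] :=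
  (Int.natCast_modEq_iff).mp h

/-- soundness of the test -/
lemma pk_test_sound (w T V' R m : ℕ) (hw : 1 ≤ w) (e : ℕ → ℤ) (hm : 1 ≤ m)
    (hV : (V' : ℤ) ≡ ∑ i ∈ Finset.range T, e i * ((2:ℤ)^w)^i [ZMOD ((2:ℤ)^w)^T])
    (hR : R ≡ ∑ i ∈ Finset.range T, (2^w)^i [MOD (2^w)^T])
    (hb : ∀ i, i < T → 4 * (|e i| + m) < 2^w)
    (h : pk_test V' R (2^(w-1)) m = true) :
    ∀ i, i < T → |e i| < m := by
  intro i hi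
  have h2 : 2^w = 2 * 2^(w-1) := by
    conv_lhs => rw [show w = (w-1)+1 by omega]
    ring
  have h2z : (2:ℤ)^w = 2 * 2^(w-1) := by exact_mod_cast h2
  rw [pk_test, Bool.and_eq_true, Nat.beq_eq, Nat.beq_eq] at h
  simp only [Nat.add_eq, Nat.mul_eq, Nat.sub_eq] at h
  obtain ⟨ha, hbb⟩ := h
  have hmask : (R * 2^(w-1)).testBit (w * i + (w-1)) = true := by
    rw [bit_extract w hw T i (fun _ => 2^(w-1)) _ hi]
    · rw [Nat.testBit_two_pow_self]
    · intro j _; rw [h2]; have : 0 < 2^(w-1) := by positivity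
      omega
    · have := hR.mul_right (2^(w-1))
      rw [Finset.sum_mul] at this
      refine this.trans ?_
      apply nmod_of_eq
      apply Finset.sum_congr rfl; intros; ring
  have main : ∀ c : ℕ, (∀ j, j < T → 0 ≤ e j + c ∧ e j + c < 2^w) →
      (V' + R * c).testBit (w * i + (w-1)) = (e i + c).toNat.testBit (w-1) := by
    intro c hc
    rw [bit_extract w hw T i (fun j => (e j + c).toNat) _ hi]
    · intro j hj
      have := hc j hj
      zify
      rw [Int.toNat_of_nonneg this.1]; exact_mod_cast this.2
    · apply zmod_to_nat
      push_cast
      have hRz : (R:ℤ) ≡ ∑ i ∈ Finset.range T, ((2:ℤ)^w)^i [ZMOD ((2:ℤ)^w)^T] := by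
        have := (Int.natCast_modEq_iff).mpr hR
        push_cast at this; exact this
      have h5 := hV.add (hRz.mul_right (c:ℤ))
      refine h5.trans ?_
      apply zmod_of_eq
      rw [Finset.sum_mul, ← Finset.sum_add_distrib]
      apply Finset.sum_congr rfl
      intro j hj
      have := hc j (Finset.mem_range.mp hj)
      rw [Int.toNat_of_nonneg this.1]; ring
  have hmb : ∀ j, j < T → -(2:ℤ)^w < 4 * (e j - m) ∧ 4 * (e j + m) < 2^w ∧ (4:ℤ) * m < 2^w := by
    intro j hj
    have := hb j hj
    have h3 := neg_abs_le (e j)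
    have h4 := le_abs_self (e j)
    have h5 := abs_nonneg (e j)
    refine ⟨by linarith, by linarith, by linarith⟩
  have hbi := hmb i hi
  have hmH : m ≤ 2^(w-1) := by
    have : 4 * m < 2^w := by exact_mod_cast hbi.2.2
    omega
  have t1 := main (2^(w-1) - m) (by
    intro j hj
    have := hmb j hj
    rw [Nat.cast_sub hmH]; push_cast
    constructor <;> linarith)
  have t2 := main (2^(w-1) + m - 1) (by
    intro j hj
    have := hmb j hj
    rw [Nat.cast_sub (by omega)]; push_cast
    constructor <;> linarith)
  have b1 : (V' + R * (2^(w-1) - m)).testBit (w * i + (w-1)) = false := by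
    have := congrArg (fun x => x.testBit (w * i + (w-1))) ha
    rw [show ∀ x y : ℕ, Nat.land x y = x &&& y from fun _ _ => rfl, Nat.testBit_and, hmask] at this
    simpa using this
  have b2 : (V' + R * (2^(w-1) + m - 1)).testBit (w * i + (w-1)) = true := by
    have := congrArg (fun x => x.testBit (w * i + (w-1))) hbb
    rw [show ∀ x y : ℕ, Nat.land x y = x &&& y from fun _ _ => rfl, Nat.testBit_and, hmask] at this
    simpa using this
  rw [b1] at t1
  rw [b2] at t2
  rw [Nat.cast_sub hmH] at t1
  rw [Nat.cast_sub (by omega)] at t2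
  push_cast at t1 t2
  have q2 := (testBit_top w _ (by
    zify; rw [Int.toNat_of_nonneg (by linarith)]; push_cast; linarith) hw).mp t2.symm
  have q1 : ¬ (2^(w-1) ≤ (e i + (2^(w-1) - (m:ℤ))).toNat) := by
    rw [← testBit_top w _ (by
      zify; rw [Int.toNat_of_nonneg (by linarith)]; push_cast; linarith) hw, ← t1]; simp
  zify at q1 q2
  rw [Int.toNat_of_nonneg (by linarith)] at q1 q2
  rw [abs_lt]
  constructor <;> linarith

lemma land_mask (V k : ℕ) : Nat.land V (Nat.sub (Nat.shiftLeft 1 k) 1) = V % 2^k := by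
  have := Nat.and_two_pow_sub_one_eq_mod V k
  rw [← this]
  show V &&& ((1 <<< k) - 1) = _
  rw [Nat.shiftLeft_eq, one_mul]

end QP

namespace QP

lemma pk_chk_sound (w T R0 n V0 i0 m B K : ℕ) (hside : pk_side w T n B i0 m = true)
    (hK : T ≤ 2 ^ K) (hR : R0 = pk_rep w K)
    (hV : (V0 : ℤ) ≡ (∏ k ∈ Finset.Icc 1 n, (1 - ((2:ℤ)^w) ^ k)) [ZMOD ((2:ℤ)^w)^T])
    (hB : ∀ i, |a n i| ≤ 4 * B)
    (h : pk_chk w R0 n V0 i0 m = true) :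
    1 ≤ w ∧ Good n ∧ ∀ i, i ≤ n * (n+1) / 4 → |a n i| ≤ 3 * m := by
  simp only [pk_side, Bool.and_eq_true, Nat.ble_eq, Nat.add_eq, Nat.mul_eq] at hside
  change _ ∧ _ ∧ i0 ≤ n * (n+1) / 4 ∧ n * (n+1) / 4 + 1 ≤ T at hside
  obtain ⟨hs1, hm, hi0, hT⟩ := hside
  set T' := n * (n+1) / 4 + 1 with hT'
  have hw : 1 ≤ w := by
    by_contra hc
    have : w = 0 := by omega
    rw [this] at hs1; omega
  rw [pk_chk] at h
  have hd : Nat.add (Nat.div (Nat.mul n (Nat.add n 1)) 4) 1 = T' := rfl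
  rw [hd] at h
  simp only [land_mask] at h
  have hH : Nat.shiftLeft 1 (Nat.sub w 1) = 2^(w-1) := by
    show 1 <<< (w-1) = _
    rw [Nat.shiftLeft_eq, one_mul]
  rw [hH] at h
  have hpw : (2:ℕ)^(w * T') = (2^w)^T' := by rw [pow_mul]
  have hMk : Nat.add (Nat.sub (Nat.shiftLeft 1 (Nat.mul w T')) 1) 1 = (2^w)^T' := by
    show (1 <<< (w * T')) - 1 + 1 = _
    rw [Nat.shiftLeft_eq, one_mul, hpw]
    have : 0 < (2^w)^T' := by positivity
    omega
  have hsh : Nat.shiftLeft (Nat.sub (Nat.mul 2 m) 1) (Nat.mul w i0) = (2*m-1) * (2^w)^i0 := by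
    show (2*m-1) <<< (w * i0) = _
    rw [Nat.shiftLeft_eq, pow_mul]
  have hmulw : Nat.mul w T' = w * T' := rfl
  rw [hMk, hsh, hmulw, hpw] at h
  have hdvd : ((2:ℤ)^w)^T' ∣ ((2:ℤ)^w)^T := pow_dvd_pow _ hT
  have hV2 : ((V0 % (2^w)^T' : ℕ) : ℤ) ≡ ∑ i ∈ Finset.range T', a n i * ((2:ℤ)^w)^i [ZMOD ((2:ℤ)^w)^T'] := by
    have h1 := (hV.of_dvd hdvd).trans (eval_mod n T' ((2:ℤ)^w))
    refine Int.ModEq.trans ?_ h1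
    push_cast
    exact Int.mod_modEq _ _
  have hR2 : R0 % (2^w)^T' ≡ ∑ i ∈ Finset.range T', (2^w)^i [MOD (2^w)^T'] := by
    refine (Nat.mod_modEq _ _).trans ?_
    rw [hR, pk_rep_eq, show 2^K = T' + (2^K - T') by omega, Finset.sum_range_add]
    have : (∑ x ∈ Finset.range (2 ^ K - T'), (2 ^ w) ^ (T' + x)) ≡ 0 [MOD (2^w)^T'] := by
      rw [Nat.modEq_zero_iff_dvd]
      apply Finset.dvd_sum
      intro j _
      exact pow_dvd_pow _ (by omega)
    simpa using this.add_left (∑ i ∈ Finset.range T', (2^w)^i)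
  have hs1z : (8:ℤ) * (4 * B + 2 * m) ≤ 2^w := by exact_mod_cast hs1
  have fin : ∀ s : ℤ, (s = 1 ∨ s = -1) → ∀ V' : ℕ,
      (V' : ℤ) ≡ ∑ i ∈ Finset.range T', a n i * ((2:ℤ)^w)^i - s * (2*m-1) * ((2:ℤ)^w)^i0 [ZMOD ((2:ℤ)^w)^T'] →
      pk_test V' (R0 % (2^w)^T') (2^(w-1)) m = true →
      Good n ∧ ∀ i, i ≤ n * (n+1) / 4 → |a n i| ≤ 3 * m := by
    intro s hs V' hV' ht
    have hsab : |s| = 1 := by rcases hs with rfl | rfl <;> simp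
    have hm' : (1:ℤ) ≤ m := by exact_mod_cast hm
    have habs : |s * (2*m-1)| = 2*m-1 := by
      rw [abs_mul, hsab, one_mul, abs_of_nonneg]; linarith
    have hB0 : (0:ℤ) ≤ B := by positivity
    have key := pk_test_sound w T' V' _ m hw (fun i => a n i - if i = i0 then s * (2*m-1) else 0) hm
      (by
        refine hV'.trans (zmod_of_eq ?_)
        simp only [sub_mul, Finset.sum_sub_distrib, ite_mul, zero_mul]
        rw [Finset.sum_ite_eq' (Finset.range T') i0, if_pos (Finset.mem_range.mpr (by omega))]
        ) hR2
      (by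
        intro i _
        show 4 * (|a n i - if i = i0 then s * (2*m-1) else 0| + (m:ℤ)) < 2^w
        have h1 := hB i
        split_ifs
        · have := abs_sub (a n i) (s * (2*m-1))
          rw [habs] at this
          linarith
        · rw [sub_zero]; linarith) ht
    have k0 := key i0 (by omega)
    simp only [if_true] at k0
    have hge : (m:ℤ) ≤ |a n i0| := by
      have := abs_sub_abs_le_abs_sub (s * (2*m-1)) (a n i0)
      rw [habs, abs_sub_comm] at this
      linarith
    have hle : |a n i0| ≤ 3 * m := by
      have := abs_sub_abs_le_abs_sub (a n i0) (s * (2*m-1))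
      rw [habs] at this
      linarith
    have ho : ∀ i, i ≤ n * (n+1) / 4 → i ≠ i0 → |a n i| < m := by
      intro i hi hne
      have := key i (by omega)
      simpa [hne] using this
    refine ⟨⟨i0, hi0, fun i hi hne => lt_of_lt_of_le (ho i hi hne) hge⟩, ?_⟩
    intro i hi
    by_cases hne : i = i0
    · rw [hne]; exact hle
    · have := ho i hi hne; linarith
  have hm2 : ((2 * m - 1 : ℕ) : ℤ) = 2 * m - 1 := by
    rw [Nat.cast_sub (by omega)]; push_cast; ring
  refine ⟨hw, ?_⟩
  by_cases h4 : Nat.beq (Nat.mod n 4) 3 = true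
  · rw [h4, cond_true] at h
    refine fin (-1) (Or.inr rfl) _ ?_ h
    simp only [Nat.add_eq]
    rw [Nat.cast_add, Nat.cast_mul, hm2]
    push_cast
    have := hV2.add_right ((2*(m:ℤ)-1) * ((2:ℤ)^w)^i0)
    push_cast at this
    refine this.trans (zmod_of_eq (by ring))
  · rw [Bool.not_eq_true] at h4
    rw [h4, cond_false] at h
    refine fin 1 (Or.inl rfl) _ ?_ h
    simp only [Nat.add_eq, Nat.sub_eq]
    have hlt : (2*m-1) * (2^w)^i0 ≤ (2^w)^T' := by
      have h1 : 2 * m - 1 ≤ 2^w := by omega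
      calc (2*m-1) * (2^w)^i0 ≤ 2^w * (2^w)^i0 := Nat.mul_le_mul_right _ h1
        _ = (2^w)^(i0+1) := by ring
        _ ≤ (2^w)^T' := Nat.pow_le_pow_right (by positivity) (by omega)
    rw [Nat.cast_sub (le_trans hlt (Nat.le_add_left _ _)), Nat.cast_add, Nat.cast_mul, hm2]
    have := (hV2.add_right (((2:ℤ)^w)^T')).sub_right ((2*(m:ℤ)-1) * ((2:ℤ)^w)^i0)
    push_cast at this ⊢
    refine this.trans ?_
    have h0 : ((2:ℤ)^w)^T' ≡ 0 [ZMOD ((2:ℤ)^w)^T'] := by simp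
    have := h0.add_left (∑ i ∈ Finset.range T', a n i * ((2:ℤ)^w)^i - 1 * (2*m-1) * ((2:ℤ)^w)^i0)
    rw [add_zero] at this
    refine (zmod_of_eq ?_).trans this
    ring

lemma pk_step_sound (w T n V : ℕ) (x : ℤ)
    (hV : (V:ℤ) ≡ x [ZMOD ((2:ℤ)^w)^T]) :
    ((pk_step w (Nat.shiftLeft 1 (Nat.mul w T)) (Nat.sub (Nat.shiftLeft 1 (Nat.mul w T)) 1) n V : ℕ):ℤ)
      ≡ x * (1 - ((2:ℤ)^w)^n) [ZMOD ((2:ℤ)^w)^T] := by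
  rw [pk_step, land_mask, land_mask]
  have e1 : Nat.shiftLeft V (Nat.mul w n) = V * (2^w)^n := by
    show V <<< (w * n) = _
    rw [Nat.shiftLeft_eq, pow_mul]
  have e2 : Nat.shiftLeft 1 (Nat.mul w T) = (2^w)^T := by
    show 1 <<< (w * T) = _
    rw [Nat.shiftLeft_eq, pow_mul, one_mul]
  have e3 : (2:ℕ)^(Nat.mul w T) = (2^w)^T := by
    show 2^(w*T) = _
    rw [pow_mul]
  rw [e1, e2, e3]
  simp only [Nat.add_eq, Nat.sub_eq]
  have hp : 0 < (2^w)^T := by positivity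
  have hlt := Nat.mod_lt (V * (2^w)^n) hp
  push_cast
  rw [Nat.cast_sub (by omega)]
  push_cast
  refine (Int.mod_modEq _ _).trans ?_
  have h0 : ((2:ℤ)^w)^T ≡ 0 [ZMOD ((2:ℤ)^w)^T] := by simp
  have h1 := (hV.add h0).sub ((Int.mod_modEq ((V:ℤ) * ((2:ℤ)^w)^n) (((2:ℤ)^w)^T)).trans (hV.mul_right (((2:ℤ)^w)^n)))
  refine h1.trans (zmod_of_eq (by ring))

lemma bound_full (n : ℕ) (B : ℤ) (h : ∀ i, i ≤ n * (n+1) / 4 → |a n i| ≤ B) :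
    ∀ i, |a n i| ≤ B := by
  intro i
  by_cases hi : i ≤ n * (n+1) / 2
  · by_cases h4 : i ≤ n * (n+1) / 4
    · exact h i h4
    · have h1 := a_symm n i hi
      have h2 := h (n * (n+1) / 2 - i) (by
        have : n * (n+1) / 4 = n * (n+1) / 2 / 2 := by rw [Nat.div_div_eq_div_mul]
        omega)
      rw [h1, abs_mul, abs_pow] at h2
      simpa using h2
  · rw [a_eq_zero n i (by omega)]
    have := h 0 (Nat.zero_le _)
    simpa using le_trans (abs_nonneg _) this

lemma pow_bound (n : ℕ) : ∀ i, |a n i| ≤ 2^n := by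
  induction n with
  | zero => intro i; rw [a_zero_left]; split_ifs <;> simp
  | succ n ih =>
    intro i
    have := a_bound_succ n _ ih i
    rw [pow_succ]; linarith

lemma bound_two (n : ℕ) (B : ℤ) (h : ∀ i, |a n i| ≤ B) : ∀ i, |a (n+2) i| ≤ 4 * B := by
  intro i
  have := a_bound_succ (n+1) _ (a_bound_succ n B h) i
  linarith

lemma pk_loop_sound (w T R0 K : ℕ) (hK : T ≤ 2 ^ K) (hR : R0 = pk_rep w K) :
    ∀ (l : List (ℕ × ℕ)) (B n V : ℕ),
    (V : ℤ) ≡ (∏ k ∈ Finset.Icc 1 n, (1 - ((2:ℤ)^w) ^ k)) [ZMOD ((2:ℤ)^w)^T] →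
    (∀ i, |a n i| ≤ 4 * B) →
    pk_loop w T (Nat.shiftLeft 1 (Nat.mul w T)) (Nat.sub (Nat.shiftLeft 1 (Nat.mul w T)) 1) R0 l B n V = true →
    (∀ j, j < l.length → Good (n + 2 * j)) ∧
    (∀ im, l.getLast? = some im → ∀ i, |a (n + 2 * (l.length - 1)) i| ≤ 3 * im.2) := by
  intro l
  induction l with
  | nil => intro B n V _ _ _; simp
  | cons im l ih =>
    intro B n V hV hB h
    rw [pk_loop, Bool.and_eq_true, Bool.and_eq_true] at h
    obtain ⟨h1, h2, h3⟩ := h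
    obtain ⟨hw, hg, hb⟩ := pk_chk_sound w T R0 n V im.1 im.2 B K h1 hK hR hV hB h2
    have hb' := bound_full n _ hb
    have hb2 : ∀ i, |a (n+2) i| ≤ 4 * ((3 * im.2 : ℕ) : ℤ) := by
      have := bound_two n _ hb'
      intro i; have := this i; push_cast; exact this
    have hs := pk_step_sound w T (Nat.add n 2) _ _ (pk_step_sound w T (Nat.add n 1) V _ hV)
    have hprod : (∏ k ∈ Finset.Icc 1 n, (1 - ((2:ℤ)^w) ^ k)) * (1 - ((2:ℤ)^w)^(Nat.add n 1)) *
        (1 - ((2:ℤ)^w)^(Nat.add n 2)) = ∏ k ∈ Finset.Icc 1 (n+2), (1 - ((2:ℤ)^w) ^ k) := by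
      rw [Finset.prod_Icc_succ_top (by omega : 1 ≤ n + 1 + 1), Finset.prod_Icc_succ_top (by omega : 1 ≤ n + 1)]
    rw [hprod] at hs
    obtain ⟨r1, r2⟩ := ih _ (n+2) _ hs hb2 h3
    constructor
    · intro j hj
      rcases Nat.eq_zero_or_pos j with rfl | hpos
      · simpa using hg
      · have := r1 (j-1) (by simp at hj; omega)
        rwa [show n + 2 + 2 * (j-1) = n + 2 * j by omega] at this
    · intro im' him
      cases l with
      | nil =>
        simp at him; subst him
        simpa using hb'
      | cons x l =>
        have := r2 im' (by simpa using him)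
        simp only [List.length_cons] at this ⊢
        intro i
        have := this i
        rwa [show n + 2 + 2 * (l.length + 1 - 1) = n + 2 * (l.length + 1 + 1 - 1) by omega] at this

/-- soundness of one block; `n0` is the last value of the previous block -/
lemma pk_block_sound (w n1 T K B : ℕ) (l : List (ℕ × ℕ)) (hn1 : Odd n1) (hlt : n1 ≤ 4096)
    (hB : ∀ i, |a n1 i| ≤ 4 * B)
    (h : pk_block w n1 T K B l = true) :
    (∀ j, j < l.length → Good (n1 + 2 * j)) ∧
    (∀ im, l.getLast? = some im → ∀ i, |a (n1 + 2 * (l.length - 1)) i| ≤ 3 * im.2) := by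
  rw [pk_block, Bool.and_eq_true, Nat.ble_eq] at h
  obtain ⟨h1, h2⟩ := h
  refine pk_loop_sound w T _ K h1 rfl l B n1 _ ?_ hB h2
  rw [land_mask, land_mask]
  have e2 : Nat.shiftLeft 1 (Nat.mul w T) = (2^w)^T := by
    show 1 <<< (w * T) = _
    rw [Nat.shiftLeft_eq, pow_mul, one_mul]
  have e3 : (2:ℕ)^(Nat.mul w T) = (2^w)^T := by
    show 2^(w*T) = _
    rw [pow_mul]
  rw [e2, e3]
  simp only [Nat.sub_eq]
  have hp : 0 < (2^w)^T := by positivity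
  have hlt2 := Nat.mod_lt (pk_tree w 12 1 n1) hp
  push_cast
  rw [Nat.cast_sub (by omega)]
  push_cast
  refine (Int.mod_modEq _ _).trans ?_
  have h0 : ((2:ℤ)^w)^T ≡ 0 [ZMOD ((2:ℤ)^w)^T] := by simp
  have h3 := h0.sub (Int.mod_modEq (pk_tree w 12 1 n1 : ℤ) (((2:ℤ)^w)^T))
  refine h3.trans (zmod_of_eq ?_)
  rw [pk_tree_eq w 12 1 n1 (by obtain ⟨k, hk⟩ := hn1; omega) (by norm_num; exact hlt), zero_sub]
  have h5 : (∏ k ∈ Finset.Icc 1 n1, (1 - ((2:ℤ)^w) ^ k)) = ∏ k ∈ Finset.range n1, (1 - ((2:ℤ)^w) ^ (1+k)) := by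
    rw [Finset.range_eq_Ico, Finset.prod_Ico_add (fun k => 1 - ((2:ℤ)^w)^(k)) 0 n1 1]
    rfl
  have h6 : ∀ k, (1 - ((2:ℤ)^w) ^ (1+k)) = (-1) * (((2:ℤ)^w) ^ (1+k) - 1) := by intro k; ring
  rw [h5, Finset.prod_congr rfl (fun k _ => h6 k), Finset.prod_mul_distrib, Finset.prod_const,
    Finset.card_range, hn1.neg_one_pow]
  ring

/-- packaged form -/
lemma pk_block_sound' (w n1 T K B cnt nl : ℕ) (im : ℕ × ℕ) (l : List (ℕ × ℕ)) (hn1 : Odd n1)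
    (hlt : n1 ≤ 4096) (hlen : l.length = cnt) (hl : l.getLast? = some im)
    (hnl : n1 + 2 * (cnt - 1) = nl)
    (hB : ∀ i, |a n1 i| ≤ 4 * B)
    (h : pk_block w n1 T K B l = true) :
    (∀ j, j < cnt → Good (n1 + 2 * j)) ∧ (∀ i, |a nl i| ≤ ((3 * im.2 : ℕ) : ℤ)) := by
  obtain ⟨h1, h2⟩ := pk_block_sound w n1 T K B l hn1 hlt hB h
  rw [hlen] at h1 h2
  rw [hnl] at h2
  refine ⟨h1, fun i => ?_⟩
  have := h2 im hl i
  push_cast; exact this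

end QP

namespace QP

/-- hints of block 0 -/
def pk_l0 : List (ℕ × ℕ) := [(303, 80),
  (339, 114),
  (378, 158),
  (418, 225),
  (459, 320),
  (503, 455),
  (549, 644),
  (596, 921),
  (647, 1321),
  (699, 1891),
  (752, 2711),
  (808, 3895),
  (867, 5591),
  (926, 8051),
  (988, 11624),
  (1052, 16765),
  (1117, 24185),
  (1185, 34967),
  (1255, 50563),
  (1327, 73204),
  (1401, 106106),
  (1477, 153816),
  (1555, 223031),
  (1635, 323699),
  (1717, 470145),
  (1800, 683108),
  (1886, 993497),
  (1974, 1445355),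
  (2064, 2103468),
  (2156, 3062815),
  (2250, 4461779),
  (2346, 6501853),
  (2443, 9478177),
  (2543, 13826598),
  (2645, 20176201),
  (2749, 29452205),
  (2855, 43007072),
  (2963, 62818238),
  (3073, 91781614),
  (3185, 134139614),
  (3298, 196119701),
  (3414, 286856063),
  (3532, 419679679),
  (3652, 614150982),
  (3774, 898947715),
  (3898, 1316123497),
  (4024, 1927340514),
  (4152, 2823028316),
  (4281, 4136484701),
  (4413, 6062487210),
  (4547, 8886989280),
  (4683, 13029930184),
  (4821, 19107817305),
  (4961, 28025873977),
  (5103, 41113532598),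
  (5246, 60325625136),
  (5392, 88540597644),
  (5540, 129972853884),
  (5690, 190823130300),
  (5842, 280205069161),
  (5996, 411515611615),
  (6152, 604450668499),
  (6310, 887970095011),
  (6469, 1304764665352),
  (6631, 1917536717740),
  (6795, 2818460465489),
  (6961, 4143200650043),
  (7129, 6091367379783),
  (7299, 8956687906910),
  (7471, 13171429861158),
  (7644, 19371944484655),
  (7820, 28497470294139),
  (7998, 41926393306973),
  (8178, 61690178249274),
  (8360, 90780191524035),
  (8544, 133601686933883),
  (8730, 196642695802984),
  (8918, 289459626086549),
  (9107, 426147890380828),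
  (9299, 627471879031651),
  (9493, 923993336285094),
  (9689, 1360765974044357),
  (9887, 2004183433491185),
  (10087, 2952094967690765),
  (10289, 4348719771319539),
  (10493, 6406637982598108),
  (10698, 9439862117003865),
  (10906, 13910400861352529),
  (11116, 20499743852326376),
  (11328, 30212838488923362),
  (11542, 44531615040980178),
  (11758, 65641532147250080),
  (11976, 96765790818164702),
  (12195, 142661473800098654),
  (12417, 210349906930652986),
  (12641, 310176194866123735),
  (12867, 457409019541258280),
  (13095, 674575724745256246),
  (13325, 994915110052644217),
  (13557, 1467473585685419720),
  (13791, 2164627276328404893),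
  (14026, 3193322337537243267),
  (14264, 4711247505841837544),
  (14504, 6951135252094886410),
  (14746, 10256563782204630940),
  (14990, 15134707579886935845),
  (15236, 22334275330099133659),
  (15484, 32960596490429880366),
  (15733, 48645979952987788090),
  (15985, 71802881418735983110),
  (16239, 105988939405405550547),
  (16495, 156459775053755111830),
  (16753, 230976643092204550149),
  (17013, 341001561507800796786),
  (17275, 503462748585955011607),
  (17539, 743362632594536576693),
  (17804, 1097659835101794923869),
  (18072, 1620930811479859469334),
  (18342, 2393769090175066942093),
  (18614, 3535256041218851532073),
  (18888, 5221317509100731836056),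
  (19164, 7711870350089486566072),
  (19442, 11390938256437102829746),
  (19721, 16825937686017864049841),
  (20003, 24856289262981527437218),
  (20287, 36720816431360920081995),
  (20573, 54250929149266010278020),
  (20861, 80153161112135676061322),
  (21151, 118427498847688255990428),
  (21443, 174985755026274613752904),
  (21737, 258565680724628266385114),
  (22032, 382088251735366504431685),
  (22330, 564654851127397795478410),
  (22630, 834486890569628679889232),
  (22932, 1233311780557190134848227),
  (23236, 1822816623162729148529589),
  (23542, 2694198900414560737582759),
  (23850, 3982288669446574153613223),
  (24160, 5886431152008723848697381),
  (24471, 8701610004851777597502104),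
  (24785, 12863673352654806016585845),
  (25101, 19017166533165277807401351),
  (25419, 28115245998122489540528956),
  (25739, 41567422324727329827733740),
  (26061, 61458122016675989954578587),
  (26385, 90869956628013087382526841),
  (26710, 134362951293130771691947491),
  (27038, 198683963386603117920750824),
  (27368, 293805696332619869119556784),
  (27700, 434481809036478799429487144),
  (28034, 642535086461102333439617383),
  (28370, 950245531988574733166924442),
  (28708, 1405362754365419196242239530),
  (29048, 2078521565938929727876292967),
  (29389, 3074271311060801524983286796),
  (29733, 4547227212127634862740327057),
  (30079, 6726110223583735210023939386),
  (30427, 9949335038419867050414634404),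
  (30777, 14717592448250659761469574758),
  (31129, 21771683954976862565291049008),
  (31483, 32207698658158273063964582543),
  (31838, 47647578452810575130063259341),
  (32196, 70492669772019854928797854753),
  (32556, 104293909916921442574738901957),
  (32918, 154307027947384246841845894057),
  (33282, 228309579257550173970711795878),
  (33648, 337811269907179138855376429224),
  (34016, 499845299552586116473644456777),
  (34386, 739619705739873434090531307811),
  (34757, 1094455062303234055680078998187),
  (35131, 1619583148632122844803715109626),
  (35507, 2396731904649910700904920216054),
  (35885, 3546879801532677361490899079588),
  (36265, 5249092253442771198038510765809),
  (36647, 7768417814312607593688159398594),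
  (37031, 11497184385203898810505391231156),
  (37417, 17016133516209003131291386831294),
  (37804, 25185434981401076126270651384706),
  (38194, 37277661854305702471955349763188),
  (38586, 55176977653103859600238556515042),
  (38980, 81672737051885389501436871106808),
  (39376, 120894402869760197791181759417474),
  (39774, 178955514575905959244581221733562),
  (40174, 264907167709634648787290896564365),
  (40575, 392152650909880776048655971102282),
  (40979, 580539250263220038875708470545910),
  (41385, 859443564204910263789515806631734),
  (41793, 1272367052378296648960213951606297),
  (42203, 1883721401850870882472012577135517),
  (42615, 2788881544011250051516952982360743),
  (43029, 4129072763334188600884474410158911),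
  (43445, 6113416841329103921552504737362357),
  (43862, 9051711932423784919195055585484837),
  (44282, 13402564552986978472383625708188330),
  (44704, 19845120952692773580340367518512609),
  (45128, 29385168840106797835896249692433439),
  (45554, 43512212552005070900908521364604395),
  (45982, 64432149551412270977020972881965884),
  (46412, 95411887912407554708416300679136597),
  (46843, 141290270082712509061114215108385076),
  (47277, 209235908402815449545645076387909732),
  (47713, 309861975297346174942007898528341134),
  (48151, 458889793676956504399518411024162726),
  (48591, 679604903913968241671213562876567169),
  (49033, 1006497143786916664013415590482885130),
  (49477, 1490652705015832764116913390004862279),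
  (49923, 2207741529569437034457131471216452350),
  (50370, 3269882377371415673937795764819433600),
  (50820, 4843131719012143977511095560193085191),
  (51272, 7173448399815156734754142603616252749),
  (51726, 10625201489925105553968728926985087880),
  (52182, 15738155011401559978812631056272021229),
  (52640, 23311910198313480371498666710259869377),
  (53100, 34531007852464440247062509828198516818),
  (53561, 51150307067287910969778281973638742305),
  (54025, 75770598097901061287050792016538878945),
  (54491, 112243261882698643552903730126408306810),
  (54959, 166274974950499599176749816871672129069),
  (55429, 246320470773455616119484060715302485210),
  (55901, 364906062561351925583321678921594253295),
  (56375, 540590693796683969169327053556695548129),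
  (56851, 800871650215570474454697629737592881507),
  (57328, 1186497869827333399095450386039424284668),
  (57808, 1757846710406666912611767989940165468593),
  (58290, 2604363954861631343530804197421746920081),
  (58774, 3858592783328445419224279927673584227857),
  (59260, 5716928687066460961242663033451154655334),
  (59748, 8470384339469597684479487354731864760001),
  (60238, 12550179363708113986812361331005382686994),
  (60730, 18595299717219726654225014065357636328118),
  (61223, 27552938773429549353164929209887852900422),
  (61719, 40826260136873207554216995118683540601719),
  (62217, 60494723215380377332208847125571766969033),
  (62717, 89639943936794878392986835308270703569446),
  (63219, 132828665030415634212147687988781144268191),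
  (63723, 196828576615506716246123955442625078311728),
  (64229, 291669200603260466214698029905601453436738),
  (64736, 432215856039056906275515335845189228914506),
  (65246, 640502086237255933234933739304441204311497),
  (65758, 949174986575516863069663511214144877647845),
  (66272, 1406623501374500657170583212336339697557354),
  (66788, 2084564164207235674132212075454617303263033),
  (67306, 3089288344289858428528504739679341096915777),
  (67826, 4578332925366691110898940088681137765747995),
  (68348, 6785189906771202888746945331054495948617408),
  (68871, 10056017979765442642544188446777648141844142),
  (69397, 14903801512400031187611388078529672431168764),
  (69925, 22088875715246819206948982960793907348986924),
  (70455, 32738265804862066315433301855710151324024559),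
  (70987, 48522503860665551932130346520140021561672422),
  (71521, 71917764439624319036068575938176019249234569),
  (72057, 106594443470048046188395047423595669516564486),
  (72594, 157993436333026454880011360986693500252352056),
  (73134, 234181715256571102275020275902678357252064461),
  (73676, 347114031581070191751878204404854078701403611),
  (74220, 514513266464541224264929687596793642424991139),
  (74766, 762651583737342680595309937539645958604960417),
  (75314, 1130474937475874448527101543429452495451729937),
  (75864, 1675717614981838344056999581313831968714756287),
  (76416, 2483967088740887012577939287773841105198563747),
  (76969, 3682124876023018238324471018292221126864983094),
  (77525, 5458309722049423964252494062259716799162702197),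
  (78083, 8091383669921179612096256265572954635944650154),
  (78643, 11994781592360972346472921172417253760910641635),
  (79205, 17781434664255443893892637306454973403870004923),
  (79769, 26360043936717145860392216341583929386823668681),
  (80335, 39077818606882396513828890824809950227074632421)]

set_option maxRecDepth 100000 in
def pk_b0 : PLift (pk_block 174 35 80515 17 8589934592 pk_l0 = true) := ⟨by decide +kernel⟩

lemma pk_s0 : (∀ j, j < 267 → Good (35 + 2 * j)) ∧
    (∀ i, |a 567 i| ≤ ((3 * 39077818606882396513828890824809950227074632421 : ℕ) : ℤ)) :=
  pk_block_sound' 174 35 80515 17 8589934592 267 567 (80335, 39077818606882396513828890824809950227074632421) pk_l0 (by decide) (by norm_num)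
    (by decide +kernel) (by decide +kernel) (by norm_num)
    (by
      intro i
      refine le_trans (pow_bound 35 i) ?_
      norm_num) pk_b0.down

/-- hints of block 1 -/
def pk_l1 : List (ℕ × ℕ) := [(80903, 57932106548717175597839983391115531260883905408),
  (81472, 85885015888345058279537301490576036575088134991),
  (82044, 127326925410368006956047704654535122919128080895),
  (82618, 188767747121003072093770866197752496814824156392),
  (83194, 279859463498482651006465857268818479770045836648),
  (83772, 414912808065389524560530077965131524591030007582),
  (84352, 615146136737804488398526124740143486859971060084),
  (84934, 912019977494924849344150281819802185923342714245),
  (85517, 1352186660496767521458307487363563212150736285300),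
  (86103, 2004822348531906483120516327437281394866381665244),
  (86691, 2972484554828730477912842338254674551941947552731),
  (87281, 4407250743698953626269441819972307368831124247705),
  (87873, 6534619905809221285759580605905370931136734013051),
  (88467, 9688963036964905430665572911424625125571431552041),
  (89063, 14366091904382714109246099663128240786417002303793),
  (89661, 21301212900181337010035343122352206950364690573348),
  (90260, 31584760465951686477861257876542551007991562828352),
  (90862, 46833409823730126701833358877355594404767440027271),
  (91466, 69444555772921715254684022145497032142412349023848),
  (92072, 102973350168866319434168317222364301944563421283778),
  (92680, 152691785240253781698974132205610628033336158372871),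
  (93290, 226417856358928719026401918292960951529886956176462),
  (93902, 335745210677902646400330486145242930977495060673807),
  (94515, 497867790535783611568855810360892010772652398421653),
  (95131, 738286836911104390118120040909258141475797728573737),
  (95749, 1094813795390689266438651176882418205861061194707382),
  (96369, 1623526636934084561255092646190821596527081320204699),
  (96991, 2407590259154134143665101473418737364479863327740887),
  (97615, 3570341180582604934646423612646366568277210406408617),
  (98241, 5294693489591085012746475485511786072631056043674477),
  (98869, 7851920113233952198564047574014047061016980164676858),
  (99498, 11644402602612090295512484508337995575547870525009735),
  (100130, 17268857332093010383920002634425779818662203219034493),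
  (100764, 25610250891225001920769092003459232284798089393372798),
  (101400, 37981130645016041233780611170100362050121903220336484),
  (102038, 56328184138628540005745859512789481504599411540323804),
  (102678, 83538640116257424344639023837600715815072052168219891),
  (103320, 123894726652741318652149424543368329192730237497780775),
  (103963, 183747860824780750942081061460737443893102735470325063),
  (104609, 272520120025322223789575154016961904620619661364907220),
  (105257, 404183450136812681563157361554338003430432487532367393),
  (105907, 599462665356844509854228126317907471414652952163227191),
  (106559, 889097512905074910248118599567784622234475083843549905),
  (107213, 1318682597857845993379079732916143168011650806981106982),
  (107869, 1955846478456061687407514602688680440534704747216524361),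
  (108527, 2900900553672905220365490834191033999754758828291334065),
  (109186, 4302651144513860197111887299082750872902694973664659465),
  (109848, 6381819985691399887842282982120780063425464484788366889),
  (110512, 9465781321652175148599868424109818441295083974879549620),
  (111178, 14040154011881104997007091154907982380461199415555182811),
  (111846, 20825275127571215185779645046657410136003401312282428470),
  (112516, 30889656524618514108617193447958754537182632681179284989),
  (113188, 45818287260409089477700118862502837583627949172805542335),
  (113862, 67962296665305448798998005931094703364470946311871115376)]

set_option maxRecDepth 100000 in
def pk_b1 : PLift (pk_block 205 569 114076 17 117233455820647189541486672474429850681223897263 pk_l1 = true) := ⟨by decide +kernel⟩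

lemma pk_s1 : (∀ j, j < 54 → Good (569 + 2 * j)) ∧
    (∀ i, |a 675 i| ≤ ((3 * 67962296665305448798998005931094703364470946311871115376 : ℕ) : ℤ)) :=
  pk_block_sound' 205 569 114076 17 117233455820647189541486672474429850681223897263 54 675 (113862, 67962296665305448798998005931094703364470946311871115376) pk_l1 (by decide) (by norm_num)
    (by decide +kernel) (by decide +kernel) (by norm_num)
    (fun i => bound_two 567 117233455820647189541486672474429850681223897263 (fun j => le_trans (pk_s0.2 j) (by norm_num)) i) pk_b1.down

/-- hints of block 2 -/
def pk_l2 : List (ℕ × ℕ) := [(114537, 100809976019524480928147112477846419843094719655668319137),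
  (115215, 149534897358691877574931502000675674746374389630392749371),
  (115895, 221811952577853393619504132813736274054309836904992280276),
  (116577, 329026335361076883577716115870423747821466814606276030050),
  (117261, 488067274633988995040521447012742571986003885917894874013),
  (117947, 723989079385198074369526907571145313820312380860681605272),
  (118635, 1073958811375571155652792474208096983523893611672784623078),
  (119324, 1593116496855182783982583260182727712282482658801684235724),
  (120016, 2363265986128531774649276285468739371889028589220851443225),
  (120710, 3505749496575957940141684556459462247895875832699557088068),
  (121406, 5200586795544558629053689332777073543879347669648916393974),
  (122104, 7714841293162532397048036952704756102962129143986889805350),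
  (122804, 11444710428679460354801146165378262427006561790457789101120),
  (123506, 16977970412979595334666293889206872129206557658325434597023),
  (124210, 25186619065318552374924273523781027750830108192273744942103),
  (124915, 37364508235213056819690310907196650037854795040388686787122),
  (125623, 55430960613291613478562434248049554267710460862340548027884),
  (126333, 82233467770790211176379972077378111154830980923499166045181),
  (127045, 121996636524050201384698137393536297125262400535629376812813),
  (127759, 180988153569431244053839375808524904151860202363958979370676),
  (128475, 268506911045137231229064659982124540539664925595182971164400),
  (129193, 398349064295271890948708942057659771838910823805314174126233),
  (129912, 590983897711268659643986258125845274904938366361669280328274),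
  (130634, 876784110354523586330097638288423344194844860490578297419244),
  (131358, 1300806323332078815622747482900831000585166312022971841950682),
  (132084, 1929903270169320371410989827600620549290185924283873962568783),
  (132812, 2863263824914801147364803715559249002880463534856377319912008),
  (133542, 4248054699103492714164189434681945804148746190582440118285451),
  (134274, 6302628827646168943227437927868428255651001265191229337855999),
  (135008, 9350961057193105959433554788827059953868317167698740479311481),
  (135743, 13873793374609755110425993118823387887932888667173057672111499),
  (136481, 20584392418151084493689333657977150214887008974769700887235503),
  (137221, 30541031782524758793313998503264581369173196077560527153283735),
  (137963, 45313975728100474549695003903718614998881088685479179520811971),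
  (138707, 67233145382911864490082928973619764711726140998856550887303502),
  (139453, 99755644474566205040761574829886084516034611801176190619130515)]

set_option maxRecDepth 100000 in
def pk_b2 : PLift (pk_block 226 677 139690 18 203886889995916346396994017793284110093412838935613346128 pk_l2 = true) := ⟨by decide +kernel⟩

lemma pk_s2 : (∀ j, j < 36 → Good (677 + 2 * j)) ∧
    (∀ i, |a 747 i| ≤ ((3 * 99755644474566205040761574829886084516034611801176190619130515 : ℕ) : ℤ)) :=
  pk_block_sound' 226 677 139690 18 203886889995916346396994017793284110093412838935613346128 36 747 (139453, 99755644474566205040761574829886084516034611801176190619130515) pk_l2 (by decide) (by norm_num)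
    (by decide +kernel) (by decide +kernel) (by norm_num)
    (fun i => bound_two 675 203886889995916346396994017793284110093412838935613346128 (fun j => le_trans (pk_s1.2 j) (by norm_num)) i) pk_b2.down

/-- hints of block 3 -/
def pk_l3 : List (ℕ × ℕ) := [(140201, 148011106154122955643332478027287247341832304069344932830890977),
  (140950, 219610938294848113402923399377107892374756877133380036304129519),
  (141702, 325850808819153017587074906970760696250390306265761842133132133),
  (142456, 483488730140475371555290380918332573724300840988801240773548614),
  (143212, 717392137838731884595371935011304827630968754415756834895552881),
  (143970, 1064460535506156431602283425600209376485027181266383387375672296),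
  (144730, 1579447521162765459413782355431920905328243132602192395012055570),
  (145492, 2343600109021840395801379353732366382690913943492729919077103864),
  (146256, 3477478719324268022522118954696376111938680147539457555086557848),
  (147021, 5159993840928073979552398802421891603326197647147429362181189539),
  (147789, 7656633015076850560903154473163912937119856675320628583053629999),
  (148559, 11361327692327801425800571659846862192799289919200725208462524408),
  (149331, 16858655525044201934188512858406420923754270983738296951260918234),
  (150105, 25016086676282115639515445586055314686596026505848155400146782340),
  (150881, 37120890400077355229602661884454154306567998358329307084589820800),
  (151659, 55083301485851267290364794097126069723188396038999662483707107137),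
  (152439, 81738016630696637071321931335551237807260967536254906476538562814),
  (153220, 121292173329489014147824487501419590129956617819835949665505230355),
  (154004, 179988300005286820666378869417843199053875700316507497280722470262),
  (154790, 267090397719489106938245827740140134389310024692471004345001349480),
  (155578, 396346262764407744309536801392333405799571589605675292102851522109),
  (156368, 588157641122025568713068264769967961744970874092164699349786849019),
  (157160, 872800916359442082756564705761565390509983218926391754133934566944),
  (157954, 1295206776304961114098743935355660025861740803616763413567343885593),
  (158749, 1922056374793196672902990106791457382153316548098492541303265616441),
  (159547, 2852312773101812184872678307674121231707710081185013586230817627923),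
  (160347, 4232827656230478400518639370123298900413539300335516130668456195696),
  (161149, 6281544351374163455840521503284662628875898563674406649945422734976)]

set_option maxRecDepth 100000 in
def pk_b3 : PLift (pk_block 242 749 161404 18 299266933423698615122284724489658253548103835403528571857391545 pk_l3 = true) := ⟨by decide +kernel⟩

lemma pk_s3 : (∀ j, j < 28 → Good (749 + 2 * j)) ∧
    (∀ i, |a 803 i| ≤ ((3 * 6281544351374163455840521503284662628875898563674406649945422734976 : ℕ) : ℤ)) :=
  pk_block_sound' 242 749 161404 18 299266933423698615122284724489658253548103835403528571857391545 28 803 (161149, 6281544351374163455840521503284662628875898563674406649945422734976) pk_l3 (by decide) (by norm_num)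
    (by decide +kernel) (by decide +kernel) (by norm_num)
    (fun i => bound_two 747 299266933423698615122284724489658253548103835403528571857391545 (fun j => le_trans (pk_s2.2 j) (by norm_num)) i) pk_b3.down

/-- hints of block 4 -/
def pk_l4 : List (ℕ × ℕ) := [(161953, 9321904961046067096490861859274855388134935354455728841279216072558),
  (162759, 13833921223189218353431745939168419141670033008588699147222858097942),
  (163567, 20529969476548335942457782209204301312496401202291383008039364129111),
  (164377, 30467279600429872612790799561325654052922618100601464847275748421644),
  (165188, 45215041157392542717695385275748633780398626916784234899395799149471),
  (166002, 67101949306689251097268558919881254414741359507814134126132469580466),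
  (166818, 99584022410154305130454187661865195832040186800133102927590917949431),
  (167636, 147790495535409716272145998107516936292359823560994383298064022464169),
  (168456, 219333844404834543206495300396064473292974341500171702195119772070590),
  (169278, 325512066717164388210151773736818410451232018341019142737172007362107),
  (170102, 483093085764628666416940651524971536348357621148819517445779978154992),
  (170927, 716963586275438128088754464152291696604380605707300153896079272897186),
  (171755, 1064063223482540631921160223987350512571347903504567681376811097917716),
  (172585, 1579210453547705331632268787045289026027843189284339752549955389094225),
  (173417, 2343769085388191693786790750118339498826107637191720525859331582222401),
  (174251, 3478498812091342070122020919792655071756892895590433725994758642415252),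
  (175087, 5162631364359080820162688324172344756438239521791664565047060138728802),
  (175925, 7662184088602610486055472112247889060329092431290600600431717628496828),
  (176765, 11371984279627799147283535614086154293441159058334536572900314696517173),
  (177606, 16878086490270167964317631025890712791746734173967163204507799278734674),
  (178450, 25050317319182938365370591887453922558681985112861215794724848354229349),
  (179296, 37179660080927025694719224664928036830428497413334576350739950816577027),
  (180144, 55182293945891405171325799593312657277489627140871042329718645137593804)]

set_option maxRecDepth 100000 in
def pk_b4 : PLift (pk_block 255 805 180413 18 18844633054122490367521564509853987886627695691023219949836268204928 pk_l4 = true) := ⟨by decide +kernel⟩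

lemma pk_s4 : (∀ j, j < 23 → Good (805 + 2 * j)) ∧
    (∀ i, |a 849 i| ≤ ((3 * 55182293945891405171325799593312657277489627140871042329718645137593804 : ℕ) : ℤ)) :=
  pk_block_sound' 255 805 180413 18 18844633054122490367521564509853987886627695691023219949836268204928 23 849 (180144, 55182293945891405171325799593312657277489627140871042329718645137593804) pk_l4 (by decide) (by norm_num)
    (by decide +kernel) (by decide +kernel) (by norm_num)
    (fun i => bound_two 803 18844633054122490367521564509853987886627695691023219949836268204928 (fun j => le_trans (pk_s3.2 j) (by norm_num)) i) pk_b4.down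

/-- hints of block 5 -/
def pk_l5 : List (ℕ × ℕ) := [(180994, 81902324938861296809992328773656928639953981288982251568151993686525271),
  (181846, 121561163106490389031322318456308513722908677285409124078549447504931697),
  (182700, 180424534151720384265527673948509470883615550236708948930951755969287627),
  (183556, 267792531102693513712777980315658070711051710590064208727105392638061814),
  (184413, 397470865584033016338741340994215021291012386200037519117974579185605220),
  (185273, 589948751772237076413504756401344786300165725522647049545851860979173357),
  (186135, 875639519587669292951319544230255511256202544832207517854892750393306547),
  (186999, 1299686164142850007538662036410209942030288317314275827995081288710991096),
  (187865, 1929095394601478748972068921384248490247144240412719006660853700193110764),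
  (188733, 2863327158051621880815709256681095219525437238152231880145263588898292413),
  (189603, 4250013339960538728891450155019039798344279318302004569274590120403932910),
  (190474, 6308300657800844038375936169894489731252463548602018023485734897470179276),
  (191348, 9363487410090666203646802306429997843980629612126513264555159609323202522),
  (192224, 13898402734714717747575330468904036621604318492722125131393570526665595752),
  (193102, 20629759290947669941760802689593453825261240146851627375115466815431909296),
  (193982, 30621427284638013532709342721108809763567878225271362291117379791462378908),
  (194864, 45452595927737135591790667961665292891821082261009523543484159248029174945),
  (195748, 67467394906856981235798613845981219558074467878762819207321108581271069940),
  (196634, 100145437977473483907176746374358744494490586758155005628281979182646896769),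
  (197521, 148652364867781494032497590378023433162613301835335813154110884072275530823)]

set_option maxRecDepth 100000 in
def pk_b5 : PLift (pk_block 266 851 197803 18 165546881837674215513977398779937971832468881422613126989155935412781412 pk_l5 = true) := ⟨by decide +kernel⟩

lemma pk_s5 : (∀ j, j < 20 → Good (851 + 2 * j)) ∧
    (∀ i, |a 889 i| ≤ ((3 * 148652364867781494032497590378023433162613301835335813154110884072275530823 : ℕ) : ℤ)) :=
  pk_block_sound' 266 851 197803 18 165546881837674215513977398779937971832468881422613126989155935412781412 20 889 (197521, 148652364867781494032497590378023433162613301835335813154110884072275530823) pk_l5 (by decide) (by norm_num)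
    (by decide +kernel) (by decide +kernel) (by norm_num)
    (fun i => bound_two 849 165546881837674215513977398779937971832468881422613126989155935412781412 (fun j => le_trans (pk_s4.2 j) (by norm_num)) i) pk_b5.down

/-- hints of block 6 -/
def pk_l6 : List (ℕ × ℕ) := [(198411, 220655504005450327401002580332032371981760328877142478694174190239577560217),
  (199303, 327536459932931558038518009773623584956658515824829898292995033605961919986),
  (200197, 486190505719678459326135464486286828285590701355278930149667678972081798865),
  (201093, 721697543705928887467511004290341732234708545894382757041442436024598751795),
  (201991, 1071287172195661248181487826356534754864939242202567910491372230469251033625),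
  (202891, 1590224717287793014755302142647126891871728860396135573718109006607798819413),
  (203792, 2360551099708443948606839410798807101582550986113255474940614847845179034541),
  (204696, 3504060054237422902645134498498319055436398900679010513863918680159218958978),
  (205602, 5201535395574251864699344337455499900704621224019510949826576583847813099120),
  (206510, 7721353791498731581259149791811966248193768771481961761015855419928038103017),
  (207420, 11461915878522163969832150785092422792217537524735129111994309237494540505892),
  (208332, 17014643167965780362879143391219472989402996263376847480162326996073689878848),
  (209246, 25257498287456747615730683306524772639134353223970812151334310153876394570100),
  (210162, 37493818332229674271359078517808958125610581746960619854745204757387855827546),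
  (211079, 55658557336796550479288629072180204926612280036917064098371660534212939223204),
  (211999, 82624078862643786785331455141458212541494750820313743372552846196590042674877),
  (212921, 122654400841576746063803972201143733376719747286410654596041041431947136757401),
  (213845, 182079668050164239714607821100713770961927629718120919426386480920907882415000)]

set_option maxRecDepth 100000 in
def pk_b6 : PLift (pk_block 277 891 214138 18 445957094603344482097492771134070299487839905506007439462332652216826592469 pk_l6 = true) := ⟨by decide +kernel⟩

lemma pk_s6 : (∀ j, j < 18 → Good (891 + 2 * j)) ∧
    (∀ i, |a 925 i| ≤ ((3 * 182079668050164239714607821100713770961927629718120919426386480920907882415000 : ℕ) : ℤ)) :=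
  pk_block_sound' 277 891 214138 18 445957094603344482097492771134070299487839905506007439462332652216826592469 18 925 (213845, 182079668050164239714607821100713770961927629718120919426386480920907882415000) pk_l6 (by decide) (by norm_num)
    (by decide +kernel) (by decide +kernel) (by norm_num)
    (fun i => bound_two 889 445957094603344482097492771134070299487839905506007439462332652216826592469 (fun j => le_trans (pk_s5.2 j) (by norm_num)) i) pk_b6.down

/-- hints of block 7 -/
def pk_l7 : List (ℕ × ℕ) := [(214771, 270297219219091301750729554071387569317494748905797741344062817135187211202530),
  (215699, 401257814905822538155529481864595261838656354559748480652354416595276870596249),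
  (216629, 595672053503203530017815170929661419828235148472880271281213891494279372359749),
  (217560, 884286210097894495533849388365275868542825989675983063645845099439298263965414),
  (218494, 1312749203738818886904587737053862557133214390030052067937712167325350482905015),
  (219430, 1948823188798368480907879068663639238052519205197708986162087314663971757812109),
  (220368, 2893109504344509561209166297789269689376503608422275590265981257413836207295301),
  (221308, 4294959353883829725190887151966145100329236554192125842130857861802051605426455),
  (222250, 6376098115414382589574505668156334621586909021349527073451570510141846446371293),
  (223194, 9465698472505431076848709156753818377557670813488721499805463279287901600383853),
  (224140, 14052450899133508263564241653161922157098153895104204721773875793622410394107143),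
  (225087, 20861906242695078532835937575217248215839949075347246618911932159275096102971444),
  (226037, 30971227226691939210437398700120868562641772828011036748110718587593672891826097),
  (226989, 45979531924682269579511267825824552864131730767149367756068181117353802652658000),
  (227943, 68260957800864271744402481711252252457883153313671648554335264404179700459287503),
  (228899, 101340234525765086668977015716280722872174383090712944727005183313618395568423825)]

set_option maxRecDepth 100000 in
def pk_b7 : PLift (pk_block 286 927 229202 18 546239004150492719143823463302141312885782889154362758279159442762723647245000 pk_l7 = true) := ⟨by decide +kernel⟩

lemma pk_s7 : (∀ j, j < 16 → Good (927 + 2 * j)) ∧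
    (∀ i, |a 957 i| ≤ ((3 * 101340234525765086668977015716280722872174383090712944727005183313618395568423825 : ℕ) : ℤ)) :=
  pk_block_sound' 286 927 229202 18 546239004150492719143823463302141312885782889154362758279159442762723647245000 16 957 (228899, 101340234525765086668977015716280722872174383090712944727005183313618395568423825) pk_l7 (by decide) (by norm_num)
    (by decide +kernel) (by decide +kernel) (by norm_num)
    (fun i => bound_two 925 546239004150492719143823463302141312885782889154362758279159442762723647245000 (fun j => le_trans (pk_s6.2 j) (by norm_num)) i) pk_b7.down

/-- hints of block 8 -/
def pk_l8 : List (ℕ × ℕ) := [(229857, 150450322209115826778113432523519852592140973729505914038033694429856067004022519),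
  (230817, 223360320386233207317899415414118785689448758034927782156862263165115390481636433),
  (231779, 331604644594536503227427385784281602057331344479093984113216570726325971084223103),
  (232742, 492309531655863694145598006577728128838911513575845189500416569502520194257119607),
  (233708, 730899515174838727637786624752922003080908712694577179891783130429977181174617234),
  (234676, 1085122463966570346702114590123179799995208168126285190389661228606341569649311455),
  (235646, 1611022034453177655756752144084771748430509997999347594417801354522682983001329985),
  (236618, 2391805428673762124234776520823312206857058585390132307384885429191226939422493618),
  (237592, 3551009626244731904829817692036822866009852258958254048419744025901091239173684178),
  (238568, 5272049537739287181493003136249653519353715312745893449854731610741467565663561485),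
  (239545, 7827250456461156694971371564572069436387535928255862725853819472448822559793477437),
  (240525, 11620948483866010392123712513727603696495868172191152510902430162955072602092232269),
  (241507, 17253433114511899837360343436965741749820235527892163690508965725412838755857912218),
  (242491, 25615985669049152241267268597702043032503413064746060435591391175271544748676570708),
  (243477, 38031916606430374423740413312997812093516925843308747769780314425620752019017078870)]

set_option maxRecDepth 100000 in
def pk_b8 : PLift (pk_block 294 959 243790 18 304020703577295260006931047148842168616523149272138834181015549940855186705271475 pk_l8 = true) := ⟨by decide +kernel⟩

lemma pk_s8 : (∀ j, j < 15 → Good (959 + 2 * j)) ∧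
    (∀ i, |a 987 i| ≤ ((3 * 38031916606430374423740413312997812093516925843308747769780314425620752019017078870 : ℕ) : ℤ)) :=
  pk_block_sound' 294 959 243790 18 304020703577295260006931047148842168616523149272138834181015549940855186705271475 15 987 (243477, 38031916606430374423740413312997812093516925843308747769780314425620752019017078870) pk_l8 (by decide) (by norm_num)
    (by decide +kernel) (by decide +kernel) (by norm_num)
    (fun i => bound_two 957 304020703577295260006931047148842168616523149272138834181015549940855186705271475 (fun j => le_trans (pk_s7.2 j) (by norm_num)) i) pk_b8.down

/-- hints of block 9 -/
def pk_l9 : List (ℕ × ℕ) := [(244465, 56465989255473519598610157706245984354621220480904383817626370130126823410260321349),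
  (245455, 83835363925510585316089127892864718549038758164460207121589714457111730501478474036),
  (246447, 124471277104182397326083419206610785887373972380427412353854057080329588537959344106),
  (247440, 184804986642401105665954135687827875443081905019922850161274276771697582442621889725),
  (248436, 274384856354071072105014679389870483366681270474379080446042756374454802618472772923),
  (249434, 407387917319202780348867540491756947528357436003389395118620355546897689095093492074),
  (250434, 604863945732749425484789155041844199173245188652032771211526472931297361504516481639)]

set_option maxRecDepth 100000 in
def pk_b9 : PLift (pk_block 298 989 250751 18 114095749819291123271221239938993436280550777529926243309340943276862256057051236610 pk_l9 = true) := ⟨by decide +kernel⟩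

lemma pk_s9 : (∀ j, j < 7 → Good (989 + 2 * j)) ∧
    (∀ i, |a 1001 i| ≤ ((3 * 604863945732749425484789155041844199173245188652032771211526472931297361504516481639 : ℕ) : ℤ)) :=
  pk_block_sound' 298 989 250751 18 114095749819291123271221239938993436280550777529926243309340943276862256057051236610 7 1001 (250434, 604863945732749425484789155041844199173245188652032771211526472931297361504516481639) pk_l9 (by decide) (by norm_num)
    (by decide +kernel) (by decide +kernel) (by norm_num)
    (fun i => bound_two 987 114095749819291123271221239938993436280550777529926243309340943276862256057051236610 (fun j => le_trans (pk_s8.2 j) (by norm_num)) i) pk_b9.down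

/-- small odd `n` -/
lemma good_small (n : ℕ) (hodd : Odd n) (h1 : 35 ≤ n) (h2 : n ≤ 1001) : Good n := by
  obtain ⟨k, hk⟩ := hodd
  by_cases c0 : n < 569
  · have := pk_s0.1 ((n - 35) / 2) (by omega)
    rwa [show 35 + 2 * ((n - 35) / 2) = n by omega] at this
  by_cases c1 : n < 677
  · have := pk_s1.1 ((n - 569) / 2) (by omega)
    rwa [show 569 + 2 * ((n - 569) / 2) = n by omega] at this
  by_cases c2 : n < 749
  · have := pk_s2.1 ((n - 677) / 2) (by omega)
    rwa [show 677 + 2 * ((n - 677) / 2) = n by omega] at this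
  by_cases c3 : n < 805
  · have := pk_s3.1 ((n - 749) / 2) (by omega)
    rwa [show 749 + 2 * ((n - 749) / 2) = n by omega] at this
  by_cases c4 : n < 851
  · have := pk_s4.1 ((n - 805) / 2) (by omega)
    rwa [show 805 + 2 * ((n - 805) / 2) = n by omega] at this
  by_cases c5 : n < 891
  · have := pk_s5.1 ((n - 851) / 2) (by omega)
    rwa [show 851 + 2 * ((n - 851) / 2) = n by omega] at this
  by_cases c6 : n < 927
  · have := pk_s6.1 ((n - 891) / 2) (by omega)
    rwa [show 891 + 2 * ((n - 891) / 2) = n by omega] at this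
  by_cases c7 : n < 959
  · have := pk_s7.1 ((n - 927) / 2) (by omega)
    rwa [show 927 + 2 * ((n - 927) / 2) = n by omega] at this
  by_cases c8 : n < 989
  · have := pk_s8.1 ((n - 959) / 2) (by omega)
    rwa [show 959 + 2 * ((n - 959) / 2) = n by omega] at this
  have := pk_s9.1 ((n - 989) / 2) (by omega)
  rwa [show 989 + 2 * ((n - 989) / 2) = n by omega] at this

end QP

/-! ### Fourier representation -/
namespace QP
open Real MeasureTheory intervalIntegral

/-- The sine product in the rescaled variable. -/
noncomputable def W (n : ℕ) (x : ℝ) : ℝ := ∏ k ∈ Finset.Icc 1 n, (2 * Real.sin (k * x / n))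

/-- The sine transform of `W`. -/
noncomputable def G (n : ℕ) (v : ℝ) : ℝ := ∫ x in (0:ℝ)..(n * π / 2), W n x * Real.sin (v * x)

lemma W_cont (n : ℕ) : Continuous (W n) := by
  unfold W
  refine continuous_finsetProd _ fun k _ => ?_
  fun_prop

lemma W_odd (n : ℕ) (hodd : Odd n) (x : ℝ) : W n (-x) = - W n x := by
  unfold W
  have : ∀ k ∈ Finset.Icc 1 n, 2 * Real.sin (k * (-x) / n) = (-1) * (2 * Real.sin (k * x / n)) := by
    intro k _
    rw [show (k:ℝ) * (-x) / n = -(k * x / n) by ring, Real.sin_neg]; ring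
  rw [Finset.prod_congr rfl this, Finset.prod_mul_distrib]
  simp [hodd.neg_one_pow]

lemma poly_eval (n : ℕ) (z : ℂ) :
    ∑ j ∈ Finset.range (n*(n+1)/2+1), (a n j : ℂ) * z^j = ∏ k ∈ Finset.Icc 1 n, (1 - z^k) := by
  set P : ℤ[X] := ∏ k ∈ Finset.Icc 1 n, (1 - (X : ℤ[X])^k) with hP
  have hdeg : P.natDegree < n*(n+1)/2+1 := by
    refine Nat.lt_succ_of_le ?_
    rw [Polynomial.natDegree_le_iff_coeff_eq_zero]
    intro m hm
    exact a_eq_zero n m hm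
  have h1 := Polynomial.eval₂_eq_sum_range' (Int.castRingHom ℂ) hdeg z
  have h2 : Polynomial.eval₂ (Int.castRingHom ℂ) z P = ∏ k ∈ Finset.Icc 1 n, (1 - z^k) := by
    rw [hP, Polynomial.eval₂_finsetProd]
    simp
  rw [← h2, h1]
  rfl

lemma one_sub_exp (t : ℝ) : 1 - Complex.exp (2 * t * Complex.I) =
    (-Complex.I) * Complex.exp (t * Complex.I) * ((2 * Real.sin t : ℝ) : ℂ) := by
  push_cast
  rw [Complex.sin, show (2:ℂ) * t * Complex.I = t * Complex.I + t * Complex.I by ring, Complex.exp_add,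
    show -(t:ℂ) * Complex.I = -(t * Complex.I) by ring, Complex.exp_neg]
  have h := Complex.exp_ne_zero (t * Complex.I)
  field_simp
  ring_nf
  simp only [Complex.I_sq]
  ring

lemma exp_int_integral (n : ℕ) (hn : 1 ≤ n) (m : ℤ) :
    ∫ x in (-(n * π / 2) : ℝ)..(n * π / 2), Complex.exp ((2 * m / n * Complex.I) * x) =
      if m = 0 then ((n * π : ℝ) : ℂ) else 0 := by
  have hn0 : (n:ℂ) ≠ 0 := by exact_mod_cast (by omega : n ≠ 0)
  split_ifs with h
  · subst h
    simp
  · have hm : (m:ℂ) ≠ 0 := by exact_mod_cast h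
    rw [integral_exp_mul_complex (by simp [hm, hn0])]
    have e : Complex.exp (2 * m / n * Complex.I * ((n * π / 2 : ℝ) : ℂ)) =
        Complex.exp (2 * m / n * Complex.I * ((-(n * π / 2) : ℝ) : ℂ)) := by
      rw [Complex.exp_eq_exp_iff_exists_int]
      refine ⟨m, ?_⟩
      push_cast
      field_simp
      ring
    rw [e]; simp

lemma prod_exp (n : ℕ) (x : ℝ) :
    ∏ k ∈ Finset.Icc 1 n, (1 - Complex.exp (2 * x / n * Complex.I) ^ k) =
      (-Complex.I)^n * Complex.exp (((n * (n+1) / 2 : ℕ) : ℝ) / n * x * Complex.I) * (W n x : ℂ) := by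
  have h : ∀ m : ℕ, ∏ k ∈ Finset.Icc 1 m, (1 - Complex.exp (2 * x / n * Complex.I) ^ k) =
      (-Complex.I)^m * Complex.exp (((m * (m+1) / 2 : ℕ) : ℝ) / n * x * Complex.I) *
        ((∏ k ∈ Finset.Icc 1 m, (2 * Real.sin (k * x / n)) : ℝ) : ℂ) := by
    intro m
    induction m with
    | zero => simp
    | succ m ih =>
      rw [Finset.prod_Icc_succ_top (by omega), ih, Finset.prod_Icc_succ_top (by omega), tri_succ]
      have e1 : Complex.exp (2 * x / n * Complex.I) ^ (m+1) =
          Complex.exp (2 * (((m+1 : ℕ) : ℝ) * x / n : ℝ) * Complex.I) := by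
        rw [← Complex.exp_nat_mul]
        congr 1
        push_cast
        ring
      rw [e1, one_sub_exp]
      have e2 : Complex.exp (((m * (m+1) / 2 + (m+1) : ℕ) : ℝ) / n * x * Complex.I) =
        Complex.exp (((m * (m+1) / 2 : ℕ) : ℝ) / n * x * Complex.I) *
          Complex.exp ((((m+1 : ℕ) : ℝ) * x / n : ℝ) * Complex.I) := by
        rw [← Complex.exp_add]
        congr 1
        push_cast
        ring
      rw [e2]
      push_cast
      ring
  exact h n

lemma fourier (n : ℕ) (hodd : Odd n) (hn : 1 ≤ n) (i : ℕ) (hi : i ≤ n*(n+1)/2) :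
    |(a n i : ℝ)| = 2 / (n * π) * |G n ((((n*(n+1)/2 : ℕ) : ℝ) - 2 * i) / n)| := by
  set N := n*(n+1)/2 with hN
  set v : ℝ := ((N:ℝ) - 2 * i) / n with hv
  set R : ℝ := n * π / 2 with hR
  have hn0 : (n:ℂ) ≠ 0 := by exact_mod_cast (by omega : n ≠ 0)
  have hnr : (0:ℝ) < n := by exact_mod_cast hn
  have key : ∫ x in (-R)..R, (∏ k ∈ Finset.Icc 1 n, (1 - Complex.exp (2 * x / n * Complex.I) ^ k)) *
      Complex.exp (-(2 * i / n * x * Complex.I)) = a n i * ((n * π : ℝ) : ℂ) := by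
    have e : ∀ x : ℝ, (∏ k ∈ Finset.Icc 1 n, (1 - Complex.exp (2 * x / n * Complex.I) ^ k)) *
      Complex.exp (-(2 * i / n * x * Complex.I)) =
      ∑ j ∈ Finset.range (N+1), (a n j : ℂ) * Complex.exp ((2 * ((j:ℤ) - (i:ℤ) : ℤ) / n * Complex.I) * x) := by
      intro x
      rw [← poly_eval, Finset.sum_mul]
      refine Finset.sum_congr rfl fun j _ => ?_
      rw [mul_assoc, ← Complex.exp_nat_mul, ← Complex.exp_add]
      congr 2
      push_cast
      ring
    simp_rw [e]
    rw [intervalIntegral.integral_finsetSum]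
    · have : ∀ j ∈ Finset.range (N+1), ∫ x in (-R)..R, (a n j : ℂ) * Complex.exp ((2 * ((j:ℤ) - (i:ℤ) : ℤ) / n * Complex.I) * x)
        = if j = i then (a n j : ℂ) * ((n * π : ℝ) : ℂ) else 0 := by
        intro j _
        rw [intervalIntegral.integral_const_mul, exp_int_integral n hn]
        by_cases hji : j = i
        · simp [hji]
        · have : (j:ℤ) - i ≠ 0 := by omega
          simp [hji, this]
      rw [Finset.sum_congr rfl this, Finset.sum_ite_eq' ]
      rw [if_pos (Finset.mem_range.2 (by omega))]
    · intro j _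
      apply Continuous.intervalIntegrable
      fun_prop
  have key2 : ∀ x : ℝ, (∏ k ∈ Finset.Icc 1 n, (1 - Complex.exp (2 * x / n * Complex.I) ^ k)) *
      Complex.exp (-(2 * i / n * x * Complex.I)) =
      (-Complex.I)^n * (((W n x * Real.cos (v * x) : ℝ) : ℂ) + ((W n x * Real.sin (v * x) : ℝ):ℂ) * Complex.I) := by
    intro x
    rw [prod_exp n]
    have : Complex.exp ((N:ℝ) / n * x * Complex.I) * Complex.exp (-(2 * i / n * x * Complex.I)) =
       Complex.cos ((v * x : ℝ)) + Complex.sin ((v*x : ℝ)) * Complex.I := by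
      rw [← Complex.exp_mul_I, ← Complex.exp_add]
      congr 1
      rw [hv]
      push_cast
      field_simp
      ring
    rw [mul_right_comm, mul_assoc ((-Complex.I)^n), this]
    push_cast
    ring
  simp_rw [key2] at key
  rw [intervalIntegral.integral_const_mul, intervalIntegral.integral_add, intervalIntegral.integral_ofReal,
    intervalIntegral.integral_mul_const, intervalIntegral.integral_ofReal] at key
  rotate_left
  · apply Continuous.intervalIntegrable
    have := W_cont n
    fun_prop
  · apply Continuous.intervalIntegrable
    have := W_cont n
    fun_prop
  have hodd0 : ∫ x in (-R)..R, W n x * Real.cos (v * x) = 0 := by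
    have h := intervalIntegral.integral_comp_neg (a := -R) (b := R) (fun x => W n x * Real.cos (v * x))
    simp only [neg_neg, W_odd n hodd, mul_neg, Real.cos_neg, neg_mul, intervalIntegral.integral_neg] at h
    linarith
  have heven : ∫ x in (-R)..R, W n x * Real.sin (v * x) = 2 * G n v := by
    have hc : Continuous (fun x => W n x * Real.sin (v * x)) := by
      have := W_cont n
      fun_prop
    have h := intervalIntegral.integral_comp_neg (a := 0) (b := R) (fun x => W n x * Real.sin (v * x))
    simp only [neg_zero, W_odd n hodd, mul_neg, Real.sin_neg, neg_mul, neg_neg] at h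
    rw [← intervalIntegral.integral_add_adjacent_intervals (hc.intervalIntegrable (-R) 0) (hc.intervalIntegrable 0 R), ← h]
    unfold G
    ring
  rw [hodd0, heven] at key
  have key3 := congrArg (fun z : ℂ => ‖z‖) key
  simp only [norm_mul, norm_pow, norm_neg, Complex.norm_I, one_pow, Complex.ofReal_zero, zero_add,
    Complex.norm_real, Real.norm_eq_abs, Complex.norm_intCast, mul_one, one_mul, abs_two] at key3
  rw [abs_of_pos Real.pi_pos, abs_of_pos hnr] at key3
  field_simp
  linarith

lemma G_diff (n : ℕ) (v δ : ℝ) : G n (v + δ) - G n (v - δ) =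
    2 * ∫ x in (0:ℝ)..(n * π / 2), W n x * Real.sin (δ * x) * Real.cos (v * x) := by
  have hW := W_cont n
  unfold G
  rw [← intervalIntegral.integral_sub, ← intervalIntegral.integral_const_mul]
  · congr 1
    ext x
    rw [add_mul, sub_mul, Real.sin_add, Real.sin_sub]
    ring
  · apply Continuous.intervalIntegrable
    fun_prop
  · apply Continuous.intervalIntegrable
    fun_prop

end QP
/-! ### Minor arcs -/
namespace QP
open Real MeasureTheory intervalIntegral

/-- Alternating Taylor bounds for sine and cosine. -/
lemma sincos_alt (m : ℕ) : (∀ x : ℝ, 0 ≤ x → 0 ≤ (-1)^(m+1) * (Real.cos x - ∑ j ∈ Finset.range (m+1), (-1)^j * x^(2*j) / (2*j).factorial)) ∧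
    (∀ x : ℝ, 0 ≤ x → 0 ≤ (-1)^(m+1) * (Real.sin x - ∑ j ∈ Finset.range (m+1), (-1)^j * x^(2*j+1) / (2*j+1).factorial)) := by
  have mono : ∀ f f' : ℝ → ℝ, (∀ x, HasDerivAt f (f' x) x) → f 0 = 0 → (∀ x, 0 ≤ x → 0 ≤ f' x) → ∀ x, 0 ≤ x → 0 ≤ f x := by
    intro f f' hd h0 hp x hx
    have : MonotoneOn f (Set.Ici 0) := by
      apply monotoneOn_of_deriv_nonneg (convex_Ici 0)
      · exact fun y _ => (hd y).continuousAt.continuousWithinAt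
      · exact fun y _ => (hd y).differentiableAt.differentiableWithinAt
      · intro y hy
        rw [(hd y).deriv]
        rw [interior_Ici] at hy
        exact hp y (le_of_lt hy)
    have := this (Set.self_mem_Ici) hx hx
    rwa [h0] at this
  have stepS : ∀ m : ℕ, (∀ x : ℝ, 0 ≤ x → 0 ≤ (-1)^(m+1) * (Real.cos x - ∑ j ∈ Finset.range (m+1), (-1)^j * x^(2*j) / (2*j).factorial)) →
     (∀ x : ℝ, 0 ≤ x → 0 ≤ (-1)^(m+1) * (Real.sin x - ∑ j ∈ Finset.range (m+1), (-1)^j * x^(2*j+1) / (2*j+1).factorial)) := by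
    intro m h
    refine mono _ _ (fun x => ?_) ?_ h
    · apply HasDerivAt.const_mul
      apply HasDerivAt.sub (Real.hasDerivAt_sin x)
      apply HasDerivAt.fun_sum
      intro j _
      have := ((hasDerivAt_pow (2*j+1) x).const_mul ((-1:ℝ)^j)).div_const ((2*j+1).factorial : ℝ)
      refine this.congr_deriv ?_
      rw [Nat.factorial_succ]
      have h1 : ((2*j).factorial : ℝ) ≠ 0 := by positivity
      have h2 : ((2*j:ℕ):ℝ)+1 ≠ 0 := by positivity
      push_cast
      push_cast at h2
      field_simp
    · simp
  induction m with
  | zero =>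
    have h : ∀ x : ℝ, 0 ≤ x → 0 ≤ (-1)^(0+1) * (Real.cos x - ∑ j ∈ Finset.range (0+1), (-1)^j * x^(2*j) / (2*j).factorial) := by
      intro x _
      have := Real.cos_le_one x
      simp; linarith
    exact ⟨h, stepS 0 h⟩
  | succ m ih =>
    have h : ∀ x : ℝ, 0 ≤ x → 0 ≤ (-1)^(m+1+1) * (Real.cos x - ∑ j ∈ Finset.range (m+1+1), (-1)^j * x^(2*j) / (2*j).factorial) := by
      refine mono _ _ (fun x => ?_) ?_ ih.2
      · have e : (-1:ℝ)^(m+1) * (Real.sin x - ∑ j ∈ Finset.range (m+1), (-1)^j * x^(2*j+1) / (2*j+1).factorial)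
          = (-1)^(m+1+1) * (-Real.sin x - (∑ j ∈ Finset.range (m+1), (-1)^(j+1) * x^(2*j+1) / (2*j+1).factorial + 0)) := by
          have : ∑ j ∈ Finset.range (m+1), (-1:ℝ)^(j+1) * x^(2*j+1) / (2*j+1).factorial = - ∑ j ∈ Finset.range (m+1), (-1:ℝ)^j * x^(2*j+1) / (2*j+1).factorial := by
            rw [← Finset.sum_neg_distrib]
            refine Finset.sum_congr rfl fun j _ => ?_
            ring
          rw [this]; ring
        rw [e]
        apply HasDerivAt.const_mul
        apply HasDerivAt.sub (Real.hasDerivAt_cos x)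
        simp_rw [Finset.sum_range_succ' _ (m+1)]
        apply HasDerivAt.add
        · apply HasDerivAt.fun_sum
          intro j _
          have := ((hasDerivAt_pow (2*j+1+1) x).const_mul ((-1:ℝ)^(j+1))).div_const ((2*(j+1)).factorial : ℝ)
          refine this.congr_deriv ?_
          rw [show 2*(j+1) = (2*j+1)+1 by ring, Nat.factorial_succ]
          have h1 : ((2*j+1).factorial : ℝ) ≠ 0 := by positivity
          have h2 : ((2*j+1:ℕ):ℝ)+1 ≠ 0 := by positivity
          push_cast
          push_cast at h2
          field_simp
        · simp [hasDerivAt_const]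
      · rw [Finset.sum_range_succ']
        simp
    exact ⟨h, stepS _ h⟩

lemma sin_ge7 {x : ℝ} (hx : 0 ≤ x) : x - x^3/6 + x^5/120 - x^7/5040 ≤ Real.sin x := by
  have := (sincos_alt 3).2 x hx
  simp [Finset.sum_range_succ, Nat.factorial] at this
  linarith

lemma cos_ge2 (x : ℝ) : 1 - x^2/2 ≤ Real.cos x := Real.one_sub_sq_div_two_le_cos

lemma cos_le4 {x : ℝ} (hx : 0 ≤ x) : Real.cos x ≤ 1 - x^2/2 + x^4/24 := by
  have := (sincos_alt 2).1 x hx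
  simp [Finset.sum_range_succ, Nat.factorial] at this
  linarith

/-- Negated cosine sum. -/
noncomputable def TT (n : ℕ) (φ : ℝ) : ℝ := -∑ k ∈ Finset.Icc 1 n, Real.cos (k * φ)

lemma TT_closed (n : ℕ) (φ : ℝ) : 2 * Real.sin (φ/2) * TT n φ = Real.sin (φ/2) - Real.sin ((n + 1/2) * φ) := by
  unfold TT
  induction n with
  | zero => simp; ring_nf
  | succ n ih =>
    rw [Finset.sum_Icc_succ_top (by omega), neg_add, mul_add, ih]
    have h : 2 * Real.sin (φ/2) * Real.cos (((n+1:ℕ):ℝ) * φ) = Real.sin (((n+1:ℕ) + 1/2) * φ) - Real.sin ((n+1/2) * φ) := by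
      have e1 : (((n+1:ℕ):ℝ) + 1/2) * φ = ((n+1:ℕ):ℝ) * φ + φ/2 := by ring
      have e2 : ((n:ℝ) + 1/2) * φ = ((n+1:ℕ):ℝ) * φ - φ/2 := by push_cast; ring
      rw [e1, e2, Real.sin_add, Real.sin_sub]; ring
    linarith

lemma TT_bound (n : ℕ) (φ s : ℝ) (hs : 0 < s) (h : s ≤ |Real.sin (φ/2)|) : TT n φ ≤ 1/2 + 1/(2*s) := by
  have hc := TT_closed n φ
  have h0 : Real.sin (φ/2) ≠ 0 := by intro h'; rw [h'] at h; simp at h; linarith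
  have e : TT n φ = 1/2 - Real.sin ((n + 1/2) * φ) / (2 * Real.sin (φ/2)) := by
    generalize Real.sin ((n + 1/2) * φ) = S0 at hc ⊢
    field_simp; linarith
  rw [e]
  have : |Real.sin ((n + 1/2) * φ) / (2 * Real.sin (φ/2))| ≤ 1/(2*s) := by
    rw [abs_div, abs_mul, abs_two]
    have := Real.abs_sin_le_one ((n + 1/2) * φ)
    gcongr
  have := abs_le.1 this
  linarith [this.1]

lemma inv_sin_bound {y : ℝ} (h0 : 0 < y) (h1 : y ≤ 5/2) : 1 / (2 * Real.sin y) ≤ 1/(2*y) + 2*y/7 := by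
  have h := sin_ge7 h0.le
  have hs : 0 < Real.sin y := Real.sin_pos_of_pos_of_lt_pi h0 (by linarith [Real.pi_gt_three])
  rw [div_add_div _ _ (by positivity) (by positivity), div_le_div_iff₀ (by positivity) (by positivity)]
  have hp : 7 * y ≤ (y - y^3/6 + y^5/120 - y^7/5040) * (7 + 4*y^2) := by
    have : 0 ≤ 17/6 - (73/120)*y^2 + (161/5040) * y^4 - y^6/1260 := by
      set s := y^2 with hs
      have hs1 : s ≤ 25/4 := by rw [hs]; nlinarith
      have hs0 : 0 ≤ s := by positivity
      rw [show y^4 = s^2 by rw [hs]; ring, show y^6 = s^3 by rw [hs]; ring]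
      nlinarith [mul_nonneg hs0 (sub_nonneg.2 hs1), mul_nonneg (mul_nonneg hs0 (sub_nonneg.2 hs1)) hs0, sq_nonneg (s-5), mul_nonneg hs0 (sq_nonneg (s-6))]
    have := mul_nonneg (pow_pos h0 3).le this
    nlinarith
  have h7 : 0 < 7 + 4*y^2 := by positivity
  have := mul_le_mul_of_nonneg_right h h7.le
  nlinarith

/-- Refined bound for small arguments. -/
lemma TT_small (n : ℕ) (φ σ : ℝ) (h0 : 0 < φ) (h1 : φ ≤ 5) (hσ : 0 ≤ σ) (hσ1 : σ ≤ 1)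
    (h : - Real.sin ((n + 1/2) * φ) ≤ σ) : TT n φ ≤ 1/2 + φ/7 + (σ / ((n+1/2) * φ)) * (n + 1/2) := by
  have hc := TT_closed n φ
  have hs : 0 < Real.sin (φ/2) := Real.sin_pos_of_pos_of_lt_pi (by linarith) (by linarith [Real.pi_gt_three])
  have e : TT n φ = 1/2 + (- Real.sin ((n + 1/2) * φ)) * (1 / (2 * Real.sin (φ/2))) := by
    generalize Real.sin ((n + 1/2) * φ) = S0 at hc ⊢
    field_simp; linarith
  rw [e]
  have hb := inv_sin_bound (y := φ/2) (by linarith) (by linarith)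
  have hp : 0 < 1 / (2 * Real.sin (φ/2)) := by positivity
  have e2 : (σ / ((n+1/2) * φ)) * (n + 1/2) = σ * (1/(2*(φ/2))) := by
    have : ((n:ℝ)+1/2) ≠ 0 := by positivity
    field_simp
  rw [e2]
  have : (- Real.sin ((n + 1/2) * φ)) * (1 / (2 * Real.sin (φ/2))) ≤ σ * (1/(2*(φ/2)) + 2*(φ/2)/7) :=
    le_trans (mul_le_mul_of_nonneg_right h hp.le) (mul_le_mul_of_nonneg_left hb hσ)
  nlinarith

lemma neg_sin_le {u : ℝ} (hu : 0 ≤ u) : - Real.sin u ≤ 0.2185 * u := by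
  have hp := Real.pi_gt_d4
  have hp2 := Real.pi_lt_d4
  rcases le_or_gt u π with h | h
  · have := Real.sin_nonneg_of_nonneg_of_le_pi hu h
    linarith
  rcases le_or_gt u (3*π/2) with h2 | h2
  · have e : - Real.sin u = Real.cos (3*π/2 - u) := by
      rw [show 3*π/2 - u = π/2 - (u - π) by ring, Real.cos_pi_div_two_sub, Real.sin_sub_pi]
    rw [e]
    set s := 3*π/2 - u with hs
    have h0 : 0 ≤ s := by linarith
    have h1 : s ≤ 1.571 := by linarith
    have := cos_le4 h0
    have hu' : u = 3*π/2 - s := by rw [hs]; ring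
    rw [hu']
    have : 1 - s^2/2 + s^4/24 ≤ 0.2185 * (4.7122 - s) := by
      nlinarith [sq_nonneg (s - 0.22), sq_nonneg (s*(s-0.22)), mul_nonneg h0 (sub_nonneg.2 h1), mul_nonneg (mul_nonneg h0 (sub_nonneg.2 h1)) h0, mul_nonneg (mul_nonneg (mul_nonneg h0 (sub_nonneg.2 h1)) h0) h0]
    linarith
  · have := Real.neg_one_le_sin u
    nlinarith

lemma TT_neg (n : ℕ) (φ : ℝ) : TT n (-φ) = TT n φ := by
  unfold TT
  simp [Real.cos_neg]

lemma TT_add_int (n : ℕ) (φ : ℝ) (m : ℤ) : TT n (φ + m * (2*π)) = TT n φ := by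
  unfold TT
  congr 1
  refine Finset.sum_congr rfl fun k _ => ?_
  rw [show (k:ℝ) * (φ + m * (2*π)) = k * φ + ((k*m : ℤ):ℝ) * (2*π) by push_cast; ring, Real.cos_add_int_mul_two_pi]

lemma TT_le (n : ℕ) (hn : 1000 ≤ n) (φ : ℝ) : TT n φ ≤ 0.22 * n + 1 := by
  have hn' : (1000:ℝ) ≤ n := by exact_mod_cast hn
  have hp := Real.pi_gt_d2
  have hp2 := Real.pi_lt_d2
  have main : ∀ φ : ℝ, 0 ≤ φ → φ ≤ π → TT n φ ≤ 0.22 * n + 1 := by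
    intro φ h0 h1
    rcases h0.eq_or_lt with h | h
    · rw [← h]; simp [TT]; linarith
    · rcases le_or_gt φ 1 with h2 | h2
      · have := TT_small n φ (min 1 (0.2185 * ((n+1/2) * φ))) h (by linarith) (by positivity) (min_le_left _ _)
          (le_min (by linarith [Real.neg_one_le_sin ((n+1/2) * φ)]) (neg_sin_le (by positivity)))
        refine this.trans ?_
        have : min 1 (0.2185 * ((n+1/2) * φ)) / ((n+1/2) * φ) ≤ 0.2185 := by
          rw [div_le_iff₀ (by positivity)]
          exact min_le_right _ _
        nlinarith
      · have h3 : 0.3 ≤ |Real.sin (φ/2)| := by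
          have := sin_ge7 (x := 1/2) (by norm_num)
          have h4 : Real.sin (1/2) ≤ Real.sin (φ/2) := by
            apply Real.sin_le_sin_of_le_of_le_pi_div_two <;> linarith
          refine le_trans ?_ (le_abs_self _)
          norm_num at this
          linarith
        have := TT_bound n φ 0.3 (by norm_num) h3
        norm_num at this ⊢
        linarith
  have e : φ = (φ - round (φ/(2*π)) * (2*π)) + round (φ/(2*π)) * (2*π) := by ring
  have hr := abs_sub_round (φ/(2*π))
  have hb : |φ - round (φ/(2*π)) * (2*π)| ≤ π := by
    have : φ - round (φ/(2*π)) * (2*π) = (φ/(2*π) - round (φ/(2*π))) * (2*π) := by field_simp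
    rw [this, abs_mul, abs_of_pos (by positivity : 0 < 2*π)]
    nlinarith
  rw [e, TT_add_int]
  rcases le_total 0 (φ - round (φ/(2*π)) * (2*π)) with h | h
  · rw [abs_of_nonneg h] at hb
    exact main _ h hb
  · rw [abs_of_nonpos h] at hb
    rw [← TT_neg]
    exact main _ (by linarith) hb

end QP
namespace QP
open Real MeasureTheory intervalIntegral

lemma hasSum_log_norm (ρ t : ℝ) (h0 : 0 < ρ) (h1 : ρ < 1) :
    HasSum (fun j : ℕ => -(ρ^j / j * Real.cos (j * t))) (Real.log ‖1 - (ρ:ℂ) * Complex.exp (t * Complex.I)‖) := by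
  have hz : ‖(ρ:ℂ) * Complex.exp (t * Complex.I)‖ < 1 := by
    rw [norm_mul, Complex.norm_exp_ofReal_mul_I]; simp [abs_of_pos h0, h1]
  have h := Complex.hasSum_re (Complex.hasSum_taylorSeries_neg_log hz)
  have h2 := h.neg
  rw [Complex.neg_re, Complex.log_re, neg_neg] at h2
  refine h2.congr_fun ?_
  intro j
  rw [mul_pow, ← Complex.exp_nat_mul, ← mul_assoc, show ((j:ℂ) * t) = ((j * t : ℝ) : ℂ) by push_cast; rfl,
    Complex.exp_mul_I, ← Complex.ofReal_cos, ← Complex.ofReal_sin, ← Complex.ofReal_pow, ← Complex.ofReal_natCast]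
  have : ((ρ^j : ℝ) : ℂ) * (((Real.cos (j*t) : ℝ):ℂ) + ((Real.sin (j*t):ℝ):ℂ) * Complex.I) / ((j:ℝ):ℂ) =
    ((ρ^j / j * Real.cos (j*t) : ℝ) : ℂ) + ((ρ^j / j * Real.sin (j*t) : ℝ) : ℂ) * Complex.I := by
    push_cast; ring
  rw [this]
  simp [-Complex.ofReal_mul, -Complex.ofReal_div, -Complex.ofReal_cos, -Complex.ofReal_sin, -Complex.ofReal_pow]

lemma abs_two_sin_le (ρ t : ℝ) (h0 : 0 < ρ) (h1 : ρ < 1) :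
    |2 * Real.sin (t/2)| ≤ Real.exp (-(1/2) * Real.log ρ + Real.log ‖1 - (ρ:ℂ) * Complex.exp (t * Complex.I)‖) := by
  have hn : ‖1 - (ρ:ℂ) * Complex.exp (t * Complex.I)‖^2 = 1 - 2 * ρ * Real.cos t + ρ^2 := by
    rw [Complex.sq_norm, Complex.normSq_apply, Complex.exp_mul_I, ← Complex.ofReal_cos, ← Complex.ofReal_sin]
    simp [-Complex.ofReal_cos, -Complex.ofReal_sin]
    nlinarith [Real.sin_sq_add_cos_sq t]
  have hc := Real.cos_le_one t
  have hpos : 0 < ‖1 - (ρ:ℂ) * Complex.exp (t * Complex.I)‖ := by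
    have h : 0 < ‖1 - (ρ:ℂ) * Complex.exp (t * Complex.I)‖^2 := by
      rw [hn]; nlinarith [sq_pos_of_pos (sub_pos.2 h1)]
    exact lt_of_le_of_ne (norm_nonneg _) (Ne.symm (sq_pos_iff.1 h))
  rw [Real.exp_add, Real.exp_log hpos]
  have e1 : Real.exp (-(1/2) * Real.log ρ) ^ 2 = ρ⁻¹ := by
    rw [← Real.exp_nat_mul, show ((2:ℕ):ℝ) * (-(1/2) * Real.log ρ) = -Real.log ρ by push_cast; ring, Real.exp_neg, Real.exp_log h0]
  refine abs_le_of_sq_le_sq ?_ (by positivity)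
  rw [mul_pow, mul_pow, e1, hn]
  have e2 : 2^2 * Real.sin (t/2)^2 = 2 - 2 * Real.cos t := by
    have := Real.cos_sq' (t/2)
    have h2 := Real.cos_two_mul (t/2)
    rw [show 2 * (t/2) = t by ring] at h2
    nlinarith
  rw [e2, inv_mul_eq_div, le_div_iff₀ h0]
  nlinarith [sq_nonneg (1-ρ)]

lemma smooth (n : ℕ) (hn : 1000 ≤ n) (θ ρ : ℝ) (h0 : 0 < ρ) (h1 : ρ < 1) (J : ℕ) :
    |∏ k ∈ Finset.Icc 1 n, (2 * Real.sin (k * θ / 2))| ≤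
      Real.exp (-(n/2) * Real.log ρ + ∑ j ∈ Finset.range J, ρ^(j+1) / (j+1) * TT n ((j+1) * θ)
        + (0.22 * n + 1) * (ρ^(J+1) / ((J+1) * (1-ρ)))) := by
  have hs : HasSum (fun j : ℕ => ρ^j / j * TT n (j * θ))
      (∑ k ∈ Finset.Icc 1 n, Real.log ‖1 - (ρ:ℂ) * Complex.exp ((k * θ : ℝ) * Complex.I)‖) := by
    have := hasSum_sum (s := Finset.Icc 1 n) (fun k _ => hasSum_log_norm ρ (k * θ) h0 h1)
    refine this.congr_fun ?_
    intro j
    unfold TT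
    rw [mul_neg, Finset.mul_sum, ← Finset.sum_neg_distrib]
    refine Finset.sum_congr rfl fun k _ => ?_
    rw [show (k:ℝ) * (j * θ) = j * (k * θ) by ring]
  have hs1 := (hasSum_nat_add_iff' (J+1)).2 hs
  have hgeo : HasSum (fun j : ℕ => (0.22 * n + 1) * (ρ^(J+1) / (J+1) * ρ^j)) ((0.22 * n + 1) * (ρ^(J+1) / (J+1) * (1-ρ)⁻¹)) :=
    ((hasSum_geometric_of_lt_one h0.le h1).mul_left _).mul_left _
  have hle := hasSum_le (fun j => ?_) hs1 hgeo
  · have e : ∑ j ∈ Finset.range (J+1), ρ^j / j * TT n (j * θ) = ∑ j ∈ Finset.range J, ρ^(j+1) / (j+1) * TT n ((j+1) * θ) := by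
      rw [Finset.sum_range_succ']
      simp
    rw [e] at hle
    rw [Finset.abs_prod]
    calc ∏ k ∈ Finset.Icc 1 n, |2 * Real.sin (k * θ / 2)|
        ≤ ∏ k ∈ Finset.Icc 1 n, Real.exp (-(1/2) * Real.log ρ + Real.log ‖1 - (ρ:ℂ) * Complex.exp ((k * θ : ℝ) * Complex.I)‖) :=
          Finset.prod_le_prod (fun _ _ => abs_nonneg _) (fun k _ => abs_two_sin_le ρ (k*θ) h0 h1)
      _ = Real.exp (-(n/2) * Real.log ρ + ∑ k ∈ Finset.Icc 1 n, Real.log ‖1 - (ρ:ℂ) * Complex.exp ((k * θ : ℝ) * Complex.I)‖) := by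
          rw [← Real.exp_sum, Finset.sum_add_distrib]
          simp
          ring
      _ ≤ _ := by
          rw [Real.exp_le_exp]
          have : (0.22 * (n:ℝ) + 1) * (ρ^(J+1) / ((J+1) * (1-ρ))) = (0.22 * n + 1) * (ρ^(J+1) / (J+1) * (1-ρ)⁻¹) := by
            rw [div_mul_eq_div_div]; rfl
          rw [this]
          linarith
  · have hT := TT_le n hn (((j + (J+1) : ℕ) : ℝ) * θ)
    have hw : ρ^(j+(J+1)) / ((j + (J+1) : ℕ) : ℝ) ≤ ρ^(J+1) / (J+1) * ρ^j := by
      rw [pow_add, mul_comm (ρ^j), div_mul_eq_mul_div]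
      have : ((J:ℝ)+1) ≤ ((j + (J+1) : ℕ) : ℝ) := by push_cast; linarith [Nat.cast_nonneg (α := ℝ) j]
      gcongr
    have hwp : 0 ≤ ρ^(j+(J+1)) / ((j + (J+1) : ℕ) : ℝ) := by positivity
    calc ρ^(j+(J+1)) / ((j + (J+1) : ℕ) : ℝ) * TT n (((j + (J+1) : ℕ) : ℝ) * θ)
        ≤ ρ^(j+(J+1)) / ((j + (J+1) : ℕ) : ℝ) * (0.22 * n + 1) := by gcongr
      _ ≤ (ρ^(J+1) / (J+1) * ρ^j) * (0.22 * n + 1) := by gcongr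
      _ = _ := by ring

/-- Block lemma: at most one resonant frequency in each block of length `m`. -/
lemma block_sum (n : ℕ) (hn : 1000 ≤ n) (θ ρ s : ℝ) (h0 : 0 < ρ) (h1 : ρ < 1) (hs : 0 < s) (m K : ℕ) (hm : 1 ≤ m)
    (hgap : ∀ i : ℕ, 1 ≤ i → i < m → 2 * s ≤ |Real.sin (i * θ / 2)|) :
    ∑ j ∈ Finset.range (m*K+(m-1)), ρ^(j+1) / (j+1) * TT n ((j+1) * θ) ≤
      (1/2 + 1/(2*s)) * ∑ j ∈ Finset.range (m*K+(m-1)), ρ^(j+1) / (j+1) +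
      (0.22 * n + 1) * ∑ i ∈ Finset.range K, ρ^(m*(i+1)) / (m*(i+1)) := by
  classical
  set A := 1/2 + 1/(2*s) with hA
  have hApos : 0 < A := by positivity
  set D := (Finset.range (m*K+(m-1))).filter (fun j => |Real.sin (((j+1:ℕ):ℝ) * θ / 2)| < s) with hD
  have hτ : (0:ℝ) ≤ 0.22 * n + 1 := by positivity
  have step1 : ∑ j ∈ Finset.range (m*K+(m-1)), ρ^(j+1) / (j+1) * TT n ((j+1) * θ) ≤
      ∑ j ∈ Finset.range (m*K+(m-1)), (A * (ρ^(j+1) / (j+1)) + if |Real.sin (((j+1:ℕ):ℝ) * θ / 2)| < s then (0.22 * n + 1) * (ρ^(j+1) / (j+1)) else 0) := by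
    refine Finset.sum_le_sum fun j _ => ?_
    have hw : 0 ≤ ρ^(j+1) / ((j:ℝ)+1) := by positivity
    split_ifs with h
    · have := TT_le n hn (((j:ℝ)+1) * θ)
      nlinarith [mul_le_mul_of_nonneg_left this hw, mul_nonneg hApos.le hw]
    · push Not at h
      have := TT_bound n (((j:ℝ)+1) * θ) s hs (by push_cast at h; exact h)
      nlinarith [mul_le_mul_of_nonneg_left this hw]
  refine step1.trans ?_
  rw [Finset.sum_add_distrib, ← Finset.mul_sum, ← Finset.sum_filter, ← Finset.mul_sum]
  gcongr
  have hdiff : ∀ j1 j2 : ℕ, j1 < j2 → j2 < j1 + m → |Real.sin (((j1:ℕ):ℝ) * θ / 2)| < s → |Real.sin (((j2:ℕ):ℝ) * θ / 2)| < s → False := by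
    intro j1 j2 h12 hlt hs1 hs2
    have := hgap (j2 - j1) (by omega) (by omega)
    rw [Nat.cast_sub h12.le, show ((j2:ℝ) - j1) * θ / 2 = j2 * θ / 2 - j1 * θ / 2 by ring, Real.sin_sub] at this
    have hb : |Real.sin (j2 * θ / 2) * Real.cos (j1 * θ / 2) - Real.cos (j2 * θ / 2) * Real.sin (j1 * θ / 2)| < 2 * s := by
      calc _ ≤ |Real.sin (j2 * θ / 2) * Real.cos (j1 * θ / 2)| + |Real.cos (j2 * θ / 2) * Real.sin (j1 * θ / 2)| := abs_sub _ _
        _ ≤ |Real.sin (j2 * θ / 2)| + |Real.sin (j1 * θ / 2)| := by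
            rw [abs_mul, abs_mul]
            have c1 := Real.abs_cos_le_one (j1 * θ / 2)
            have c2 := Real.abs_cos_le_one (j2 * θ / 2)
            have := abs_nonneg (Real.sin (j1 * θ / 2))
            have := abs_nonneg (Real.sin (j2 * θ / 2))
            nlinarith
        _ < 2 * s := by linarith
    linarith
  have hz : ∀ j ∈ D, m ≤ j + 1 := by
    intro j hj
    rw [hD, Finset.mem_filter] at hj
    by_contra hlt
    push Not at hlt
    have := hgap (j+1) (by omega) hlt
    linarith [hj.2]
  have hinj : Set.InjOn (fun j => (j+1)/m - 1) (D : Set ℕ) := by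
    intro j1 hj1 j2 hj2 he
    have hz1 := hz j1 hj1
    have hz2 := hz j2 hj2
    simp only [hD, Finset.coe_filter, Set.mem_ofPred_eq] at hj1 hj2
    have q1 : 1 ≤ (j1+1)/m := (Nat.one_le_div_iff (by omega)).2 hz1
    have q2 : 1 ≤ (j2+1)/m := (Nat.one_le_div_iff (by omega)).2 hz2
    have hq : (j1+1)/m = (j2+1)/m := by simp only at he; omega
    have d1 := Nat.div_add_mod (j1+1) m
    have d2 := Nat.div_add_mod (j2+1) m
    have r1 := Nat.mod_lt (j1+1) (by omega : m > 0)
    have r2 := Nat.mod_lt (j2+1) (by omega : m > 0)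
    rw [hq] at d1
    rcases lt_trichotomy j1 j2 with h | h | h
    · exact (hdiff (j1+1) (j2+1) (by omega) (by omega) hj1.2 hj2.2).elim
    · exact h
    · exact (hdiff (j2+1) (j1+1) (by omega) (by omega) hj2.2 hj1.2).elim
  calc ∑ j ∈ D, ρ^(j+1) / ((j:ℝ)+1) ≤ ∑ j ∈ D, (fun i : ℕ => ρ^(m*(i+1)) / ((m:ℝ)*((i:ℝ)+1))) ((j+1)/m - 1) := by
        refine Finset.sum_le_sum fun j hj => ?_
        have q1 : 1 ≤ (j+1)/m := (Nat.one_le_div_iff (by omega)).2 (hz j hj)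
        simp only
        have hle : m * ((j+1)/m - 1 + 1) ≤ j+1 := by
          rw [Nat.sub_add_cancel q1]; exact Nat.mul_div_le _ _
        have hle' : (m:ℝ) * ((((j+1)/m - 1 : ℕ):ℝ) + 1) ≤ (j:ℝ)+1 := by exact_mod_cast hle
        have hp := pow_le_pow_of_le_one h0.le h1.le hle
        have hm' : (0:ℝ) < m := by exact_mod_cast hm
        gcongr
    _ = ∑ i ∈ D.image (fun j => (j+1)/m - 1), ρ^(m*(i+1)) / ((m:ℝ)*((i:ℝ)+1)) := by
        rw [Finset.sum_image hinj]
    _ ≤ ∑ i ∈ Finset.range K, ρ^(m*(i+1)) / ((m:ℝ)*((i:ℝ)+1)) := by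
        refine Finset.sum_le_sum_of_subset_of_nonneg ?_ (fun i _ _ => by positivity)
        intro i hi
        rw [Finset.mem_image] at hi
        obtain ⟨j, hj, rfl⟩ := hi
        have q1 : 1 ≤ (j+1)/m := (Nat.one_le_div_iff (by omega)).2 (hz j hj)
        rw [hD, Finset.mem_filter, Finset.mem_range] at hj
        rw [Finset.mem_range]
        have : (j+1)/m < K + 1 := by
          rw [Nat.div_lt_iff_lt_mul (by omega)]
          have := hj.1
          have e : (K+1)*m = m*K + m := by ring
          omega
        omega

end QP
namespace QP
open Real MeasureTheory intervalIntegral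

lemma neg_log_le {q y : ℝ} (hq : 0 < q) (h : q⁻¹ ≤ 1 + y + y^2/2 + y^3/6) (hy : 0 ≤ y) : - Real.log q ≤ y := by
  rw [← Real.log_inv, Real.log_le_iff_le_exp (by positivity)]
  refine h.trans ?_
  have := Real.sum_le_exp_of_nonneg hy 4
  simp [Finset.sum_range_succ, Nat.factorial] at this
  linarith

lemma sin_ge_of_mem {a y : ℝ} (ha : 0 ≤ a) (h1 : a ≤ y) (h2 : y ≤ π - a) : Real.sin a ≤ Real.sin y := by
  rcases le_total y (π/2) with h | h
  · apply Real.sin_le_sin_of_le_of_le_pi_div_two <;> linarith [Real.pi_pos]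
  · rw [← Real.sin_pi_sub y]
    apply Real.sin_le_sin_of_le_of_le_pi_div_two <;> linarith [Real.pi_pos]

lemma caseB (n : ℕ) (hn : 1003 ≤ n) (θ s S2 : ℝ) (hs : 0 < s) (m K : ℕ) (hm : 1 ≤ m)
    (hgap : ∀ i : ℕ, 1 ≤ i → i < m → 2 * s ≤ |Real.sin (i * θ / 2)|)
    (hS1 : ∑ j ∈ Finset.range (m*K+(m-1)), (22/25:ℝ)^(j+1) / (j+1) ≤ 2.1203)
    (hS2 : ∑ i ∈ Finset.range K, (22/25:ℝ)^(m*(i+1)) / (m*(i+1)) ≤ S2)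
    (hJ : 59 ≤ m*K+(m-1)) :
    |∏ k ∈ Finset.Icc 1 n, (2 * Real.sin (k * θ / 2))| ≤
      Real.exp (0.06395 * n + (1/2+1/(2*s)) * 2.1203 + (0.22 * n + 1) * (S2 + 0.0001)) := by
  refine (smooth n (by omega) θ (22/25) (by norm_num) (by norm_num) (m*K+(m-1))).trans ?_
  rw [Real.exp_le_exp]
  have hb := block_sum n (by omega) θ (22/25) s (by norm_num) (by norm_num) hs m K hm hgap
  have hl : - Real.log (22/25) ≤ 0.1279 := neg_log_le (by norm_num) (by norm_num) (by norm_num)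
  have hn0 : (0:ℝ) ≤ n := by positivity
  have hA : 0 < 1/2+1/(2*s) := by positivity
  have hτ : (0:ℝ) < 0.22 * n + 1 := by positivity
  have ht : (22/25:ℝ)^((m*K+(m-1))+1) / ((((m*K+(m-1) : ℕ):ℝ)+1) * (1-22/25)) ≤ 0.0001 := by
    have h1 : (22/25:ℝ)^((m*K+(m-1))+1) ≤ (22/25:ℝ)^60 := pow_le_pow_of_le_one (by norm_num) (by norm_num) (by omega)
    have h2 : (60:ℝ) ≤ ((m*K+(m-1) : ℕ):ℝ)+1 := by exact_mod_cast Nat.succ_le_succ hJ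
    rw [div_le_iff₀ (by positivity)]
    have h3 : (22/25:ℝ)^60 ≤ 0.0005 := by norm_num
    nlinarith
  have := mul_le_mul_of_nonneg_left hS1 hA.le
  have := mul_le_mul_of_nonneg_left hS2 hτ.le
  have := mul_le_mul_of_nonneg_left ht hτ.le
  have := mul_le_mul_of_nonneg_left hl hn0
  rw [mul_add]
  linarith

lemma caseB1 (n : ℕ) (hn : 1003 ≤ n) (θ : ℝ) (h1 : 0.05 ≤ θ) (h2 : θ ≤ 0.2 * π) :
    |∏ k ∈ Finset.Icc 1 n, (2 * Real.sin (k * θ / 2))| ≤ Real.exp (0.16 * n + 4) := by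
  have hn' : (1003:ℝ) ≤ n := by exact_mod_cast hn
  have hp := Real.pi_gt_d2
  refine (caseB n hn θ 0.01249 0.0327 (by norm_num) 10 5 (by norm_num) ?_ ?_ ?_ (by norm_num)).trans ?_
  · intro i hi1 hi2
    have hi1' : (1:ℝ) ≤ i := by exact_mod_cast hi1
    have hi2' : (i:ℝ) ≤ 9 := by exact_mod_cast (by omega : i ≤ 9)
    have h := sin_ge_of_mem (a := 0.025) (y := i * θ / 2) (by norm_num) (by nlinarith) (by nlinarith)
    have h3 := sin_ge7 (x := 0.025) (by norm_num)
    refine le_trans ?_ (le_abs_self _)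
    norm_num at h3 ⊢
    linarith
  · have : (∑ j ∈ Finset.range 59, (22/25:ℚ)^(j+1) / (j+1)) ≤ 21203/10000 := by decide +kernel
    have := (Rat.cast_le (K := ℝ)).2 this
    push_cast at this
    norm_num at this ⊢
  · have : (∑ i ∈ Finset.range 5, (22/25:ℚ)^(10*(i+1)) / (10*(i+1))) ≤ 327/10000 := by decide +kernel
    have := (Rat.cast_le (K := ℝ)).2 this
    push_cast at this
    norm_num at this ⊢
  · rw [Real.exp_le_exp]; norm_num; linarith

lemma caseB3 (n : ℕ) (hn : 1003 ≤ n) (θ : ℝ) (h1 : 0.2 * π ≤ θ) (h2 : θ ≤ 0.9 * π) :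
    |∏ k ∈ Finset.Icc 1 n, (2 * Real.sin (k * θ / 2))| ≤ Real.exp (0.16 * n + 4) := by
  have hn' : (1003:ℝ) ≤ n := by exact_mod_cast hn
  have hp := Real.pi_gt_d2
  refine (caseB n hn θ 0.15 0.382 (by norm_num) 3 20 (by norm_num) ?_ ?_ ?_ (by norm_num)).trans ?_
  · intro i hi1 hi2
    have hi1' : (1:ℝ) ≤ i := by exact_mod_cast hi1
    have hi2' : (i:ℝ) ≤ 2 := by exact_mod_cast (by omega : i ≤ 2)
    have h := sin_ge_of_mem (a := 0.314) (y := i * θ / 2) (by norm_num) (by nlinarith) (by nlinarith)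
    have h3 := sin_ge7 (x := 0.314) (by norm_num)
    refine le_trans ?_ (le_abs_self _)
    norm_num at h3 ⊢
    linarith
  · have : (∑ j ∈ Finset.range 62, (22/25:ℚ)^(j+1) / (j+1)) ≤ 21203/10000 := by decide +kernel
    have := (Rat.cast_le (K := ℝ)).2 this
    push_cast at this
    norm_num at this ⊢
  · have : (∑ i ∈ Finset.range 20, (22/25:ℚ)^(3*(i+1)) / (3*(i+1))) ≤ 382/1000 := by decide +kernel
    have := (Rat.cast_le (K := ℝ)).2 this
    push_cast at this
    norm_num at this ⊢
  · rw [Real.exp_le_exp]; norm_num; linarith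

lemma abs_sin_even (l : ℕ) (η : ℝ) : |Real.sin (((2*l : ℕ):ℝ) * (π - η) / 2)| = |Real.sin (l * η)| := by
  rw [show ((2*l : ℕ):ℝ) * (π - η) / 2 = l * π - l * η by push_cast; ring, Real.sin_nat_mul_pi_sub]
  simp [abs_mul]

lemma abs_sin_odd (l : ℕ) (η : ℝ) : |Real.sin (((2*l+1 : ℕ):ℝ) * (π - η) / 2)| = |Real.cos (((2*l+1 : ℕ):ℝ) * η / 2)| := by
  rw [show ((2*l+1 : ℕ):ℝ) * (π - η) / 2 = l * π - (((2*l+1 : ℕ):ℝ) * η / 2 - π/2) by push_cast; ring, Real.sin_nat_mul_pi_sub,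
    Real.sin_sub_pi_div_two]
  simp [abs_mul]

lemma caseCfar (n : ℕ) (hn : 1003 ≤ n) (θ : ℝ) (h1 : 0.9 * π ≤ θ) (h2 : θ ≤ π - 0.03) :
    |∏ k ∈ Finset.Icc 1 n, (2 * Real.sin (k * θ / 2))| ≤ Real.exp (0.16 * n + 4) := by
  have hn' : (1003:ℝ) ≤ n := by exact_mod_cast hn
  have hp := Real.pi_gt_d2
  obtain ⟨η, rfl⟩ : ∃ η, θ = π - η := ⟨π - θ, by ring⟩
  refine (caseB n hn (π - η) 0.01499 0.0327 (by norm_num) 10 5 (by norm_num) ?_ ?_ ?_ (by norm_num)).trans ?_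
  · intro i hi1 hi2
    have h3 := sin_ge7 (x := 0.03) (by norm_num)
    norm_num at h3
    rcases Nat.even_or_odd' i with ⟨l, rfl | rfl⟩
    · rw [abs_sin_even]
      have hl1 : (1:ℝ) ≤ l := by exact_mod_cast (by omega : 1 ≤ l)
      have hl2 : (l:ℝ) ≤ 4 := by exact_mod_cast (by omega : l ≤ 4)
      have h := sin_ge_of_mem (a := 0.03) (y := l * η) (by norm_num) (by nlinarith) (by nlinarith)
      refine le_trans ?_ (le_abs_self _)
      norm_num at h ⊢
      linarith
    · rw [abs_sin_odd]
      have hl2 : ((2*l+1 : ℕ):ℝ) ≤ 9 := by exact_mod_cast (by omega : 2*l+1 ≤ 9)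
      have hl1 : (1:ℝ) ≤ ((2*l+1 : ℕ):ℝ) := by exact_mod_cast (by omega : 1 ≤ 2*l+1)
      rw [← Real.sin_pi_div_two_sub]
      have h := sin_ge_of_mem (a := 0.03) (y := π/2 - ((2*l+1 : ℕ):ℝ) * η / 2) (by norm_num) (by nlinarith) (by nlinarith)
      refine le_trans ?_ (le_abs_self _)
      norm_num at h ⊢
      linarith
  · have : (∑ j ∈ Finset.range 59, (22/25:ℚ)^(j+1) / (j+1)) ≤ 21203/10000 := by decide +kernel
    have := (Rat.cast_le (K := ℝ)).2 this
    push_cast at this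
    norm_num at this ⊢
  · have : (∑ i ∈ Finset.range 5, (22/25:ℚ)^(10*(i+1)) / (10*(i+1))) ≤ 327/10000 := by decide +kernel
    have := (Rat.cast_le (K := ℝ)).2 this
    push_cast at this
    norm_num at this ⊢
  · rw [Real.exp_le_exp]; norm_num; linarith

lemma sumA (n : ℕ) (hn : 1003 ≤ n) (θ : ℝ) (b : ℕ → ℚ)
    (hB : ∑ j ∈ Finset.range 100, (19/20:ℚ)^(j+1) / (j+1) * b j ≤ 132/1000)
    (hT : ∀ j : ℕ, j < 100 → TT n ((j+1) * θ) ≤ 1/2 + (j+1)/140 + (b j : ℝ) * (n + 1/2)) :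
    |∏ k ∈ Finset.Icc 1 n, (2 * Real.sin (k * θ / 2))| ≤ Real.exp (0.16 * n + 4) := by
  refine (smooth n (by omega) θ (19/20) (by norm_num) (by norm_num) 100).trans ?_
  rw [Real.exp_le_exp]
  have hn' : (1003:ℝ) ≤ n := by exact_mod_cast hn
  have hl : - Real.log (19/20) ≤ 0.0513 := neg_log_le (by norm_num) (by norm_num) (by norm_num)
  have hl2 := mul_le_mul_of_nonneg_left hl (by linarith : (0:ℝ) ≤ n)
  have ht : (19/20:ℝ)^(100+1) / (((100:ℕ)+1) * (1-19/20)) ≤ 0.0012 := by norm_num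
  have ht2 := mul_le_mul_of_nonneg_left ht (by linarith : (0:ℝ) ≤ 0.22 * n + 1)
  have h1 : ∑ j ∈ Finset.range 100, (19/20:ℚ)^(j+1) / (j+1) * (1/2 + (j+1)/140) ≤ 17/10 := by decide +kernel
  have h1' := (Rat.cast_le (K := ℝ)).2 h1
  have hB' := (Rat.cast_le (K := ℝ)).2 hB
  push_cast at h1' hB'
  have hsum : ∑ j ∈ Finset.range 100, (19/20:ℝ)^(j+1) / (j+1) * TT n ((j+1) * θ) ≤
      ∑ j ∈ Finset.range 100, ((19/20:ℝ)^(j+1) / (j+1) * (1/2 + (j+1)/140) + ((19/20:ℝ)^(j+1) / (j+1) * b j) * (n + 1/2)) := by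
    refine Finset.sum_le_sum fun j hj => ?_
    have := mul_le_mul_of_nonneg_left (hT j (Finset.mem_range.1 hj)) (by positivity : 0 ≤ (19/20:ℝ)^(j+1) / ((j:ℝ)+1))
    linarith
  rw [Finset.sum_add_distrib, ← Finset.sum_mul] at hsum
  have := mul_le_mul_of_nonneg_right hB' (by positivity : (0:ℝ) ≤ n + 1/2)
  norm_num at *
  linarith

lemma caseA (n : ℕ) (hn : 1003 ≤ n) (θ : ℝ) (h1 : 2 * π / n ≤ θ) (h2 : θ ≤ 0.05) :
    |∏ k ∈ Finset.Icc 1 n, (2 * Real.sin (k * θ / 2))| ≤ Real.exp (0.16 * n + 4) := by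
  have hn' : (1003:ℝ) ≤ n := by exact_mod_cast hn
  have hp := Real.pi_gt_d4
  have hp2 := Real.pi_lt_d4
  have hθ : 0 < θ := lt_of_lt_of_le (by positivity) h1
  set u := (n+1/2) * θ with hu
  have hu1 : 2 * π ≤ u := by
    rw [div_le_iff₀ (by positivity)] at h1
    rw [hu]; nlinarith
  -- generic bounds
  have hzero : ∀ j : ℕ, j < 100 → 0 ≤ Real.sin ((j+1) * u) → TT n ((j+1) * θ) ≤ 1/2 + (j+1)/140 + 0 * (n + 1/2) := by
    intro j hj hsin
    have hj' : (j:ℝ) + 1 ≤ 100 := by exact_mod_cast hj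
    have := TT_small n ((j+1) * θ) 0 (by positivity) (by nlinarith) le_rfl (by norm_num)
      (by rw [show (n + 1/2) * ((j+1) * θ) = (j+1) * u by rw [hu]; ring]; linarith)
    rw [zero_div] at this
    have : ((j:ℝ)+1) * θ / 7 ≤ (j+1)/140 := by
      rw [div_le_div_iff₀ (by norm_num) (by norm_num)]
      nlinarith [Nat.cast_nonneg (α := ℝ) j]
    linarith
  have hgen : ∀ β : ℝ, 1 ≤ β * u → ∀ j : ℕ, j < 100 → TT n ((j+1) * θ) ≤ 1/2 + (j+1)/140 + (β/(j+1)) * (n + 1/2) := by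
    intro β hβ j hj
    have hj' : (j:ℝ) + 1 ≤ 100 := by exact_mod_cast hj
    have h := TT_small n ((j+1) * θ) 1 (by positivity) (by nlinarith) zero_le_one le_rfl
      (by linarith [Real.neg_one_le_sin ((n + 1/2) * (((j:ℝ)+1) * θ))])
    have h3 : ((j:ℝ)+1) * θ / 7 ≤ (j+1)/140 := by
      rw [div_le_div_iff₀ (by norm_num) (by norm_num)]
      nlinarith [Nat.cast_nonneg (α := ℝ) j]
    have h4 : 1 / ((n + 1/2) * (((j:ℝ)+1) * θ)) ≤ β/(j+1) := by
      rw [show (n + 1/2) * (((j:ℝ)+1) * θ) = (j+1) * u by rw [hu]; ring, div_le_div_iff₀ (by positivity) (by positivity)]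
      nlinarith [Nat.cast_nonneg (α := ℝ) j]
    have := mul_le_mul_of_nonneg_right h4 (by positivity : (0:ℝ) ≤ n + 1/2)
    linarith
  rcases le_or_gt u (3*π) with hA | hA
  · refine sumA n hn θ (fun j => if j = 0 then 0 else 0.1592/(j+1)) (by decide +kernel) ?_
    intro j hj
    split_ifs with h
    · subst h
      have := hzero 0 (by norm_num) (by
        simp only [Nat.cast_zero, zero_add, one_mul]
        rw [← Real.sin_sub_two_pi]
        apply Real.sin_nonneg_of_nonneg_of_le_pi <;> linarith)
      exact_mod_cast this
    · have := hgen 0.1592 (by nlinarith) j hj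
      push_cast
      norm_num at this ⊢
      exact this
  rcases le_or_gt u (3.5*π) with hB | hB
  · refine sumA n hn θ (fun j => if j = 1 then 0 else 0.1062/(j+1)) (by decide +kernel) ?_
    intro j hj
    split_ifs with h
    · subst h
      have := hzero 1 (by norm_num) (by
        have e : Real.sin ((((1:ℕ):ℝ) + 1) * u) = Real.sin (2*u - 3 * (2*π)) := by
          rw [show (2*u - 3*(2*π)) = ((((1:ℕ):ℝ) + 1) * u) - ((3:ℕ):ℝ) * (2*π) by push_cast; ring, Real.sin_sub_nat_mul_two_pi]
        rw [e]
        apply Real.sin_nonneg_of_nonneg_of_le_pi <;> linarith)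
      exact_mod_cast this
    · have := hgen 0.1062 (by nlinarith) j hj
      push_cast
      norm_num at this ⊢
      exact this
  · refine sumA n hn θ (fun j => 0.0910/(j+1)) (by decide +kernel) ?_
    intro j hj
    have := hgen 0.0910 (by nlinarith) j hj
    push_cast
    norm_num at this ⊢
    exact this

end QP
namespace QP
open Real MeasureTheory intervalIntegral

lemma sum_range_two_mul' (K : ℕ) (f : ℕ → ℝ) : ∑ j ∈ Finset.range (2*K), f j = ∑ l ∈ Finset.range K, (f (2*l) + f (2*l+1)) := by
  induction K with
  | zero => simp
  | succ K ih =>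
    rw [show 2*(K+1) = 2*K+1+1 by ring, Finset.sum_range_succ, Finset.sum_range_succ, Finset.sum_range_succ, ih]
    ring

lemma sumC (n : ℕ) (hn : 1003 ≤ n) (η : ℝ) (h0 : 0 ≤ η) (h1 : η ≤ 0.03) (b : ℕ → ℚ)
    (hB : ∑ j ∈ Finset.range 30, (19/20:ℚ)^(2*j+2) / (2*j+2) * b j ≤ 1307/10000)
    (hT : ∀ j : ℕ, j < 30 → TT n ((j+1) * (2*η)) ≤ 1/2 + (j+1)*0.06/7 + (b j : ℝ) * (n + 1/2)) :
    |∏ k ∈ Finset.Icc 1 n, (2 * Real.sin (k * (π - η) / 2))| ≤ Real.exp (0.16 * n + 4) := by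
  refine (smooth n (by omega) (π - η) (19/20) (by norm_num) (by norm_num) (2*30)).trans ?_
  rw [Real.exp_le_exp, sum_range_two_mul']
  have hn' : (1003:ℝ) ≤ n := by exact_mod_cast hn
  have hl : - Real.log (19/20) ≤ 0.0513 := neg_log_le (by norm_num) (by norm_num) (by norm_num)
  have hl2 := mul_le_mul_of_nonneg_left hl (by linarith : (0:ℝ) ≤ n)
  have ht : (19/20:ℝ)^(2*30+1) / (((2*30:ℕ)+1) * (1-19/20)) ≤ 0.01437 := by norm_num
  have ht2 := mul_le_mul_of_nonneg_left ht (by linarith : (0:ℝ) ≤ 0.22 * n + 1)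
  have h1q : ∑ j ∈ Finset.range 30, ((19/20:ℚ)^(2*j+1) / (2*j+1) * (4/3) + (19/20:ℚ)^(2*j+2) / (2*j+2) * (1/2 + (j+1)*(6/100)/7)) ≤ 34/10 := by decide +kernel
  have h1' := (Rat.cast_le (K := ℝ)).2 h1q
  have hB' := (Rat.cast_le (K := ℝ)).2 hB
  push_cast at h1' hB'
  have hsum : ∑ l ∈ Finset.range 30, ((19/20:ℝ)^(2*l+1) / ((2*l:ℕ)+1) * TT n (((2*l:ℕ)+1) * (π - η)) +
      (19/20:ℝ)^(2*l+1+1) / ((2*l+1:ℕ)+1) * TT n (((2*l+1:ℕ)+1) * (π - η))) ≤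
      ∑ j ∈ Finset.range 30, (((19/20:ℝ)^(2*j+1) / (2*j+1) * (4/3) + (19/20:ℝ)^(2*j+2) / (2*j+2) * (1/2 + (j+1)*(6/100)/7)) + ((19/20:ℝ)^(2*j+2) / (2*j+2) * b j) * (n + 1/2)) := by
    refine Finset.sum_le_sum fun j hj => ?_
    have hj := Finset.mem_range.1 hj
    have e1 : TT n (((2*j+1:ℕ)+1) * (π - η)) = TT n ((j+1) * (2*η)) := by
      rw [show (((2*j+1:ℕ):ℝ)+1) * (π - η) = -((j+1) * (2*η)) + ((j+1:ℤ):ℝ) * (2*π) by push_cast; ring, TT_add_int, TT_neg]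
    have e2 : TT n (((2*j:ℕ)+1) * (π - η)) ≤ 4/3 := by
      refine (TT_bound n _ 0.6 (by norm_num) ?_).trans (by norm_num)
      have := abs_sin_odd j η
      push_cast at this ⊢
      rw [this]
      refine le_trans ?_ (le_abs_self _)
      refine le_trans ?_ (cos_ge2 _)
      have hj' : (j:ℝ) ≤ 29 := by exact_mod_cast (by omega : j ≤ 29)
      have h3 : (2*(j:ℝ)+1) * η / 2 ≤ 0.885 := by nlinarith
      have h4 : 0 ≤ (2*(j:ℝ)+1) * η / 2 := by positivity
      nlinarith
    rw [e1]
    have t1 := mul_le_mul_of_nonneg_left (hT j hj) (by positivity : 0 ≤ (19/20:ℝ)^(2*j+2) / (2*(j:ℝ)+2))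
    have t2 := mul_le_mul_of_nonneg_left e2 (by positivity : 0 ≤ (19/20:ℝ)^(2*j+1) / (2*(j:ℝ)+1))
    push_cast at t2 ⊢
    rw [show (2*(j:ℝ)+1+1) = 2*j+2 by ring, show 2*j+1+1 = 2*j+2 by ring]
    norm_num at t1 t2 ⊢
    linarith
  replace hsum := hsum.trans_eq (by rw [Finset.sum_add_distrib, ← Finset.sum_mul])
  have := mul_le_mul_of_nonneg_right hB' (by positivity : (0:ℝ) ≤ n + 1/2)
  norm_num at *
  linarith

lemma caseCnear (n : ℕ) (hn : 1003 ≤ n) (η : ℝ) (h0 : 0 ≤ η) (h1 : η ≤ 0.03) :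
    |∏ k ∈ Finset.Icc 1 n, (2 * Real.sin (k * (π - η) / 2))| ≤ Real.exp (0.16 * n + 4) := by
  have hn' : (1003:ℝ) ≤ n := by exact_mod_cast hn
  have hp := Real.pi_gt_d4
  have hp2 := Real.pi_lt_d4
  rcases h0.eq_or_lt with rfl | h0'
  · refine sumC n hn 0 le_rfl (by norm_num) (fun _ => 0) (by decide +kernel) ?_
    intro j hj
    have : TT n ((j+1) * (2*0)) = - n := by simp [TT]
    rw [this]
    have : (0:ℝ) ≤ (j+1)*0.06/7 := by positivity
    push_cast
    linarith
  set u := (n+1/2) * (2*η) with hu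
  have hu0 : 0 < u := by positivity
  have hsig : ∀ σ β : ℝ, 0 ≤ σ → σ ≤ 1 → ∀ j : ℕ, j < 30 → σ ≤ β * ((j+1)*u) → - Real.sin ((j+1) * u) ≤ σ → TT n ((j+1) * (2*η)) ≤ 1/2 + (j+1)*0.06/7 + β * (n + 1/2) := by
    intro σ β hσ hσ1 j hj hβ hs
    have hj' : (j:ℝ) + 1 ≤ 30 := by exact_mod_cast hj
    have h := TT_small n ((j+1) * (2*η)) σ (by positivity) (by nlinarith) hσ hσ1
      (by rw [show (n + 1/2) * ((j+1) * (2*η)) = (j+1) * u by rw [hu]; ring]; linarith)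
    have h3 : ((j:ℝ)+1) * (2*η) / 7 ≤ (j+1)*0.06/7 := by
      have : (2*η) ≤ 0.06 := by linarith
      gcongr
    have h4 : σ / ((n + 1/2) * (((j:ℝ)+1) * (2*η))) ≤ β := by
      rw [show (n + 1/2) * (((j:ℝ)+1) * (2*η)) = (j+1) * u by rw [hu]; ring, div_le_iff₀ (by positivity)]
      exact hβ
    have := mul_le_mul_of_nonneg_right h4 (by positivity : (0:ℝ) ≤ n + 1/2)
    linarith
  have hzero : ∀ j : ℕ, j < 30 → 0 ≤ Real.sin ((j+1) * u) → TT n ((j+1) * (2*η)) ≤ 1/2 + (j+1)*0.06/7 + 0 * (n + 1/2) := by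
    intro j hj hsin
    exact hsig 0 0 le_rfl (by norm_num) j hj (by simp) (by linarith)
  have hgen : ∀ β : ℝ, 1 ≤ β * u → ∀ j : ℕ, j < 30 → TT n ((j+1) * (2*η)) ≤ 1/2 + (j+1)*0.06/7 + (β/(j+1)) * (n + 1/2) := by
    intro β hβ j hj
    refine hsig 1 _ zero_le_one le_rfl j hj ?_ (by linarith [Real.neg_one_le_sin (((j:ℝ)+1) * u)])
    rw [show β/((j:ℝ)+1) * ((j+1)*u) = β * u by field_simp]
    exact hβ
  have htr : ∀ j : ℕ, TT n ((j+1) * (2*η)) ≤ 1/2 + (j+1)*0.06/7 + 0.2206 * (n + 1/2) := by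
    intro j
    have := TT_le n (by omega) ((j+1) * (2*η))
    have : (0:ℝ) ≤ (j+1)*0.06/7 := by positivity
    linarith
  have hs0 : ∀ y : ℝ, 0 ≤ y → y ≤ π → 0 ≤ Real.sin y := fun y => Real.sin_nonneg_of_nonneg_of_le_pi
  rcases le_or_gt u (π/3) with hA | hA
  · refine sumC n hn η h0 h1 (fun j => if j < 3 then 0 else 0.2206) (by decide +kernel) ?_
    intro j hj
    by_cases hj3 : j < 3
    · simp only [hj3, if_true]
      have hj' : (j:ℝ) ≤ 2 := by exact_mod_cast (by omega : j ≤ 2)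
      have := hzero j hj (hs0 _ (by positivity) (by nlinarith))
      push_cast; exact this
    · simp only [hj3, if_false]
      have := htr j
      push_cast; norm_num at this ⊢; exact this
  rcases le_or_gt u (π/2) with hB | hB
  · refine sumC n hn η h0 h1 (fun j => if j < 2 then 0 else 0.955/(j+1)) (by decide +kernel) ?_
    intro j hj
    by_cases hj3 : j < 2
    · simp only [hj3, if_true]
      have hj' : (j:ℝ) ≤ 1 := by exact_mod_cast (by omega : j ≤ 1)
      have := hzero j hj (hs0 _ (by positivity) (by nlinarith))
      push_cast; exact this
    · simp only [hj3, if_false]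
      have := hgen 0.955 (by linarith) j hj
      push_cast; norm_num at this ⊢; exact this
  rcases le_or_gt u π with hC | hC
  · refine sumC n hn η h0 h1 (fun j => if j = 0 then 0 else if j = 1 then 0.2206 else 0.6367/(j+1)) (by decide +kernel) ?_
    intro j hj
    by_cases hj0 : j = 0
    · subst hj0
      have := hzero 0 hj (hs0 _ (by positivity) (by norm_num; linarith))
      simpa using this
    by_cases hj1 : j = 1
    · subst hj1
      have := htr 1
      simp only [hj0, if_false, if_true]
      push_cast; norm_num at this ⊢; exact this
    · simp only [hj0, hj1, if_false]
      have := hgen 0.6367 (by linarith) j hj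
      push_cast; norm_num at this ⊢; exact this
  rcases le_or_gt u (1.5*π) with hD | hD
  · refine sumC n hn η h0 h1 (fun j => if j = 0 then 0.2185 else if j = 1 then 0 else 0.3184/(j+1)) (by decide +kernel) ?_
    intro j hj
    by_cases hj0 : j = 0
    · subst hj0
      have h3 := neg_sin_le hu0.le
      rcases le_or_gt 0 (Real.sin u) with h4 | h4
      · have := hzero 0 hj (by simpa using h4)
        simp at this ⊢
        have : (0:ℝ) < n := by linarith
        norm_num; linarith
      have := hsig (- Real.sin u) 0.2185 (by linarith) (by linarith [Real.neg_one_le_sin u]) 0 hj (by simpa using h3) (by simp)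
      norm_num at this ⊢; exact this
    by_cases hj1 : j = 1
    · subst hj1
      have := hzero 1 hj (by
        have := hs0 (2*u-2*π) (by linarith) (by norm_num at hD ⊢; linarith)
        rw [Real.sin_sub_two_pi] at this
        norm_num; exact this)
      norm_num at this ⊢; exact this
    · simp only [hj0, hj1, if_false]
      have := hgen 0.3184 (by linarith) j hj
      push_cast; norm_num at this ⊢; exact this
  rcases le_or_gt u (1.6*π) with hE | hE
  · refine sumC n hn η h0 h1 (fun j => if j = 1 then 0.0667 else 0.2123/(j+1)) (by decide +kernel) ?_
    intro j hj
    by_cases hj1 : j = 1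
    · subst hj1
      have := hsig 0.62833 0.0667 (by norm_num) (by norm_num) 1 hj (by norm_num at hD ⊢; linarith) (by
        have h5 := Real.sin_le (x := 2*u-3*π) (by norm_num at hD ⊢; linarith)
        rw [show 2*u-3*π = (2*u - π) - 2*π by ring, Real.sin_sub_two_pi, Real.sin_sub_pi] at h5
        norm_num at h5 hE ⊢
        linarith)
      norm_num at this ⊢; exact this
    · simp only [hj1, if_false]
      have := hgen 0.2123 (by norm_num at hD ⊢; linarith) j hj
      push_cast; norm_num at this ⊢; exact this
  · refine sumC n hn η h0 h1 (fun j => 0.199/(j+1)) (by decide +kernel) ?_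
    intro j hj
    have := hgen 0.199 (by norm_num at hE ⊢; linarith) j hj
    push_cast; norm_num at this ⊢; exact this

lemma W_minor (n : ℕ) (hn : 1003 ≤ n) (x : ℝ) (h1 : π ≤ x) (h2 : x ≤ n * π / 2) : |W n x| ≤ Real.exp (0.16 * n + 4) := by
  have hn' : (1003:ℝ) ≤ n := by exact_mod_cast hn
  have hp := Real.pi_gt_d4
  have hp2 := Real.pi_lt_d4
  have e : W n x = ∏ k ∈ Finset.Icc 1 n, (2 * Real.sin (k * (2*x/n) / 2)) := by
    unfold W
    refine Finset.prod_congr rfl fun k _ => ?_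
    congr 2; ring
  rw [e]
  have ha : 2 * π / n ≤ 2*x/n := by gcongr
  have hb : 2*x/n ≤ π := by rw [div_le_iff₀ (by linarith)]; linarith
  generalize 2*x/n = θ at ha hb
  rcases le_or_gt θ 0.05 with h | h
  · exact caseA n hn θ ha h
  rcases le_or_gt θ (0.2*π) with h' | h'
  · exact caseB1 n hn θ h.le h'
  rcases le_or_gt θ (0.9*π) with h'' | h''
  · exact caseB3 n hn θ h'.le h''
  rcases le_or_gt θ (π-0.03) with h3 | h3
  · exact caseCfar n hn θ h''.le h3
  · have := caseCnear n hn (π - θ) (by linarith) (by linarith)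
    rwa [sub_sub_cancel] at this

end QP
namespace QP
open Real MeasureTheory intervalIntegral

/-- `s cot s`, continuously extended at `0`. -/
noncomputable def cc (s : ℝ) : ℝ := Real.cos s / Real.sinc s
/-- first derivative of `cc`. -/
noncomputable def c1 (s : ℝ) : ℝ := Real.cos s / Real.sin s - s / Real.sin s ^ 2
/-- second derivative of `cc`. -/
noncomputable def c2 (s : ℝ) : ℝ := -2 * (Real.sin s - s * Real.cos s) / Real.sin s ^ 3
/-- primitive of `cc`. -/
noncomputable def Psi (x : ℝ) : ℝ := ∫ s in (0:ℝ)..x, cc s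

lemma cc_eq {s : ℝ} (h : s ≠ 0) : cc s = s * Real.cos s / Real.sin s := by
  rw [cc, Real.sinc_of_ne_zero h, div_div_eq_mul_div, mul_comm]

lemma cc_zero : cc 0 = 1 := by simp [cc]

lemma sinc_pos {s : ℝ} (h0 : 0 ≤ s) (h1 : s < π) : 0 < Real.sinc s := by
  rcases h0.eq_or_lt with rfl | h
  · simp
  · rw [Real.sinc_of_ne_zero h.ne']
    exact div_pos (Real.sin_pos_of_pos_of_lt_pi h h1) h

lemma sin_pos' {s : ℝ} (h0 : 0 < s) (h1 : s < π) : 0 < Real.sin s := Real.sin_pos_of_pos_of_lt_pi h0 h1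

lemma cc_contAt {s : ℝ} (h0 : 0 ≤ s) (h1 : s < π) : ContinuousAt cc s := by
  unfold cc
  exact Real.continuous_cos.continuousAt.div Real.continuous_sinc.continuousAt (sinc_pos h0 h1).ne'

lemma cc_contOn {a b : ℝ} (h0 : 0 ≤ a) (h1 : b < π) : ContinuousOn cc (Set.Icc a b) :=
  fun s hs => (cc_contAt (h0.trans hs.1) (hs.2.trans_lt h1)).continuousWithinAt

lemma cc_int {a b : ℝ} (ha : 0 ≤ a) (ha' : a < π) (hb : 0 ≤ b) (hb' : b < π) : IntervalIntegrable cc volume a b := by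
  apply ContinuousOn.intervalIntegrable
  intro s hs
  rw [Set.uIcc, Set.mem_Icc] at hs
  exact (cc_contAt ((le_min ha hb).trans hs.1) (hs.2.trans_lt (max_lt ha' hb'))).continuousWithinAt

lemma hasDerivAt_cc {s : ℝ} (h0 : 0 < s) (h1 : s < π) : HasDerivAt cc (c1 s) s := by
  have hs := sin_pos' h0 h1
  have h : HasDerivAt (fun s => s * Real.cos s / Real.sin s) (c1 s) s := by
    have := ((hasDerivAt_id s).mul (Real.hasDerivAt_cos s)).div (Real.hasDerivAt_sin s) hs.ne'
    refine this.congr_deriv ?_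
    simp only [c1, id, Pi.mul_apply]
    have e := Real.sin_sq_add_cos_sq s
    field_simp
    linear_combination (-s) * e
  refine h.congr_of_eventuallyEq ?_
  filter_upwards [lt_mem_nhds h0] with y hy
  exact cc_eq hy.ne'

lemma hasDerivAt_c1 {s : ℝ} (h0 : 0 < s) (h1 : s < π) : HasDerivAt c1 (c2 s) s := by
  have hs := sin_pos' h0 h1
  have := ((Real.hasDerivAt_cos s).div (Real.hasDerivAt_sin s) hs.ne').sub
    ((hasDerivAt_id s).div ((Real.hasDerivAt_sin s).pow 2) (pow_ne_zero 2 hs.ne'))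
  unfold c1
  refine this.congr_deriv ?_
  simp only [c2, id]
  have e := Real.sin_sq_add_cos_sq s
  field_simp
  push_cast
  simp
  linear_combination (-Real.sin s ^ 5) * e

lemma cusa_aux {s : ℝ} (h0 : 0 ≤ s) (h1 : s ≤ π) : 0 ≤ Real.sin s - s * Real.cos s := by
  have hm : MonotoneOn (fun s => Real.sin s - s * Real.cos s) (Set.Icc 0 π) := by
    apply monotoneOn_of_deriv_nonneg (convex_Icc 0 π)
    · fun_prop
    · fun_prop
    · intro x hx
      rw [interior_Icc] at hx
      have : HasDerivAt (fun s => Real.sin s - s * Real.cos s) (x * Real.sin x) x := by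
        refine ((Real.hasDerivAt_sin x).sub ((hasDerivAt_id x).mul (Real.hasDerivAt_cos x))).congr_deriv ?_
        simp
      rw [this.deriv]
      exact mul_nonneg hx.1.le (sin_pos' hx.1 hx.2).le
  have := hm (Set.mem_Icc.2 ⟨le_rfl, Real.pi_pos.le⟩) (Set.mem_Icc.2 ⟨h0, h1⟩) h0
  simpa using this

/-- Cusa–Huygens in the form `3 sin s cos s ≤ s (1 + 2 cos² s)`. -/
lemma cusa {s : ℝ} (h0 : 0 ≤ s) (h1 : s ≤ π) : 3 * Real.sin s * Real.cos s ≤ s * (1 + 2 * Real.cos s ^ 2) := by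
  have hm : MonotoneOn (fun s => s * (1 + 2 * Real.cos s ^ 2) - 3 * Real.sin s * Real.cos s) (Set.Icc 0 π) := by
    apply monotoneOn_of_deriv_nonneg (convex_Icc 0 π)
    · fun_prop
    · fun_prop
    · intro x hx
      rw [interior_Icc] at hx
      have : HasDerivAt (fun s => s * (1 + 2 * Real.cos s ^ 2) - 3 * Real.sin s * Real.cos s)
          (4 * Real.sin x * (Real.sin x - x * Real.cos x)) x := by
        refine (((hasDerivAt_id x).mul ((((Real.hasDerivAt_cos x).pow 2).const_mul 2).const_add 1)).sub
          (((Real.hasDerivAt_sin x).const_mul 3).mul (Real.hasDerivAt_cos x))).congr_deriv ?_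
        simp
        have e := Real.sin_sq_add_cos_sq x
        linear_combination (-1) * e
      rw [this.deriv]
      exact mul_nonneg (mul_nonneg (by norm_num) (sin_pos' hx.1 hx.2).le) (cusa_aux hx.1.le hx.2.le)
  have := hm (Set.mem_Icc.2 ⟨le_rfl, Real.pi_pos.le⟩) (Set.mem_Icc.2 ⟨h0, h1⟩) h0
  simp at this
  linarith

lemma c2_antitone : AntitoneOn c2 (Set.Ioo 0 π) := by
  have hd : ∀ s ∈ Set.Ioo 0 π, HasDerivAt c2 (-2 * (s * (1 + 2 * Real.cos s ^ 2) - 3 * Real.sin s * Real.cos s) / Real.sin s ^ 4) s := by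
    intro s hs
    have hp := sin_pos' hs.1 hs.2
    have := (((Real.hasDerivAt_sin s).sub ((hasDerivAt_id s).mul (Real.hasDerivAt_cos s))).const_mul (-2)).div
      ((Real.hasDerivAt_sin s).pow 3) (pow_ne_zero 3 hp.ne')
    unfold c2
    refine this.congr_deriv ?_
    simp
    have e := Real.sin_sq_add_cos_sq s
    field_simp
    linear_combination (-s) * e
  apply antitoneOn_of_deriv_nonpos (convex_Ioo 0 π)
  · exact fun s hs => (hd s hs).continuousAt.continuousWithinAt
  · intro s hs
    rw [interior_Ioo] at hs
    exact (hd s hs).differentiableAt.differentiableWithinAt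
  · intro s hs
    rw [interior_Ioo] at hs
    rw [(hd s hs).deriv]
    have := cusa hs.1.le hs.2.le
    have hp := sin_pos' hs.1 hs.2
    apply div_nonpos_of_nonpos_of_nonneg _ (by positivity)
    linarith

lemma c2_nonpos {s : ℝ} (h0 : 0 < s) (h1 : s < π) : c2 s ≤ 0 := by
  have := cusa_aux h0.le h1.le
  have := sin_pos' h0 h1
  apply div_nonpos_of_nonpos_of_nonneg _ (by positivity)
  linarith

lemma hasDerivAt_Psi {x : ℝ} (h0 : 0 < x) (h1 : x < π) : HasDerivAt Psi (cc x) x := by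
  apply integral_hasDerivAt_right (cc_int le_rfl Real.pi_pos h0.le h1)
  · apply ContinuousOn.stronglyMeasurableAtFilter (s := Set.Ioo 0 π) isOpen_Ioo _ _ ⟨h0, h1⟩
    exact fun s hs => (cc_contAt hs.1.le hs.2).continuousWithinAt
  · exact cc_contAt h0.le h1

/-- corrected trapezoidal rule on one interval. -/
lemma trap_one (a b : ℝ) (F f f1 f2 : ℝ → ℝ) (hab : a ≤ b)
    (hF : ∀ t ∈ Set.Icc a b, HasDerivAt F (f t) t) (hf : ∀ t ∈ Set.Icc a b, HasDerivAt f (f1 t) t)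
    (hf1 : ∀ t ∈ Set.Icc a b, HasDerivAt f1 (f2 t) t) (hanti : AntitoneOn f2 (Set.Icc a b)) :
    |F b - F a - (b-a) * (f a + f b)/2 + (b-a)^2 * (f1 b - f1 a)/12| ≤ (b-a)^3 * (f2 a - f2 b) / 9 := by
  set m := f2 b with hm
  set V := f2 a - f2 b with hV
  have ha : a ∈ Set.Icc a b := ⟨le_rfl, hab⟩
  have hb : b ∈ Set.Icc a b := ⟨hab, le_rfl⟩
  have mono : ∀ g g' : ℝ → ℝ, (∀ t ∈ Set.Icc a b, HasDerivAt g (g' t) t) → (∀ t ∈ Set.Icc a b, 0 ≤ g' t) →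
      ∀ t ∈ Set.Icc a b, g a ≤ g t := by
    intro g g' hg hp t ht
    have : MonotoneOn g (Set.Icc a b) := by
      apply monotoneOn_of_deriv_nonneg (convex_Icc a b)
      · exact fun s hs => (hg s hs).continuousAt.continuousWithinAt
      · exact fun s hs => (hg s (interior_subset hs)).differentiableAt.differentiableWithinAt
      · intro s hs
        rw [(hg s (interior_subset hs)).deriv]
        exact hp s (interior_subset hs)
    exact this ha ht ht.1
  have h2 : ∀ t ∈ Set.Icc a b, 0 ≤ f2 t - m ∧ f2 t - m ≤ V := fun t ht =>
    ⟨by have := hanti ht hb ht.2; linarith, by have := hanti ha ht ht.1; linarith⟩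
  have hid : ∀ t : ℝ, HasDerivAt (fun t => t - a) 1 t := fun t => (hasDerivAt_id t).sub_const a
  have hid2 : ∀ t : ℝ, HasDerivAt (fun t => (t - a)^2) (2*(t-a)) t := fun t => by
    refine ((hid t).pow 2).congr_deriv ?_; simp
  have hid3 : ∀ t : ℝ, HasDerivAt (fun t => (t - a)^3) (3*(t-a)^2) t := fun t => by
    refine ((hid t).pow 3).congr_deriv ?_; simp
  -- first derivative bounds
  have h1l : ∀ t ∈ Set.Icc a b, 0 ≤ f1 t - f1 a - m * (t-a) := by
    intro t ht
    have := mono (fun t => f1 t - m * (t-a)) (fun t => f2 t - m) (fun t ht => by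
      refine ((hf1 t ht).sub ((hid t).const_mul m)).congr_deriv ?_; simp) (fun t ht => (h2 t ht).1) t ht
    simp at this; linarith
  have h1u : ∀ t ∈ Set.Icc a b, f1 t - f1 a - m * (t-a) ≤ V * (t-a) := by
    intro t ht
    have := mono (fun t => V*(t-a) - (f1 t - m * (t-a))) (fun t => V - (f2 t - m)) (fun t ht => by
      refine (((hid t).const_mul V).sub ((hf1 t ht).sub ((hid t).const_mul m))).congr_deriv ?_; simp)
      (fun t ht => by have := (h2 t ht).2; linarith) t ht
    simp at this; linarith
  have h0l : ∀ t ∈ Set.Icc a b, 0 ≤ f t - f a - f1 a * (t-a) - m * (t-a)^2/2 := by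
    intro t ht
    have := mono (fun t => f t - f1 a * (t-a) - m * (t-a)^2/2) (fun t => f1 t - f1 a - m * (t-a)) (fun t ht => by
      refine (((hf t ht).sub ((hid t).const_mul (f1 a))).sub (((hid2 t).const_mul m).div_const 2)).congr_deriv ?_
      ring) (fun t ht => h1l t ht) t ht
    simp at this; linarith
  have h0u : ∀ t ∈ Set.Icc a b, f t - f a - f1 a * (t-a) - m * (t-a)^2/2 ≤ V * (t-a)^2/2 := by
    intro t ht
    have := mono (fun t => V * (t-a)^2/2 - (f t - f1 a * (t-a) - m * (t-a)^2/2)) (fun t => V * (t-a) - (f1 t - f1 a - m * (t-a))) (fun t ht => by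
      refine ((((hid2 t).const_mul V).div_const 2).sub (((hf t ht).sub ((hid t).const_mul (f1 a))).sub (((hid2 t).const_mul m).div_const 2))).congr_deriv ?_
      ring) (fun t ht => by have := h1u t ht; linarith) t ht
    simp at this; linarith
  have hE : ∀ t ∈ Set.Icc a b, HasDerivAt (fun t => F t - (t-a) * (f a + f t)/2 + (t-a)^2 * (f1 t - f1 a)/12)
      ((f t - f a - f1 a * (t-a) - m * (t-a)^2/2)/2 - (t-a) * (f1 t - f1 a - m * (t-a))/3 + (t-a)^2 * (f2 t - m)/12) t := by
    intro t ht
    refine (((hF t ht).sub (((hid t).mul ((hf t ht).const_add (f a))).div_const 2)).add (((hid2 t).mul ((hf1 t ht).sub_const (f1 a))).div_const 12)).congr_deriv ?_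
    ring
  rw [abs_le]
  constructor
  · have := mono (fun t => (F t - (t-a) * (f a + f t)/2 + (t-a)^2 * (f1 t - f1 a)/12) + V * (t-a)^3/9) _ (fun t ht => (hE t ht).add (((hid3 t).const_mul V).div_const 9)) (fun t ht => by
      have e0 := h0l t ht
      have e1 := mul_le_mul_of_nonneg_left (h1u t ht) (sub_nonneg.2 ht.1)
      have e2 := mul_nonneg (sq_nonneg (t-a)) (h2 t ht).1
      nlinarith) b hb
    simp at this
    linarith
  · have := mono (fun t => V * (t-a)^3/9 - (F t - (t-a) * (f a + f t)/2 + (t-a)^2 * (f1 t - f1 a)/12)) _ (fun t ht => (((hid3 t).const_mul V).div_const 9).sub (hE t ht)) (fun t ht => by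
      have e0 := h0u t ht
      have e1 := mul_nonneg (sub_nonneg.2 ht.1) (h1l t ht)
      have e2 := mul_le_mul_of_nonneg_left (h2 t ht).2 (sq_nonneg (t-a))
      nlinarith) b hb
    simp at this
    linarith

lemma em_sum (η : ℝ) (hη : 0 < η) (N : ℕ) (hN : 1 ≤ N) (h : N * η < π) :
    |(Psi (N*η) - Psi η) - η * (∑ k ∈ Finset.Icc 1 N, cc (k*η) - (cc η + cc (N*η))/2) + η^2 * (c1 (N*η) - c1 η)/12|
      ≤ η^3 * (c2 η - c2 (N*η)) / 9 := by
  induction N, hN using Nat.le_induction with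
  | base => simp
  | succ N hN ih =>
    have hN' : (1:ℝ) ≤ N := by exact_mod_cast hN
    push_cast at h ⊢
    have h' : N * η < π := by nlinarith
    have ih := ih h'
    rw [Finset.sum_Icc_succ_top (by omega)]
    have hin : ∀ t ∈ Set.Icc (N*η) ((N+1)*η), 0 < t ∧ t < π := fun t ht => ⟨lt_of_lt_of_le (by positivity) ht.1, ht.2.trans_lt h⟩
    have := trap_one (N*η) ((N+1)*η) Psi cc c1 c2 (by nlinarith) (fun t ht => hasDerivAt_Psi (hin t ht).1 (hin t ht).2)
      (fun t ht => hasDerivAt_cc (hin t ht).1 (hin t ht).2) (fun t ht => hasDerivAt_c1 (hin t ht).1 (hin t ht).2)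
      (c2_antitone.mono fun t ht => hin t ht)
    rw [show (N+1)*η - N*η = η by ring] at this
    push_cast
    rw [abs_le] at ih this ⊢
    constructor <;> nlinarith [ih.1, ih.2, this.1, this.2]

lemma cc_small {s : ℝ} (h0 : 0 ≤ s) (h1 : s ≤ 1) : 1 - s^2/2 ≤ cc s ∧ cc s ≤ 1 := by
  rcases h0.eq_or_lt with rfl | h
  · simp [cc_zero]
  have hp := Real.pi_gt_three
  have hs := sin_pos' h (by linarith)
  rw [cc_eq h.ne']
  constructor
  · rw [le_div_iff₀ hs]
    have h2 := Real.sin_le h0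
    have h3 := cos_ge2 s
    have h4 : 0 ≤ 1 - s^2/2 := by nlinarith
    nlinarith
  · rw [div_le_iff₀ hs]
    have := cusa_aux h0 (by linarith)
    linarith

lemma c1_small {s : ℝ} (h0 : 0 < s) (h1 : s ≤ 1) : -s ≤ c1 s ∧ c1 s ≤ 0 := by
  have hp := Real.pi_gt_three
  have hs := sin_pos' h0 (by linarith)
  have e := Real.sin_sq_add_cos_sq s
  have hl := Real.sin_le h0.le
  have e0 : c1 s = (Real.sin s * Real.cos s - s) / Real.sin s ^ 2 := by unfold c1; field_simp
  rw [e0]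
  have hc := cos_ge2 s
  have hg := sin_ge7 h0.le
  constructor
  · rw [le_div_iff₀ (by positivity)]
    have h3 : s - s^3/6 ≤ Real.sin s := (sin_gt_sub_cube h0).le
    have h4 : 0 ≤ Real.cos s := by nlinarith
    have h5 : 0 ≤ s - s^3/6 := by nlinarith [pow_pos h0 3]
    have h6 : s - s^3/6 - s^3/2 * Real.sin s / s ≤ Real.sin s * Real.cos s := by
      have : Real.sin s * (1 - s^2/2) ≤ Real.sin s * Real.cos s := mul_le_mul_of_nonneg_left hc hs.le
      have e1 : s^3/2 * Real.sin s / s = Real.sin s * (s^2/2) := by field_simp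
      rw [e1]; linarith
    have h7 : (s - s^3/6)^2 ≤ Real.sin s ^ 2 := pow_le_pow_left₀ h5 h3 2
    have h8 : s^3/2 * Real.sin s / s ≤ s^3/2 := by
      rw [div_le_iff₀ h0]; nlinarith [pow_pos h0 3]
    have h9 := mul_le_mul_of_nonneg_left h7 h0.le
    have h10 : s^5 ≤ s^3 := pow_le_pow_of_le_one h0.le h1 (by norm_num)
    have h11 : s * (s - s^3/6)^2 = s^3 - s^5/3 + s^7/36 := by ring
    have h12 := pow_pos h0 7
    linarith
  · apply div_nonpos_of_nonpos_of_nonneg _ (by positivity)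
    have := Real.cos_le_one s
    nlinarith

lemma Psi_small {s : ℝ} (h0 : 0 < s) (h1 : s ≤ 1) : s * (1 - s^2/2) ≤ Psi s ∧ Psi s ≤ s := by
  have hp := Real.pi_gt_three
  have hi := cc_int (a := 0) (b := s) le_rfl Real.pi_pos h0.le (by linarith)
  constructor
  · have := integral_mono_on h0.le (intervalIntegrable_const (c := 1 - s^2/2)) hi (fun x hx => by
      have := (cc_small hx.1 (hx.2.trans h1)).1
      have : x^2 ≤ s^2 := pow_le_pow_left₀ hx.1 hx.2 2
      linarith)
    rw [Psi]
    simp at this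
    linarith
  · have := integral_mono_on h0.le hi (intervalIntegrable_const (c := 1)) (fun x hx => (cc_small hx.1 (hx.2.trans h1)).2)
    rw [Psi]
    simpa using this

/-- Euler–Maclaurin for the logarithmic derivative. -/
lemma em (n : ℕ) (hn : 1003 ≤ n) (x : ℝ) (h0 : 0 < x) (h1 : x < π) (κ : ℝ) (hκ0 : 0 ≤ κ) (hκ1 : κ ≤ 1) :
    |(∑ k ∈ Finset.Icc 1 n, cc (k*(x/n)) + κ * cc (x/n)) - (n * Psi x / x + (cc x - 1)/2 + κ + x * c1 x / (12*n))|
      ≤ (x/n)^2 * (2 - c2 x / 9) := by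
  have hn' : (1003:ℝ) ≤ n := by exact_mod_cast hn
  have hn0 : (0:ℝ) < n := by linarith
  set η := x/n with hη
  have hη0 : 0 < η := by positivity
  have hp := Real.pi_lt_four
  have hη1 : η ≤ 1 := by rw [hη, div_le_one hn0]; linarith
  have hnη : n * η = x := by rw [hη]; field_simp
  have := em_sum η hη0 n (by omega) (by rw [hnη]; exact h1)
  rw [hnη] at this
  have a1 := Psi_small hη0 hη1
  have a2 := c1_small hη0 hη1
  have a3 := cc_small hη0.le hη1
  have a4 := c2_nonpos hη0 (by linarith [Real.pi_gt_three])
  have e1 : n * Psi x / x = Psi x / η := by rw [hη]; field_simp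
  have e2 : x * c1 x / (12*n) = η * c1 x / 12 := by rw [hη]; field_simp
  rw [e1, e2]
  set S := ∑ k ∈ Finset.Icc 1 n, cc (k*η)
  have key : η * ((S + κ * cc η) - (Psi x / η + (cc x - 1)/2 + κ + η * c1 x / 12)) =
      -((Psi x - Psi η) - η * (S - (cc η + cc x)/2) + η^2 * (c1 x - c1 η)/12)
      + (η * (cc η + 1)/2 - Psi η) - η^2 * c1 η / 12 - η * κ * (1 - cc η) := by
    field_simp; ring
  have hb : |η * ((S + κ * cc η) - (Psi x / η + (cc x - 1)/2 + κ + η * c1 x / 12))| ≤ η * (η^2 * (2 - c2 x/9)) := by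
    rw [key]
    rw [abs_le] at this ⊢
    have b1 : κ * (1 - cc η) ≤ η^2/2 := by nlinarith [a3.1, a3.2]
    have b1' : 0 ≤ κ * (1 - cc η) := mul_nonneg hκ0 (by linarith [a3.2])
    have b2 := mul_le_mul_of_nonneg_left b1 hη0.le
    have b2' := mul_nonneg hη0.le b1'
    have b3 := mul_le_mul_of_nonneg_left a2.1 (sq_nonneg η)
    have b3' := mul_nonneg (sq_nonneg η) (by linarith [a2.2] : 0 ≤ - c1 η)
    have b4 := mul_le_mul_of_nonneg_left a3.1 hη0.le
    have b4' := mul_le_mul_of_nonneg_left a3.2 hη0.le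
    have b5 := mul_nonneg (pow_pos hη0 3).le (by linarith : 0 ≤ - c2 η)
    have b6 := pow_pos hη0 3
    constructor <;> nlinarith [this.1, this.2, a1.1, a1.2]
  rw [abs_mul, abs_of_pos hη0] at hb
  exact le_of_mul_le_mul_left hb hη0

end QP
namespace QP
open Real MeasureTheory intervalIntegral

/-- evaluation of a coefficient list. -/
noncomputable def ev : List ℚ → ℝ → ℝ
  | [], _ => 0
  | a :: p, z => (a : ℝ) + z * ev p z
/-- rational evaluation -/
def evq : List ℚ → ℚ → ℚ
  | [], _ => 0
  | a :: p, z => a + z * evq p z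
/-- sum of lists -/
def padd : List ℚ → List ℚ → List ℚ
  | [], q => q
  | p, [] => p
  | a :: p, b :: q => (a + b) :: padd p q
/-- scalar multiple -/
def psmul (c : ℚ) : List ℚ → List ℚ
  | [] => []
  | a :: p => (c * a) :: psmul c p
/-- product of lists -/
def pmul : List ℚ → List ℚ → List ℚ
  | [], _ => []
  | a :: p, q => padd (psmul a q) (0 :: pmul p q)
/-- absolute bound -/
def pb : List ℚ → ℚ → ℚ
  | [], _ => 0
  | a :: p, r => |a| + r * pb p r
/-- primitive vanishing at zero: helper with index -/
def pintAux : ℕ → List ℚ → List ℚ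
  | _, [] => []
  | k, a :: p => (a / (k+1)) :: pintAux (k+1) p

lemma ev_cast (p : List ℚ) (z : ℚ) : ev p (z:ℝ) = ((evq p z : ℚ) : ℝ) := by
  induction p with
  | nil => simp [ev, evq]
  | cons a p ih => simp [ev, evq, ih]

lemma ev_add (p q : List ℚ) (z : ℝ) : ev (padd p q) z = ev p z + ev q z := by
  induction p generalizing q with
  | nil => simp [padd, ev]
  | cons a p ih =>
    cases q with
    | nil => simp [padd, ev]
    | cons b q => simp [padd, ev, ih]; ring

lemma ev_smul (c : ℚ) (p : List ℚ) (z : ℝ) : ev (psmul c p) z = c * ev p z := by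
  induction p with
  | nil => simp [psmul, ev]
  | cons a p ih => simp [psmul, ev, ih]; ring

lemma ev_mul (p q : List ℚ) (z : ℝ) : ev (pmul p q) z = ev p z * ev q z := by
  induction p with
  | nil => simp [pmul, ev]
  | cons a p ih => simp [pmul, ev, ev_add, ev_smul, ih]; ring

lemma pb_nonneg (p : List ℚ) {r : ℚ} (hr : 0 ≤ r) : 0 ≤ pb p r := by
  induction p with
  | nil => simp [pb]
  | cons a p ih => simp only [pb]; positivity

lemma ev_abs (p : List ℚ) {z : ℝ} {r : ℚ} (h : |z| ≤ r) : |ev p z| ≤ ((pb p r : ℚ) : ℝ) := by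
  induction p with
  | nil => simp [ev, pb]
  | cons a p ih =>
    simp only [ev, pb]
    have hr : (0:ℝ) ≤ r := (abs_nonneg z).trans h
    refine (abs_add_le _ _).trans ?_
    rw [abs_mul]
    push_cast
    have := mul_le_mul h ih (abs_nonneg _) hr
    linarith

lemma ev_split (k : ℕ) (p : List ℚ) (z : ℝ) : ev p z = ev (p.take k) z + z^k * ev (p.drop k) z := by
  induction k generalizing p with
  | zero => simp [ev]
  | succ k ih =>
    cases p with
    | nil => simp [ev]
    | cons a p => simp only [List.take_succ_cons, List.drop_succ_cons, ev]; rw [ih p]; ring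

lemma ev_map_range (N : ℕ) (f : ℕ → ℚ) (z : ℝ) : ev ((List.range N).map f) z = ∑ k ∈ Finset.range N, (f k : ℝ) * z^k := by
  induction N generalizing f with
  | zero => simp [ev]
  | succ N ih =>
    rw [List.range_succ_eq_map, List.map_cons, List.map_map, ev, ih, Finset.sum_range_succ']
    simp only [Function.comp_apply, Finset.mul_sum, Nat.succ_eq_add_one]
    rw [add_comm]
    congr 1
    · refine Finset.sum_congr rfl fun k _ => ?_
      ring
    · simp

/-- Taylor list of the sine -/
def sinL (m : ℕ) : List ℚ := (List.range (2*(m+1))).map fun k => if k % 2 = 0 then 0 else (-1)^(k/2) / (k.factorial : ℚ)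
/-- Taylor list of the cosine -/
def cosL (m : ℕ) : List ℚ := (List.range (2*(m+1))).map fun k => if k % 2 = 1 then 0 else (-1)^(k/2) / (k.factorial : ℚ)

lemma ev_sinL (m : ℕ) (z : ℝ) : ev (sinL m) z = ∑ j ∈ Finset.range (m+1), (-1)^j * z^(2*j+1) / (2*j+1).factorial := by
  rw [sinL, ev_map_range, sum_range_two_mul']
  refine Finset.sum_congr rfl fun j _ => ?_
  have h1 : (2*j) % 2 = 0 := by omega
  have h2 : (2*j+1) % 2 = 1 := by omega
  have h3 : (2*j+1)/2 = j := by omega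
  simp [h1, h2, h3]
  ring

lemma ev_cosL (m : ℕ) (z : ℝ) : ev (cosL m) z = ∑ j ∈ Finset.range (m+1), (-1)^j * z^(2*j) / (2*j).factorial := by
  rw [cosL, ev_map_range, sum_range_two_mul']
  refine Finset.sum_congr rfl fun j _ => ?_
  have h1 : (2*j) % 2 = 0 := by omega
  have h2 : (2*j+1) % 2 = 1 := by omega
  simp [h1, h2]
  ring

lemma alt_abs (m : ℕ) (s A B T : ℝ) (hB : B = A + (-1)^(m+1) * T) (h1 : 0 ≤ (-1)^(m+1) * (s - A)) (h2 : 0 ≤ (-1)^(m+2) * (s - B)) : |s - A| ≤ T := by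
  have e : |s - A| = (-1)^(m+1) * (s - A) := by
    rw [← abs_of_nonneg h1, abs_mul, abs_pow]; simp
  rw [e]
  have h3 : (-1:ℝ)^(m+2) * (s - B) = -((-1)^(m+1) * (s-A)) + ((-1)^(m+1) * (-1)^(m+1)) * T := by rw [hB]; ring
  have h4 : ((-1:ℝ)^(m+1) * (-1)^(m+1)) = 1 := by rw [← mul_pow]; simp
  rw [h3, h4] at h2
  linarith

lemma sin_abs (m : ℕ) (z : ℝ) : |Real.sin z - ev (sinL m) z| ≤ |z|^(2*m+3) / (2*m+3).factorial := by
  have main : ∀ x : ℝ, 0 ≤ x → |Real.sin x - ev (sinL m) x| ≤ x^(2*m+3) / (2*m+3).factorial := by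
    intro x hx
    have h1 := (sincos_alt m).2 x hx
    have h2 := (sincos_alt (m+1)).2 x hx
    rw [← ev_sinL] at h1 h2
    refine alt_abs m _ _ (ev (sinL (m+1)) x) _ ?_ h1 h2
    rw [ev_sinL, ev_sinL, Finset.sum_range_succ _ (m+1)]
    rw [show 2*(m+1)+1 = 2*m+3 by ring]; ring
  rcases le_total 0 z with h | h
  · rw [abs_of_nonneg h]; exact main z h
  · have := main (-z) (by linarith)
    rw [abs_of_nonpos h]
    have e : ev (sinL m) (-z) = - ev (sinL m) z := by
      rw [ev_sinL, ev_sinL, ← Finset.sum_neg_distrib]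
      refine Finset.sum_congr rfl fun j _ => ?_
      rw [Odd.neg_pow ⟨j, rfl⟩]; ring
    rw [e, Real.sin_neg, ← abs_neg] at this
    rw [show Real.sin z - ev (sinL m) z = -(-Real.sin z - -ev (sinL m) z) by ring]
    exact this

lemma cos_abs (m : ℕ) (z : ℝ) : |Real.cos z - ev (cosL m) z| ≤ |z|^(2*m+2) / (2*m+2).factorial := by
  have main : ∀ x : ℝ, 0 ≤ x → |Real.cos x - ev (cosL m) x| ≤ x^(2*m+2) / (2*m+2).factorial := by
    intro x hx
    have h1 := (sincos_alt m).1 x hx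
    have h2 := (sincos_alt (m+1)).1 x hx
    rw [← ev_cosL] at h1 h2
    refine alt_abs m _ _ (ev (cosL (m+1)) x) _ ?_ h1 h2
    rw [ev_cosL, ev_cosL, Finset.sum_range_succ _ (m+1)]
    rw [show 2*(m+1) = 2*m+2 by ring]; ring
  have e : ev (cosL m) z = ev (cosL m) |z| := by
    rw [ev_cosL, ev_cosL]
    refine Finset.sum_congr rfl fun j _ => ?_
    rw [pow_mul, pow_mul, sq_abs]
  rw [e, ← Real.cos_abs]
  exact main |z| (abs_nonneg z)

/-- rational approximation to the critical point -/
def xq : ℚ := 2485711582928390865 / 10^18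

lemma ratle {a b : ℚ} (h : a ≤ b) : (a:ℝ) ≤ (b:ℝ) := (Rat.cast_le (K := ℝ)).2 h

def sq0 : ℚ := 6098577380608168444034499 / 10^25
def cq0 : ℚ := -7925109080178922746610380 / 10^25

lemma sin_xq : |Real.sin (xq:ℝ) - (sq0:ℝ)| ≤ 1/10^20 := by
  have h := sin_abs 15 (xq:ℝ)
  rw [ev_cast] at h
  have hx : (0:ℚ) ≤ xq := by decide +kernel
  rw [abs_of_nonneg (show (0:ℝ) ≤ (xq:ℝ) by exact_mod_cast hx)] at h
  have h1 : xq^(2*15+3) / ((2*15+3).factorial : ℚ) ≤ 1/10^21 := by decide +kernel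
  have h2 : |evq (sinL 15) xq - sq0| ≤ 1/10^21 := by decide +kernel
  have h1' := ratle h1
  have h2' := ratle h2
  push_cast at h1' h2'
  have := abs_sub_le (Real.sin (xq:ℝ)) (evq (sinL 15) xq : ℝ) (sq0:ℝ)
  have h3 : (1:ℝ)/10^21 + 1/10^21 ≤ 1/10^20 := by norm_num
  linarith

lemma cos_xq : |Real.cos (xq:ℝ) - (cq0:ℝ)| ≤ 1/10^20 := by
  have h := cos_abs 15 (xq:ℝ)
  rw [ev_cast] at h
  have hx : (0:ℚ) ≤ xq := by decide +kernel
  rw [abs_of_nonneg (show (0:ℝ) ≤ (xq:ℝ) by exact_mod_cast hx)] at h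
  have h1 : xq^(2*15+2) / ((2*15+2).factorial : ℚ) ≤ 1/10^21 := by decide +kernel
  have h2 : |evq (cosL 15) xq - cq0| ≤ 1/10^21 := by decide +kernel
  have h1' := ratle h1
  have h2' := ratle h2
  push_cast at h1' h2'
  have := abs_sub_le (Real.cos (xq:ℝ)) (evq (cosL 15) xq : ℝ) (cq0:ℝ)
  have h3 : (1:ℝ)/10^21 + 1/10^21 ≤ 1/10^20 := by norm_num
  linarith

end QP
namespace QP
open Real MeasureTheory intervalIntegral

def SL : List ℚ := padd (psmul sq0 (cosL 7)) (psmul cq0 (sinL 7))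
def CL : List ℚ := padd (psmul cq0 (cosL 7)) (psmul (-sq0) (sinL 7))
/-- Taylor coefficients of `cc` at `xq` -/
def T4 : List ℚ := [-323018537064249186595/10^20, -798284286444960234431/10^20, -1137371447837267567836/10^20,
  -1700793699303760058272/10^20, -2589307396254638529062/10^20]
def T5 : List ℚ := 0 :: pintAux 0 T4

lemma small_pow {z : ℝ} (hz : |z| ≤ 0.3) (k : ℕ) : |z|^k ≤ 0.3^k := pow_le_pow_left₀ (abs_nonneg _) hz k

lemma lin_abs (a b c d a' b' c' d' e : ℝ) (ha : |a - a'| ≤ e) (hb : |b - b'| ≤ e) (hc : |c-c'| ≤ e) (hd : |d-d'| ≤ e)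
    (h1 : |b| ≤ 1) (h2 : |d| ≤ 1) (h3 : |a'| ≤ 1) (h4 : |c'| ≤ 1) : |(a*b + c*d) - (a'*b' + c'*d')| ≤ 4*e := by
  have e1 : (a*b + c*d) - (a'*b' + c'*d') = (a-a')*b + a'*(b-b') + ((c-c')*d + c'*(d-d')) := by ring
  have t (u v : ℝ) (hu : |u| ≤ e) (hv : |v| ≤ 1) : |u * v| ≤ e := by
    rw [abs_mul]
    have := mul_le_mul hu hv (abs_nonneg v) ((abs_nonneg _).trans hu)
    linarith
  have k1 := t _ _ ha h1
  have k2 := t _ _ hb h3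
  have k3 := t _ _ hc h2
  have k4 := t _ _ hd h4
  rw [mul_comm] at k2 k4
  rw [e1]
  have := abs_add_le ((a-a')*b + a'*(b-b')) ((c-c')*d + c'*(d-d'))
  have := abs_add_le ((a-a')*b) (a'*(b-b'))
  have := abs_add_le ((c-c')*d) (c'*(d-d'))
  linarith

lemma sin_z {z : ℝ} (hz : |z| ≤ 0.3) : |Real.sin z - ev (sinL 7) z| ≤ 1/10^20 := by
  refine (sin_abs 7 z).trans ?_
  have := small_pow hz 17
  have h2 : ((2*7+3).factorial : ℝ) = 355687428096000 := by norm_num [Nat.factorial]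
  rw [h2, show 2*7+3 = 17 by norm_num]
  rw [div_le_iff₀ (by norm_num)]
  refine this.trans ?_
  norm_num

lemma cos_z {z : ℝ} (hz : |z| ≤ 0.3) : |Real.cos z - ev (cosL 7) z| ≤ 1/10^20 := by
  refine (cos_abs 7 z).trans ?_
  have := small_pow hz 16
  have h2 : ((2*7+2).factorial : ℝ) = 20922789888000 := by norm_num [Nat.factorial]
  rw [h2, show 2*7+2 = 16 by norm_num]
  rw [div_le_iff₀ (by norm_num)]
  refine this.trans ?_
  norm_num

lemma abs_sq0 : |(sq0:ℝ)| ≤ 1 := by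
  have : |sq0| ≤ 1 := by decide +kernel
  exact_mod_cast this
lemma abs_cq0 : |(cq0:ℝ)| ≤ 1 := by
  have : |cq0| ≤ 1 := by decide +kernel
  exact_mod_cast this

lemma sin_xz {z : ℝ} (hz : |z| ≤ 0.3) : |Real.sin (xq + z) - ev SL z| ≤ 1/10^19 := by
  rw [Real.sin_add, SL, ev_add, ev_smul, ev_smul]
  refine (lin_abs _ _ _ _ _ _ _ _ (1/10^20) sin_xq (cos_z hz) cos_xq (sin_z hz) (Real.abs_cos_le_one _) (Real.abs_sin_le_one _) abs_sq0 abs_cq0).trans ?_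
  norm_num

lemma cos_xz {z : ℝ} (hz : |z| ≤ 0.3) : |Real.cos (xq + z) - ev CL z| ≤ 1/10^19 := by
  rw [Real.cos_add, CL, ev_add, ev_smul, ev_smul, sub_eq_add_neg (Real.cos xq * Real.cos z), ← neg_mul]
  refine (lin_abs _ _ _ _ _ _ _ _ (1/10^20) cos_xq (cos_z hz) ?_ (sin_z hz) (Real.abs_cos_le_one _) (Real.abs_sin_le_one _) abs_cq0 ?_).trans ?_
  · push_cast; rw [neg_sub_neg, abs_sub_comm]; exact sin_xq
  · push_cast; rw [abs_neg]; exact abs_sq0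
  · norm_num

lemma xq_val : (xq:ℝ) = 2485711582928390865 / 10^18 := by simp [xq]

lemma xz_mem {z : ℝ} (hz : |z| ≤ 0.3) : 2.18 < (xq:ℝ) + z ∧ (xq:ℝ) + z < 2.79 := by
  rw [xq_val]; have := abs_le.1 hz
  constructor <;> norm_num at this ⊢ <;> linarith

lemma sin_lb {z : ℝ} (hz : |z| ≤ 0.3) : 0.344 ≤ Real.sin (xq + z) := by
  rw [Real.sin_add]
  have h1 := abs_le.1 sin_xq
  have h2 := abs_le.1 cos_xq
  have h3 := Real.one_sub_sq_div_two_le_cos (x := z)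
  have h4 : |Real.sin z| ≤ 0.3 := (Real.abs_sin_le_abs).trans hz
  have h5 := abs_le.1 h4
  have h6 : z^2 ≤ 0.09 := by rw [← sq_abs]; exact (small_pow hz 2).trans (by norm_num)
  simp only [sq0, cq0] at h1 h2
  push_cast at h1 h2
  have h7 : (0.6098:ℝ) ≤ Real.sin xq := by norm_num at h1 ⊢; linarith
  have h8 : (-0.7926:ℝ) ≤ Real.cos xq ∧ Real.cos xq ≤ 0 := by norm_num at h2 ⊢; constructor <;> linarith
  have h9 : 0.955 ≤ Real.cos z := by norm_num at h6 ⊢; linarith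
  nlinarith

lemma xq_lt_pi {z : ℝ} (hz : |z| ≤ 0.3) : 0 < (xq:ℝ) + z ∧ (xq:ℝ) + z < π := by
  have := xz_mem hz; have := Real.pi_gt_d2; constructor <;> linarith

def DL : List ℚ := padd (pmul [xq, 1] CL) (psmul (-1) (pmul T4 SL))

lemma cc_taylor {z : ℝ} (hz : |z| ≤ 0.3) : |cc (xq + z) - ev T4 z| ≤ 77 * |z|^5 + 1/10^15 := by
  have hp := xq_lt_pi hz
  have hs := sin_lb hz
  have hs0 : 0 < Real.sin (xq + z) := by linarith
  rw [cc_eq hp.1.ne']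
  have e1 : ((xq:ℝ)+z) * Real.cos (xq+z) / Real.sin (xq+z) - ev T4 z = (((xq:ℝ)+z) * Real.cos (xq+z) - ev T4 z * Real.sin (xq+z)) / Real.sin (xq+z) := by
    field_simp
  rw [e1, abs_div, abs_of_pos hs0, div_le_iff₀ hs0]
  have hT : |ev T4 z| ≤ 10 := by
    refine (ev_abs T4 (r := 3/10) (by norm_num at hz ⊢; exact hz)).trans ?_
    have : pb T4 (3/10) ≤ 10 := by decide +kernel
    exact_mod_cast this
  have hD : ev DL z = ((xq:ℝ)+z) * ev CL z - ev T4 z * ev SL z := by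
    rw [DL, ev_add, ev_mul, ev_smul, ev_mul]; simp [ev]; ring
  have e2 : ((xq:ℝ)+z) * Real.cos (xq+z) - ev T4 z * Real.sin (xq+z) = ev DL z + ((xq:ℝ)+z) * (Real.cos (xq+z) - ev CL z) - ev T4 z * (Real.sin (xq+z) - ev SL z) := by
    rw [hD]; ring
  have k1 : |((xq:ℝ)+z) * (Real.cos (xq+z) - ev CL z)| ≤ 3 * (1/10^19) := by
    rw [abs_mul]
    refine mul_le_mul ?_ (cos_xz hz) (abs_nonneg _) (by norm_num)
    rw [abs_of_pos hp.1]; have := xz_mem hz; linarith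
  have k2 : |ev T4 z * (Real.sin (xq+z) - ev SL z)| ≤ 10 * (1/10^19) := by
    rw [abs_mul]
    exact mul_le_mul hT (sin_xz hz) (abs_nonneg _) (by norm_num)
  have k3 : |ev DL z| ≤ 26.4 * |z|^5 + 1/10^16 := by
    rw [ev_split 5 DL z]
    have a1 : |ev (DL.take 5) z| ≤ 1/10^16 := by
      refine (ev_abs _ (r := 3/10) (by norm_num at hz ⊢; exact hz)).trans ?_
      have : pb (DL.take 5) (3/10) ≤ 1/10^16 := by decide +kernel
      have := ratle this
      push_cast at this; exact this
    have a2 : |ev (DL.drop 5) z| ≤ 26.4 := by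
      refine (ev_abs _ (r := 3/10) (by norm_num at hz ⊢; exact hz)).trans ?_
      have : pb (DL.drop 5) (3/10) ≤ 264/10 := by decide +kernel
      have := ratle this
      push_cast at this; norm_num at this ⊢; exact this
    have := abs_add_le (ev (DL.take 5) z) (z^5 * ev (DL.drop 5) z)
    have a3 : |z^5 * ev (DL.drop 5) z| ≤ |z|^5 * 26.4 := by
      rw [abs_mul, abs_pow]; exact mul_le_mul_of_nonneg_left a2 (by positivity)
    linarith
  rw [e2]
  have b1 := abs_add_le (ev DL z) (((xq:ℝ)+z) * (Real.cos (xq+z) - ev CL z))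
  have b2 := abs_sub (ev DL z + ((xq:ℝ)+z) * (Real.cos (xq+z) - ev CL z)) (ev T4 z * (Real.sin (xq+z) - ev SL z))
  have h0 : 0 ≤ |z|^5 := by positivity
  have b3 : (77 * |z|^5 + 1/10^15) * 0.344 ≤ (77 * |z|^5 + 1/10^15) * Real.sin (xq+z) := mul_le_mul_of_nonneg_left hs (by positivity)
  refine le_trans ?_ b3
  refine le_trans b2 ?_
  norm_num at k1 k2 k3 b1 ⊢
  linarith

lemma ev_deriv_aux (p : List ℚ) (k : ℕ) (z : ℝ) : HasDerivAt (fun z => z^(k+1) * ev (pintAux k p) z) (z^k * ev p z) z := by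
  induction p generalizing k with
  | nil => simpa [pintAux, ev] using hasDerivAt_const z (0:ℝ)
  | cons a p ih =>
    have h1 := ((hasDerivAt_pow (k+1) z).mul_const ((a:ℝ)/(k+1))).add (ih (k+1))
    have e : (fun z : ℝ => z^(k+1) * ev (pintAux k (a::p)) z) = (fun z : ℝ => z^(k+1) * ((a:ℝ)/(k+1))) + fun z : ℝ => z^(k+1+1) * ev (pintAux (k+1) p) z := by
      funext y; simp only [pintAux, ev, Pi.add_apply]; push_cast; ring
    rw [e]
    refine h1.congr_deriv ?_
    simp only [ev]
    have : (k:ℝ)+1 ≠ 0 := by positivity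
    push_cast
    field_simp
    ring

lemma ev_deriv (p : List ℚ) (z : ℝ) : HasDerivAt (ev (0 :: pintAux 0 p)) (ev p z) z := by
  have := ev_deriv_aux p 0 z
  simp only [zero_add, pow_one, pow_zero, one_mul] at this
  refine this.congr_of_eventuallyEq (Filter.Eventually.of_forall fun y => ?_)
  simp [ev]

/-- growth from a derivative bound, two-sided -/
lemma grow (f f' : ℝ → ℝ) (r A ε : ℝ) (k : ℕ) (hf : ∀ z, |z| ≤ r → HasDerivAt f (f' z) z)
    (hb : ∀ z, |z| ≤ r → |f' z| ≤ A * |z|^k + ε) {z : ℝ} (hz : |z| ≤ r) : |f z - f 0| ≤ A * |z|^(k+1)/(k+1) + ε * |z| := by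
  have main : ∀ σ : ℝ, |σ| = 1 → ∀ t, 0 ≤ t → t ≤ r → |f (σ*t) - f 0| ≤ A * t^(k+1)/(k+1) + ε*t := by
    intro σ hσ t ht htr
    have hm : ∀ x, 0 ≤ x → x ≤ t → |σ * x| ≤ r ∧ |σ*x| = x := by
      intro x h0 h1; rw [abs_mul, hσ, one_mul, abs_of_nonneg h0]; exact ⟨h1.trans htr, rfl⟩
    have hd : ∀ x ∈ Set.Icc 0 t, HasDerivAt (fun x => f (σ*x) - f 0) (f' (σ*x) * σ) x := by
      intro x hx
      have h1 := hf (σ*x) (hm x hx.1 hx.2).1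
      have h2 : HasDerivAt (fun x => σ * x) σ x := by simpa using (hasDerivAt_id x).const_mul σ
      exact (h1.comp x h2).sub_const _
    have := image_norm_le_of_norm_deriv_right_le_deriv_boundary (f := fun x => f (σ*x) - f 0) (f' := fun x => f' (σ*x) * σ) (a := 0) (b := t)
      (B := fun x => A * x^(k+1)/(k+1) + ε*x) (B' := fun x => A * x^k + ε)
      (fun x hx => (hd x hx).continuousAt.continuousWithinAt)
      (fun x hx => (hd x ⟨hx.1, hx.2.le⟩).hasDerivWithinAt) (by simp)
      (fun x => by
        have h1 := (((hasDerivAt_pow (k+1) x).const_mul A).div_const ((k:ℝ)+1)).add ((hasDerivAt_id x).const_mul ε)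
        refine h1.congr_deriv ?_
        have : (k:ℝ)+1 ≠ 0 := by positivity
        push_cast
        field_simp)
      (fun x hx => by
        have h1 := hm x hx.1 hx.2.le
        have h2 := hb (σ*x) h1.1
        rw [h1.2] at h2
        rw [Real.norm_eq_abs, abs_mul, hσ, mul_one]; exact h2)
      (Set.right_mem_Icc.2 ht)
    simpa using this
  rcases le_total 0 z with h | h
  · have := main 1 (by simp) z h (by rwa [abs_of_nonneg h] at hz)
    rw [abs_of_nonneg h]; simpa using this
  · have := main (-1) (by simp) (-z) (by linarith) (by rwa [abs_of_nonpos h] at hz)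
    rw [abs_of_nonpos h]; simpa using this

lemma Psi_taylor0 {z : ℝ} (hz : |z| ≤ 0.3) : |(Psi (xq + z) - Psi xq) - ev T5 z| ≤ 77 * |z|^6/6 + 1/10^15 := by
  have := grow (fun z => Psi (xq+z) - ev T5 z) (fun z => cc (xq+z) - ev T4 z) 0.3 77 (1/10^15) 5 (fun z hz => by
    have hp := xq_lt_pi hz
    have h1 : HasDerivAt (fun z => Psi (xq+z)) (cc (xq+z)) z := by
      simpa using (hasDerivAt_Psi hp.1 hp.2).comp_const_add (xq:ℝ) z
    exact h1.sub (ev_deriv T4 z)) (fun z hz => cc_taylor hz) hz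
  have e0 : ev T5 0 = 0 := by simp [T5, ev]
  simp only [add_zero, e0, sub_zero] at this
  have e : Psi (xq + z) - Psi xq - ev T5 z = Psi (xq+z) - ev T5 z - Psi xq := by ring
  rw [e]
  refine this.trans ?_
  norm_num at hz ⊢
  linarith

lemma c2_bd {z : ℝ} (hz : |z| ≤ 0.3) : -150 ≤ c2 (xq + z) ∧ c2 (xq+z) ≤ 0 := by
  have hp := xq_lt_pi hz
  refine ⟨?_, c2_nonpos hp.1 hp.2⟩
  have hs := sin_lb hz
  have hx := xz_mem hz
  set x := (xq:ℝ) + z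
  have hs0 : 0 < Real.sin x := by linarith
  unfold c2
  rw [le_div_iff₀ (by positivity)]
  have hc : -1 ≤ Real.cos x := Real.neg_one_le_cos x
  have h1 := Real.sin_sq_add_cos_sq x
  have hc2 : -0.94 ≤ Real.cos x := by nlinarith
  have h2 : (0.118336:ℝ) * Real.sin x ≤ Real.sin x^3 := by nlinarith
  nlinarith
end QP
namespace QP
open Real MeasureTheory intervalIntegral

lemma Psi_half : Psi (π/2) = π/2 * Real.log 2 := by
  have hpi := Real.pi_pos
  have hint1 : IntervalIntegrable (fun s => Real.log (Real.sin s)) volume 0 (π/2) := intervalIntegrable_log_sin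
  have hint2 : IntervalIntegrable cc volume 0 (π/2) := cc_int le_rfl hpi (by positivity) (by linarith)
  have h := integral_eq_sub_of_hasDerivAt_of_le (a := 0) (b := π/2) (f := fun s => (Real.sin s * Real.log (Real.sin s)) / Real.sinc s)
    (f' := fun s => Real.log (Real.sin s) + cc s) (by positivity)
    (by
      intro s hs
      refine ContinuousAt.continuousWithinAt ?_
      refine ContinuousAt.div ?_ Real.continuous_sinc.continuousAt (sinc_pos hs.1 (by linarith [hs.2])).ne'
      exact (Real.continuous_mul_log.comp Real.continuous_sin).continuousAt)
    (by
      intro s hs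
      have hs1 : s < π := by linarith [hs.2]
      have hsin := sin_pos' hs.1 hs1
      have h1 : HasDerivAt (fun s => s * Real.log (Real.sin s)) (Real.log (Real.sin s) + cc s) s := by
        have := (hasDerivAt_id s).mul ((Real.hasDerivAt_sin s).log hsin.ne')
        refine this.congr_deriv ?_
        rw [cc_eq hs.1.ne']; simp; ring
      refine h1.congr_of_eventuallyEq ?_
      filter_upwards [lt_mem_nhds hs.1, gt_mem_nhds hs1] with y hy hy1
      have := sin_pos' hy hy1
      rw [Real.sinc_of_ne_zero hy.ne']
      field_simp)
    (hint1.add hint2)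
  rw [integral_add hint1 hint2, integral_log_sin_zero_pi_div_two] at h
  simp at h
  rw [Psi]; linarith

lemma Psi_refl {d : ℝ} (h0 : 0 < d) (h1 : d ≤ π/2) : Psi (π - d) + Psi d = π * Real.log (2 * Real.sin d) := by
  have hpi := Real.pi_pos
  have key : ∀ x ∈ Set.Icc d (π/2), HasDerivAt (fun d => Psi (π - d) + Psi d - π * Real.log (2 * Real.sin d)) 0 x := by
    intro x hx
    have hx0 : 0 < x := h0.trans_le hx.1
    have hx1 : x < π := by linarith [hx.2]
    have hs := sin_pos' hx0 hx1
    have a1 := (hasDerivAt_Psi (x := π - x) (by linarith) (by linarith)).comp_const_sub π x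
    have a2 := hasDerivAt_Psi hx0 hx1
    have a3 := ((((Real.hasDerivAt_sin x).const_mul 2).log (by positivity)).const_mul π)
    refine ((a1.add a2).sub a3).congr_deriv ?_
    rw [cc_eq hx0.ne', cc_eq (by linarith), Real.sin_pi_sub, Real.cos_pi_sub]
    field_simp; ring
  have hc := constant_of_has_deriv_right_zero (f := fun d => Psi (π - d) + Psi d - π * Real.log (2 * Real.sin d)) (a := d) (b := π/2)
    (fun x hx => (key x hx).continuousAt.continuousWithinAt) (fun x hx => (key x ⟨hx.1, hx.2.le⟩).hasDerivWithinAt) (π/2) ⟨h1, le_rfl⟩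
  rw [show π - π/2 = π/2 by ring, Psi_half, Real.sin_pi_div_two, mul_one] at hc
  linarith

def ccL : List ℚ := [1, 0, -1/3, 0, -1/45, 0, -2/945, 0, -1/4725, 0, -2/93555, 0, -1382/638512875, 0, -4/18243225, 0, -3617/162820783125, 0, -87734/38979295480125, 0, -349222/1531329465290625, 0, -310732/13447856940643125]
def ccE : List ℚ := padd (cosL 12) (psmul (-1) (pmul ccL (sinL 12).tail))

lemma cc_series {s : ℝ} (h0 : 0 < s) (h1 : s ≤ 0.66) : |cc s - ev ccL s| ≤ 1/10^15 := by
  have hpi := Real.pi_gt_three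
  have hsin := sin_pos' h0 (by linarith)
  have habs : |s| ≤ ((66/100 : ℚ):ℝ) := by rw [abs_of_pos h0]; norm_num at h1 ⊢; exact h1
  have hsl : 0.9 * s ≤ Real.sin s := by
    have := Real.sin_gt_sub_cube h0
    have h2 : s^2 ≤ 0.5 := by nlinarith
    nlinarith [mul_le_mul_of_nonneg_left h2 h0.le]
  rw [cc_eq h0.ne']
  have e1 : s * Real.cos s / Real.sin s - ev ccL s = (s * Real.cos s - ev ccL s * Real.sin s) / Real.sin s := by field_simp
  rw [e1, abs_div, abs_of_pos hsin, div_le_iff₀ hsin]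
  have k0 : ev (sinL 12) s = s * ev (sinL 12).tail s := by
    have : sinL 12 = 0 :: (sinL 12).tail := by decide +kernel
    rw [this]; simp [ev]
  have hE : s * ev ccE s = s * ev (cosL 12) s - ev ccL s * ev (sinL 12) s := by
    rw [k0, ccE, ev_add, ev_smul, ev_mul]; push_cast; ring
  have e2 : s * Real.cos s - ev ccL s * Real.sin s = s * ev ccE s + s * (Real.cos s - ev (cosL 12) s) - ev ccL s * (Real.sin s - ev (sinL 12) s) := by
    rw [hE]; ring
  have q1 : |ev ccE s| ≤ 2/10^16 := by
    refine (ev_abs _ habs).trans ?_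
    have : pb ccE (66/100) ≤ 2/10^16 := by decide +kernel
    have := ratle this
    push_cast at this ⊢; exact this
  have q2 : |ev ccL s| ≤ 2 := by
    refine (ev_abs _ habs).trans ?_
    have : pb ccL (66/100) ≤ 2 := by decide +kernel
    exact_mod_cast this
  have q3 : |Real.cos s - ev (cosL 12) s| ≤ 1/10^20 := by
    refine (cos_abs 12 s).trans ?_
    have : |s|^(2*12+2) ≤ 1 := pow_le_one₀ (abs_nonneg _) (by rw [abs_of_pos h0]; linarith)
    have h2 : (10:ℝ)^20 ≤ ((2*12+2).factorial : ℝ) := by norm_num [Nat.factorial]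
    gcongr
  have q4 : |Real.sin s - ev (sinL 12) s| ≤ s * (1/10^20) := by
    refine (sin_abs 12 s).trans ?_
    have : |s|^(2*12+3) ≤ s := by
      rw [abs_of_pos h0, show 2*12+3 = 26+1 by norm_num, pow_succ]
      have : s^26 ≤ 1 := pow_le_one₀ h0.le (by linarith)
      nlinarith
    have h2 : (10:ℝ)^20 ≤ ((2*12+3).factorial : ℝ) := by norm_num [Nat.factorial]
    rw [mul_one_div]
    gcongr
  rw [e2]
  have b1 := abs_add_le (s * ev ccE s) (s * (Real.cos s - ev (cosL 12) s))
  have b2 := abs_sub (s * ev ccE s + s * (Real.cos s - ev (cosL 12) s)) (ev ccL s * (Real.sin s - ev (sinL 12) s))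
  have p1 : |s * ev ccE s| ≤ s * (2/10^16) := by rw [abs_mul, abs_of_pos h0]; gcongr
  have p2 : |s * (Real.cos s - ev (cosL 12) s)| ≤ s * (1/10^20) := by rw [abs_mul, abs_of_pos h0]; gcongr
  have p3 : |ev ccL s * (Real.sin s - ev (sinL 12) s)| ≤ 2 * (s * (1/10^20)) := by
    rw [abs_mul]; exact mul_le_mul q2 q4 (abs_nonneg _) (by norm_num)
  refine b2.trans ?_
  have hh : s*(2/10^16) + s*(1/10^20) + 2*(s*(1/10^20)) ≤ 1/10^15 * (0.9*s) := by
    have : (2/10^16+1/10^20+2/10^20 : ℝ) ≤ 1/10^15*0.9 := by norm_num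
    nlinarith
  have hh2 : 1/10^15 * (0.9*s) ≤ 1/10^15 * Real.sin s := mul_le_mul_of_nonneg_left hsl (by norm_num)
  linarith

lemma Psi_series {s : ℝ} (h0 : 0 < s) (h1 : s ≤ 0.66) : |Psi s - ev (0 :: pintAux 0 ccL) s| ≤ 1/10^15 := by
  have hpi := Real.pi_gt_three
  have hc : Continuous (ev ccL) := by
    have : ∀ p : List ℚ, Continuous (ev p) := by
      intro p
      induction p with
      | nil => exact continuous_const
      | cons a p ih => exact continuous_const.add (continuous_id.mul ih)
    exact this _
  have hi := integral_eq_sub_of_hasDerivAt (a := 0) (b := s) (fun x _ => ev_deriv ccL x) (hc.intervalIntegrable _ _)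
  have e0 : ev (0 :: pintAux 0 ccL) 0 = 0 := by simp [ev]
  rw [e0, sub_zero] at hi
  rw [← hi, Psi, ← integral_sub (cc_int le_rfl (by linarith) h0.le (by linarith)) (hc.intervalIntegrable _ _)]
  have := norm_integral_le_of_norm_le_const (a := 0) (b := s) (C := 1/10^15) (f := fun x => cc x - ev ccL x) (by
    intro x hx
    rw [Set.uIoc_of_le h0.le] at hx
    exact cc_series hx.1 (hx.2.trans h1))
  refine this.trans ?_
  rw [sub_zero, abs_of_pos h0]
  norm_num at h1 ⊢; linarith

def dq : ℚ := 314159265358979323846/10^20 - xq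
def logT : ℚ := 1 - 1/(2*sq0)
def logq : ℚ := ∑ i ∈ Finset.range 24, logT^(i+1)/(i+1)

lemma log_close {a b e : ℝ} (ha : 1 ≤ a) (hb : 1 ≤ b) (h : |a - b| ≤ e) : |Real.log a - Real.log b| ≤ e := by
  have m : ∀ a b : ℝ, 1 ≤ a → 1 ≤ b → Real.log a - Real.log b ≤ |a - b| := by
    intro a b ha hb
    rw [← Real.log_div (by linarith) (by linarith)]
    have h1 := Real.log_le_sub_one_of_pos (show 0 < a/b by positivity)
    have h2 : a/b - 1 = (a-b)/b := by field_simp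
    rw [h2] at h1
    refine h1.trans ((div_le_div_of_nonneg_right (le_abs_self _) (by linarith)).trans ?_)
    exact div_le_self (abs_nonneg _) hb
  refine abs_le.2 ⟨?_, (m a b ha hb).trans h⟩
  have := m b a hb ha
  rw [abs_sub_comm] at this
  linarith

lemma log_sin_xq : |Real.log (2 * Real.sin xq) - (logq:ℝ)| ≤ 1/10^16 := by
  have h := sin_xq
  have hs : (1.2:ℝ) ≤ 2 * (sq0:ℝ) := by simp only [sq0]; push_cast; norm_num
  have h1 : |2 * Real.sin xq - 2 * (sq0:ℝ)| ≤ 1/10^19 := by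
    rw [← mul_sub, abs_mul]; norm_num at h ⊢; linarith
  have h2 : 1 ≤ 2 * Real.sin xq := by have := abs_le.1 h1; norm_num at this ⊢; linarith
  have k1 := log_close h2 (by linarith) h1
  have ht : |(logT:ℝ)| ≤ 1/5 := by
    have : |logT| ≤ 1/5 := by decide +kernel
    have := ratle this; push_cast at this; exact this
  have k2 := Real.abs_log_sub_add_sum_range_le (x := (logT:ℝ)) (by linarith) 24
  have e1 : 1 - (logT:ℝ) = (2*(sq0:ℝ))⁻¹ := by simp [logT]
  have e2 : (∑ i ∈ Finset.range 24, (logT:ℝ)^(i+1)/(i+1)) = (logq:ℝ) := by simp only [logq]; push_cast; rfl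
  rw [e1, Real.log_inv, e2] at k2
  have k3 : |(logT:ℝ)|^(24+1) / (1 - |(logT:ℝ)|) ≤ (1/5)^25/(1-1/5) := by gcongr
  have k4 : ((1/5:ℝ))^25/(1-1/5) ≤ 5/10^17 := by norm_num
  have k5 : |Real.log (2*(sq0:ℝ)) - (logq:ℝ)| ≤ 5/10^17 := by
    rw [abs_sub_comm, sub_eq_add_neg]; exact k2.trans (k3.trans k4)
  have := abs_sub_le (Real.log (2 * Real.sin xq)) (Real.log (2*(sq0:ℝ))) (logq:ℝ)
  norm_num at k1 k5 ⊢
  linarith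

lemma Psi_xq : |Psi xq| ≤ 1/10^14 := by
  have hp1 := Real.pi_gt_d20
  have hp2 := Real.pi_lt_d20
  have hd0 : (0.65:ℝ) ≤ π - xq := by rw [xq_val]; norm_num at hp1 ⊢; linarith
  have hd1 : π - (xq:ℝ) ≤ 0.66 := by rw [xq_val]; norm_num at hp2 ⊢; linarith
  have hr := Psi_refl (d := π - xq) (by linarith) (by norm_num at hp1 hd1 ⊢; linarith)
  rw [Real.sin_pi_sub, sub_sub_cancel] at hr
  have hdq : (dq:ℝ) = 314159265358979323846/10^20 - (xq:ℝ) := by simp [dq]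
  have hd2 : (0:ℝ) < (dq:ℝ) ∧ (dq:ℝ) ≤ 0.66 := by
    rw [hdq, xq_val]; norm_num
  have hdd : |(π - xq) - (dq:ℝ)| ≤ 1/10^19 := by
    rw [hdq, abs_le]; norm_num at hp1 hp2 ⊢; constructor <;> linarith
  have k1 : |Psi (π - xq) - Psi dq| ≤ 1/10^19 := by
    have e : Psi (π - xq) - Psi dq = ∫ s in (dq:ℝ)..(π - xq), cc s := by
      rw [Psi, Psi, integral_interval_sub_left (cc_int le_rfl Real.pi_pos (by linarith) (by linarith)) (cc_int le_rfl Real.pi_pos (by linarith) (by linarith))]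
    rw [e]
    have := norm_integral_le_of_norm_le_const (a := (dq:ℝ)) (b := π - xq) (C := 1) (f := cc) (by
      intro x hx
      have hx1 : 0 < x := (lt_min hd2.1 (by linarith)).trans hx.1
      have hx2 : x ≤ 0.66 := hx.2.trans (max_le hd2.2 hd1)
      have := cc_small hx1.le (by linarith)
      rw [Real.norm_eq_abs, abs_le]; constructor <;> nlinarith)
    rw [one_mul, Real.norm_eq_abs] at this
    exact this.trans hdd
  have k2 := Psi_series hd2.1 hd2.2
  rw [ev_cast] at k2
  have k3 := log_sin_xq
  have k4 : |(314159265358979323846/10^20 : ℚ) * logq - evq (0 :: pintAux 0 ccL) dq| ≤ 1/10^15 := by decide +kernel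
  have k4' := ratle k4
  push_cast at k4'
  have hl : |(logq:ℝ)| ≤ 1 := by
    have : |logq| ≤ 1 := by decide +kernel
    exact_mod_cast this
  have k5 : |π * Real.log (2 * Real.sin xq) - (314159265358979323846/10^20 : ℝ) * logq| ≤ 4/10^16 := by
    have e : π * Real.log (2 * Real.sin xq) - (314159265358979323846/10^20 : ℝ) * logq = π * (Real.log (2 * Real.sin xq) - logq) + (π - 314159265358979323846/10^20) * logq := by ring
    rw [e]
    refine (abs_add_le _ _).trans ?_
    rw [abs_mul, abs_mul, abs_of_pos Real.pi_pos]
    have a1 : |π - 314159265358979323846/10^20| ≤ 1/10^19 := by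
      rw [abs_le]; norm_num at hp1 hp2 ⊢; constructor <;> linarith
    have a2 := mul_le_mul a1 hl (abs_nonneg _) (by norm_num)
    have a3 := mul_le_mul (show π ≤ 3.2 by norm_num at hp2 ⊢; linarith) k3 (abs_nonneg _) (by norm_num)
    norm_num at a2 a3 ⊢
    linarith
  have e : Psi xq = (π * Real.log (2 * Real.sin xq) - (314159265358979323846/10^20 : ℝ) * logq) + ((314159265358979323846/10^20 : ℝ) * logq - (evq (0 :: pintAux 0 ccL) dq : ℝ)) - (Psi dq - (evq (0 :: pintAux 0 ccL) dq : ℝ)) - (Psi (π - xq) - Psi dq) := by linarith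
  rw [e]
  refine (abs_sub _ _).trans ?_
  have b1 := abs_sub (π * Real.log (2 * Real.sin xq) - (314159265358979323846/10^20 : ℝ) * logq + ((314159265358979323846/10^20 : ℝ) * logq - (evq (0 :: pintAux 0 ccL) dq : ℝ))) (Psi dq - (evq (0 :: pintAux 0 ccL) dq : ℝ))
  have b2 := abs_add_le (π * Real.log (2 * Real.sin xq) - (314159265358979323846/10^20 : ℝ) * logq) ((314159265358979323846/10^20 : ℝ) * logq - (evq (0 :: pintAux 0 ccL) dq : ℝ))
  norm_num at b1 b2 k1 k2 k4' k5 ⊢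
  linarith

lemma Psi_taylor {z : ℝ} (hz : |z| ≤ 0.3) : |Psi (xq + z) - ev T5 z| ≤ 77 * |z|^6/6 + 2/10^14 := by
  have h1 := Psi_taylor0 hz
  have h2 := Psi_xq
  have := abs_add_le ((Psi (xq + z) - Psi xq) - ev T5 z) (Psi xq)
  rw [show (Psi (xq + z) - Psi xq) - ev T5 z + Psi xq = Psi (xq + z) - ev T5 z by ring] at this
  norm_num at h1 h2 ⊢
  linarith
end QP
namespace QP
open Real MeasureTheory intervalIntegral

lemma Qpoly {y : ℝ} (h0 : 0 ≤ y) (h1 : y ≤ 9.88) :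
    0 ≤ 1/675 - 47/155925*y + 16294/638512875*y^2 - 2374/1915538625*y^3 + 32/820945125*y^4 - 8/8045262225*y^5 := by
  obtain ⟨s, rfl⟩ : ∃ s, y = 9.88 - s := ⟨9.88 - y, by ring⟩
  have hs0 : 0 ≤ s := by linarith
  have hs1 : s ≤ 9.88 := by linarith
  have a : 0 ≤ s^3 * (9.88 - s) := by apply mul_nonneg (by positivity); linarith
  have b2 : 0 ≤ s^2 := by positivity
  have b3 : 0 ≤ s^3 := by positivity
  have b5 : 0 ≤ s^5 := by positivity
  norm_num at a ⊢
  ring_nf at a ⊢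
  linarith

lemma csc_ineq {u : ℝ} (h0 : 0 < u) (h1 : u < π) : Real.sin u^2 * (1 + u^2/3 + u^4/15 + 2*u^6/189) ≤ u^2 := by
  have hc := (sincos_alt 7).1 (2*u) (by linarith)
  simp [Finset.sum_range_succ, Nat.factorial] at hc
  have e : Real.sin u^2 = (1 - Real.cos (2*u))/2 := by rw [Real.sin_sq, Real.cos_sq]; ring
  have hu : u^2 ≤ 9.88 := by
    have := Real.pi_lt_d4
    nlinarith
  have hq := Qpoly (sq_nonneg u) hu
  have hq2 := mul_nonneg (show (0:ℝ) ≤ (u^2)^5 by positivity) hq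
  set C := Real.cos (2*u)
  have hs : Real.sin u^2 ≤ (1 - (1 - (2*u)^2/2 + (2*u)^4/24 - (2*u)^6/720 + (2*u)^8/40320 - (2*u)^10/3628800 + (2*u)^12/479001600 - (2*u)^14/87178291200))/2 := by
    rw [e]; linarith
  have hp : 0 ≤ 1 + u^2/3 + u^4/15 + 2*u^6/189 := by positivity
  refine (mul_le_mul_of_nonneg_right hs hp).trans ?_
  nlinarith [hq2]

/-- cotangent minus its first Laurent terms -/
noncomputable def EE (u : ℝ) : ℝ := Real.cos u / Real.sin u - 1/u + u/3 + u^3/45 + 2*u^5/945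

lemma EE_antitone : AntitoneOn EE (Set.Ioo 0 π) := by
  have hd : ∀ u ∈ Set.Ioo 0 π, HasDerivAt EE (-1/Real.sin u^2 + 1/u^2 + 1/3 + u^2/15 + 2*u^4/189) u := by
    intro u hu
    have hs := sin_pos' hu.1 hu.2
    have hu0 := hu.1.ne'
    have h1 := (Real.hasDerivAt_cos u).div (Real.hasDerivAt_sin u) hs.ne'
    have h2 := hasDerivAt_inv hu0
    have h3 := (hasDerivAt_id u).div_const 3
    have h4 := (hasDerivAt_pow 3 u).div_const 45
    have h5 := ((hasDerivAt_pow 5 u).const_mul 2).div_const 945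
    have := (((h1.sub h2).add h3).add h4).add h5
    have e : EE = fun u => Real.cos u / Real.sin u - u⁻¹ + u/3 + u^3/45 + 2*u^5/945 := by
      funext y; simp [EE]
    rw [e]
    refine this.congr_deriv ?_
    have e := Real.sin_sq_add_cos_sq u
    have e2 : -Real.sin u * Real.sin u - Real.cos u * Real.cos u = -1 := by linarith
    rw [e2]; push_cast; field_simp; ring
  apply antitoneOn_of_deriv_nonpos (convex_Ioo 0 π)
  · exact fun u hu => (hd u hu).continuousAt.continuousWithinAt
  · intro u hu; rw [interior_Ioo] at hu; exact (hd u hu).differentiableAt.differentiableWithinAt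
  · intro u hu
    rw [interior_Ioo] at hu
    rw [(hd u hu).deriv]
    have hs := sin_pos' hu.1 hu.2
    have hu0 := hu.1
    have := csc_ineq hu.1 hu.2
    have h2 : 1/u^2 + 1/3 + u^2/15 + 2*u^4/189 ≤ 1/Real.sin u^2 := by
      rw [le_div_iff₀ (by positivity)]
      have : (1/u^2 + 1/3 + u^2/15 + 2*u^4/189) * Real.sin u^2 = Real.sin u^2 * (1 + u^2/3 + u^4/15 + 2*u^6/189) / u^2 := by field_simp
      rw [this, div_le_one (by positivity)]; assumption
    have e3 : -1/Real.sin u^2 = -(1/Real.sin u^2) := by ring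
    rw [e3]; linarith

lemma sum_pow2 (n : ℕ) : (n:ℝ)^3/3 ≤ ∑ k ∈ Finset.Icc 1 n, (k:ℝ)^2 := by
  induction n with
  | zero => simp
  | succ n ih =>
    rw [Finset.sum_Icc_succ_top (by omega)]; push_cast
    have : (0:ℝ) ≤ n := Nat.cast_nonneg n
    nlinarith
lemma sum_pow4 (n : ℕ) : (n:ℝ)^5/5 ≤ ∑ k ∈ Finset.Icc 1 n, (k:ℝ)^4 := by
  induction n with
  | zero => simp
  | succ n ih =>
    rw [Finset.sum_Icc_succ_top (by omega)]; push_cast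
    have h : (0:ℝ) ≤ n := Nat.cast_nonneg n
    have h2 : (0:ℝ) ≤ 10*n^3+20*n^2+15*n+4 := by positivity
    ring_nf at ih h2 ⊢
    linarith
lemma sum_pow6 (n : ℕ) : (n:ℝ)^7/7 ≤ ∑ k ∈ Finset.Icc 1 n, (k:ℝ)^6 := by
  induction n with
  | zero => simp
  | succ n ih =>
    rw [Finset.sum_Icc_succ_top (by omega)]; push_cast
    have h : (0:ℝ) ≤ n := Nat.cast_nonneg n
    have h2 : (0:ℝ) ≤ 21*n^5+70*n^4+105*n^3+84*n^2+35*n+6 := by positivity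
    ring_nf at ih h2 ⊢
    linarith

/-- weight -/
noncomputable def w (n κ : ℕ) (x : ℝ) : ℝ := W n x * Real.sin (x/n)^κ
/-- its logarithmic derivative -/
noncomputable def ell (n κ : ℕ) (x : ℝ) : ℝ := (∑ k ∈ Finset.Icc 1 n, cc (k*(x/n)) + κ * cc (x/n)) / x

lemma w_cont (n κ : ℕ) : Continuous (w n κ) := by
  unfold w; exact (W_cont n).mul (by fun_prop)

lemma arg_mem {n k : ℕ} {x : ℝ} (hk : k ∈ Finset.Icc 1 n) (h0 : 0 < x) (h1 : x < π) : 0 < (k:ℝ)*(x/n) ∧ (k:ℝ)*(x/n) < π := by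
  rw [Finset.mem_Icc] at hk
  have h2 : (1:ℝ) ≤ k := by exact_mod_cast hk.1
  have h3 : (k:ℝ) ≤ n := by exact_mod_cast hk.2
  have h4 : (0:ℝ) < n := by linarith
  refine ⟨by positivity, ?_⟩
  have : (k:ℝ)*(x/n) = (k/n)*x := by ring
  rw [this]
  have : (k:ℝ)/n ≤ 1 := (div_le_one h4).2 h3
  nlinarith

lemma arg_mem1 {n : ℕ} (hn : 1 ≤ n) {x : ℝ} (h0 : 0 < x) (h1 : x < π) : 0 < x/n ∧ x/n < π := by
  simpa using arg_mem (n := n) (k := 1) (by simp [hn]) h0 h1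

lemma w_pos (n κ : ℕ) (hn : 1 ≤ n) {x : ℝ} (h0 : 0 < x) (h1 : x < π) : 0 < w n κ x := by
  unfold w W
  have a := arg_mem1 hn h0 h1
  refine mul_pos (Finset.prod_pos fun k hk => ?_) (pow_pos (sin_pos' a.1 a.2) _)
  have := arg_mem hk h0 h1
  rw [mul_div_assoc]
  have := sin_pos' this.1 this.2
  linarith

lemma w_zero (n κ : ℕ) (hn : 1 ≤ n) : w n κ 0 = 0 := by
  unfold w W
  rw [Finset.prod_eq_zero (i := 1) (by simp [hn]) (by simp)]; simp

lemma w_pi (n κ : ℕ) (hn : 1 ≤ n) : w n κ π = 0 := by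
  unfold w W
  have : (n:ℝ) ≠ 0 := by positivity
  rw [Finset.prod_eq_zero (i := n) (by simp [hn]) (by rw [mul_div_assoc, mul_div_cancel₀ _ this]; simp)]; simp

lemma w_nonneg (n κ : ℕ) (hn : 1 ≤ n) {x : ℝ} (h0 : 0 ≤ x) (h1 : x ≤ π) : 0 ≤ w n κ x := by
  rcases h0.eq_or_lt with rfl | h0
  · rw [w_zero n κ hn]
  rcases h1.eq_or_lt with rfl | h1
  · rw [w_pi n κ hn]
  exact (w_pos n κ hn h0 h1).le

lemma prod_logderiv {ι : Type} (s : Finset ι) (f : ι → ℝ → ℝ) (l : ι → ℝ) (x : ℝ) (h : ∀ i ∈ s, HasDerivAt (f i) (l i * f i x) x) :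
    HasDerivAt (fun y => ∏ i ∈ s, f i y) ((∑ i ∈ s, l i) * ∏ i ∈ s, f i x) x := by
  classical
  induction s using Finset.induction_on with
  | empty => simpa using hasDerivAt_const x (1:ℝ)
  | insert i s hi ih =>
    have h1 := (h i (Finset.mem_insert_self i s)).mul (ih fun j hj => h j (Finset.mem_insert_of_mem hj))
    simp only [Finset.prod_insert hi, Finset.sum_insert hi]
    refine h1.congr_deriv ?_
    ring

lemma sin_lin_deriv {c x : ℝ} (hx : 0 < x) (h0 : 0 < c * x) (h1 : c * x < π) : HasDerivAt (fun y => Real.sin (c*y)) (cc (c*x)/x * Real.sin (c*x)) x := by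
  have hs := sin_pos' h0 h1
  have := ((hasDerivAt_id x).const_mul c).sin
  refine this.congr_deriv ?_
  rw [cc_eq h0.ne']
  simp only [id, mul_one]
  field_simp

lemma hasDerivAt_w (n κ : ℕ) (hn : 1 ≤ n) {x : ℝ} (h0 : 0 < x) (h1 : x < π) : HasDerivAt (w n κ) (ell n κ x * w n κ x) x := by
  have a : HasDerivAt (W n) ((∑ k ∈ Finset.Icc 1 n, cc (k*(x/n))/x) * W n x) x := by
    refine prod_logderiv (Finset.Icc 1 n) (fun k y => 2 * Real.sin (k*y/n)) (fun k => cc (k*(x/n))/x) x ?_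
    intro k hk
    have hm := arg_mem hk h0 h1
    have e : (k:ℝ)*(x/n) = (k/n)*x := by ring
    rw [e] at hm ⊢
    have := (sin_lin_deriv h0 hm.1 hm.2).const_mul 2
    have e2 : ∀ y:ℝ, (k:ℝ)*y/n = (k/n)*y := fun y => by ring
    simp only [e2]
    refine this.congr_deriv ?_
    ring
  have b : HasDerivAt (fun y => Real.sin (y/n)^κ) (κ * cc (x/n)/x * Real.sin (x/n)^κ) x := by
    have := prod_logderiv (Finset.range κ) (fun _ y => Real.sin (y/n)) (fun _ => cc (x/n)/x) x (fun _ _ => by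
      have hm := arg_mem1 hn h0 h1
      have e : x/n = (1/n)*x := by ring
      rw [e] at hm
      have := (sin_lin_deriv h0 hm.1 hm.2)
      have e2 : (fun y:ℝ => Real.sin (y/n)) = fun y => Real.sin ((1/n)*y) := by funext y; congr 1; ring
      rw [← e2, ← e] at this
      exact this)
    simp only [Finset.prod_const, Finset.sum_const, Finset.card_range, nsmul_eq_mul] at this
    refine this.congr_deriv ?_
    ring
  refine (a.mul b).congr_deriv ?_
  rw [ell, w, ← Finset.sum_div]; ring
end QP
namespace QP
open Real MeasureTheory intervalIntegral

lemma c1_eq {x : ℝ} (h0 : 0 < x) (h1 : x < π) : x * c1 x = cc x - x^2 - cc x^2 := by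
  have hs := sin_pos' h0 h1
  have e := Real.sin_sq_add_cos_sq x
  rw [cc_eq h0.ne', c1]
  field_simp
  linear_combination x * e

lemma cc_core {z : ℝ} (hz : |z| ≤ 0.3) : -7.6 ≤ cc (xq + z) ∧ cc (xq+z) ≤ 0 := by
  constructor
  · have h := cc_taylor hz
    have hT : |ev T4 z| ≤ 7.4 := by
      refine (ev_abs T4 (r := 3/10) (by norm_num at hz ⊢; exact hz)).trans ?_
      have : pb T4 (3/10) ≤ 74/10 := by decide +kernel
      have := ratle this; push_cast at this; norm_num at this ⊢; exact this
    have h5 := small_pow hz 5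
    have a1 := (abs_le.1 h).1
    have a2 := (abs_le.1 hT).1
    norm_num at h5 a1 a2 ⊢
    linarith
  · have hp := xq_lt_pi hz
    have hx := xz_mem hz
    rw [cc_eq hp.1.ne']
    have hs := sin_pos' hp.1 hp.2
    have hc : Real.cos (xq + z) ≤ 0 := Real.cos_nonpos_of_pi_div_two_le_of_le (by linarith [Real.pi_lt_d2]) (by linarith [Real.pi_pos])
    exact div_nonpos_of_nonpos_of_nonneg (mul_nonpos_of_nonneg_of_nonpos hp.1.le hc) hs.le

lemma em_core (n κ : ℕ) (hn : 1003 ≤ n) (hκ : κ ≤ 1) {z : ℝ} (hz : |z| ≤ 0.3) :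
    |((xq:ℝ)+z) * ell n κ (xq+z) - (n * Psi (xq+z)/(xq+z) + (cc (xq+z) - 1)/2 + κ + (xq+z)*c1 (xq+z)/(12*n))| ≤ 146/(n:ℝ)^2 := by
  have hp := xq_lt_pi hz
  have hx := xz_mem hz
  have hc := c2_bd hz
  have hκ1 : (κ:ℝ) ≤ 1 := by exact_mod_cast hκ
  have h := em n hn ((xq:ℝ)+z) hp.1 hp.2 κ (Nat.cast_nonneg κ) hκ1
  set x := (xq:ℝ)+z
  have e : x * ell n κ x = ∑ k ∈ Finset.Icc 1 n, cc (k*(x/n)) + κ * cc (x/n) := by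
    rw [ell, mul_div_cancel₀ _ hp.1.ne']
  rw [e]
  refine h.trans ?_
  have hn0 : (0:ℝ) < n := by positivity
  rw [div_pow, div_mul_eq_mul_div]
  gcongr
  have : x^2 ≤ 7.7841 := by nlinarith
  nlinarith

lemma ell_xq (n κ : ℕ) (hn : 1003 ≤ n) (hn2 : n ≤ 75000) (hκ : κ ≤ 1) : |ell n κ xq| ≤ 0.9 := by
  have h0 : |(0:ℝ)| ≤ 0.3 := by norm_num
  have h := em_core n κ hn hκ h0
  have hc := cc_core h0
  have hp := xq_lt_pi h0
  have hx := xz_mem h0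
  have ht := cc_taylor h0
  simp only [add_zero] at *
  have hN : (1003:ℝ) ≤ n := by exact_mod_cast hn
  have hN2 : (n:ℝ) ≤ 75000 := by exact_mod_cast hn2
  have e4 : ev T4 0 = -323018537064249186595/10^20 := by simp [T4, ev]
  rw [e4] at ht
  norm_num at ht
  have k1 : |n * Psi xq / xq| ≤ 0.001 := by
    rw [abs_div, abs_mul, abs_of_pos hp.1, abs_of_pos (show (0:ℝ) < n by linarith), div_le_iff₀ hp.1]
    have := Psi_xq
    have := mul_le_mul hN2 Psi_xq (abs_nonneg _) (by norm_num)
    norm_num at this hx ⊢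
    linarith
  have k2 : |(xq:ℝ) * c1 xq / (12*n)| ≤ 0.01 := by
    rw [c1_eq hp.1 hp.2, abs_div, abs_of_pos (show (0:ℝ) < 12*n by linarith), div_le_iff₀ (by linarith), abs_le]
    have : (xq:ℝ)^2 ≤ 7.8 := by nlinarith
    have : cc xq^2 ≤ 57.76 := by nlinarith
    constructor <;> nlinarith
  have k3 : 146/(n:ℝ)^2 ≤ 0.001 := by
    rw [div_le_iff₀ (by positivity)]; nlinarith
  have hκ1 : (κ:ℝ) ≤ 1 := by exact_mod_cast hκ
  have hκ0 : (0:ℝ) ≤ κ := Nat.cast_nonneg κ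
  have a1 := abs_le.1 k1
  have a2 := abs_le.1 k2
  have a3 := abs_le.1 (h.trans k3)
  have a4 := abs_le.1 ht
  have b1 : -2.13 ≤ (xq:ℝ) * ell n κ xq := by norm_num at a1 a2 a3 a4 ⊢; linarith
  have b2 : (xq:ℝ) * ell n κ xq ≤ 2.13 := by norm_num at a1 a2 a3 a4 ⊢; linarith
  have hxq : (2.48:ℝ) ≤ xq := by rw [xq_val]; norm_num
  rw [abs_le]
  constructor
  · by_contra hlt; push Not at hlt; nlinarith
  · by_contra hlt; push Not at hlt; nlinarith

lemma cc_div {η x : ℝ} (hx : 0 < x) (h0 : 0 < η) : cc (η*x)/x = η*EE (η*x) + (1/x - η^2*(x/3) - η^4*(x^3/45) - η^6*(2*x^5/945)) := by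
  rw [cc_eq (by positivity), EE]
  field_simp
  ring

lemma Smin {x : ℝ} (h0 : 0 < x) (h1 : x < π) :
    0.41 ≤ 1/(x*xq) + 1/9 + (x^2+x*xq+xq^2)/225 + 2*(x^4+x^3*xq+x^2*xq^2+x*xq^3+xq^4)/6615 := by
  have hpi := Real.pi_lt_d2
  have hq1 : (2.4857:ℝ) ≤ xq := by rw [xq_val]; norm_num
  have hq2 : (xq:ℝ) ≤ 2.4858 := by rw [xq_val]; norm_num
  have t1 : 2/2.35 - x/2.35^2 ≤ 1/x := by
    rw [le_div_iff₀ h0]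
    have e : (2/2.35 - x/2.35^2)*x = 1 - (x-2.35)^2/2.35^2 := by ring
    have : 0 ≤ (x-2.35)^2/2.35^2 := by positivity
    linarith
  have t1' : (2/2.35 - x/2.35^2)/2.4858 ≤ 1/(x*xq) := by
    rw [one_div, mul_inv, ← one_div, ← div_eq_mul_inv]
    rw [div_le_div_iff₀ (by norm_num) (by linarith)]
    have : 0 ≤ 2/2.35 - x/2.35^2 := by norm_num; linarith
    nlinarith
  have t2 : 2*2.35*x - 2.35^2 ≤ x^2 := by nlinarith [sq_nonneg (x-2.35)]
  have t3 : 3*2.35^2*x - 2*2.35^3 ≤ x^3 := by nlinarith [mul_nonneg (show 0 ≤ x + 2*2.35 by linarith) (sq_nonneg (x-2.35))]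
  have t4 : 4*2.35^3*x - 3*2.35^4 ≤ x^4 := by nlinarith [mul_nonneg (show 0 ≤ (x + 2.35)^2 + 2*2.35^2 by positivity) (sq_nonneg (x-2.35))]
  have p2 : (2.4857:ℝ)^2 ≤ xq^2 := by gcongr
  have p3 : (2.4857:ℝ)^3 ≤ xq^3 := by gcongr
  have p4 : (2.4857:ℝ)^4 ≤ xq^4 := by gcongr
  have q1 : x*2.4857 ≤ x*xq := by gcongr
  have q2 : x*2.4857^3 ≤ x*(xq:ℝ)^3 := by gcongr
  have q3 : x^2*2.4857^2 ≤ x^2*(xq:ℝ)^2 := by gcongr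
  have q4 : x^3*2.4857 ≤ x^3*(xq:ℝ) := by gcongr
  norm_num at *
  linarith

lemma F1 (n κ : ℕ) (hn : 1003 ≤ n) (hn2 : n ≤ 75000) (hκ : κ ≤ 1) {x : ℝ} (h0 : 0 < x) (h1 : x < π) :
    (x - xq) * ell n κ x ≤ 0.9 * |x - xq| - 0.41 * n * (x-xq)^2 := by
  have hq := xq_lt_pi (z := 0) (by norm_num)
  simp only [add_zero] at hq
  set y : ℝ := (xq:ℝ) with hy
  have hn1 : (0:ℝ) < n := by positivity
  have d3 : 0 ≤ (x-y)*(x^3-y^3) := by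
    have : (x-y)*(x^3-y^3) = (x-y)^2*(x^2+x*y+y^2) := by ring
    have := hq.1; rw [‹(x-y)*(x^3-y^3) = _›]; positivity
  have d5 : (x-y)*(x^5-y^5) = (x-y)^2*(x^4+x^3*y+x^2*y^2+x*y^3+y^4) := by ring
  have d5' : 0 ≤ (x-y)*(x^5-y^5) := by have := hq.1; rw [d5]; positivity
  have dinv : (x-y)*(1/x-1/y) = -(x-y)^2/(x*y) := by have := hq.1.ne'; field_simp; ring
  have dinv' : (x-y)*(1/x-1/y) ≤ 0 := by
    rw [dinv]; have := hq.1; exact div_nonpos_of_nonpos_of_nonneg (by nlinarith [sq_nonneg (x-y)]) (by positivity)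
  have key : ∀ k ∈ Finset.Icc 1 n, (x-y)*(cc (k*(x/n))/x - cc (k*(y/n))/y) ≤
      (x-y)*(1/x-1/y) - ((k:ℝ)^2*((x-y)^2/(3*n^2)) + (k:ℝ)^4*((x-y)*(x^3-y^3)/(45*n^4)) + (k:ℝ)^6*(2*((x-y)*(x^5-y^5))/(945*n^6))) := by
    intro k hk
    have m1 := arg_mem hk h0 h1
    have m2 := arg_mem hk hq.1 hq.2
    have hk1 : (1:ℝ) ≤ k := by exact_mod_cast (Finset.mem_Icc.1 hk).1
    have e1 : (k:ℝ)*(x/n) = (k/n)*x := by ring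
    have e2 : (k:ℝ)*(y/n) = (k/n)*y := by ring
    rw [e1] at m1 ⊢
    rw [e2] at m2 ⊢
    have hη : 0 < (k:ℝ)/n := by positivity
    rw [cc_div h0 hη, cc_div hq.1 hη]
    have mono : (x-y)*(EE ((k/n)*x) - EE ((k/n)*y)) ≤ 0 := by
      rcases le_total y x with h | h
      · exact mul_nonpos_of_nonneg_of_nonpos (by linarith) (sub_nonpos.2 (EE_antitone m2 m1 (by gcongr)))
      · exact mul_nonpos_of_nonpos_of_nonneg (by linarith) (sub_nonneg.2 (EE_antitone m1 m2 (by gcongr)))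
    have mono2 := mul_nonneg hη.le (neg_nonneg.2 mono)
    have e3 : (x-y)*((k/n)*EE ((k/n)*x) + (1/x - (k/n)^2*(x/3) - (k/n)^4*(x^3/45) - (k/n)^6*(2*x^5/945)) - ((k/n)*EE ((k/n)*y) + (1/y - (k/n)^2*(y/3) - (k/n)^4*(y^3/45) - (k/n)^6*(2*y^5/945))))
       = -((k/n)* -((x-y)*(EE ((k/n)*x) - EE ((k/n)*y)))) + ((x-y)*(1/x-1/y) - ((k:ℝ)^2*((x-y)^2/(3*n^2)) + (k:ℝ)^4*((x-y)*(x^3-y^3)/(45*n^4)) + (k:ℝ)^6*(2*((x-y)*(x^5-y^5))/(945*n^6)))) := by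
      ring
    rw [e3]
    linarith
  have hsum := Finset.sum_le_sum key
  rw [← Finset.mul_sum, Finset.sum_sub_distrib, ← Finset.sum_div, ← Finset.sum_div] at hsum
  replace hsum := hsum.trans_eq (by
    rw [Finset.sum_sub_distrib, Finset.sum_const, Nat.card_Icc, Nat.add_sub_cancel, nsmul_eq_mul, Finset.sum_add_distrib, Finset.sum_add_distrib, ← Finset.sum_mul, ← Finset.sum_mul, ← Finset.sum_mul])
  have s2 := mul_le_mul_of_nonneg_right (sum_pow2 n) (show 0 ≤ (x-y)^2/(3*(n:ℝ)^2) by positivity)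
  have s4 := mul_le_mul_of_nonneg_right (sum_pow4 n) (show 0 ≤ (x-y)*(x^3-y^3)/(45*(n:ℝ)^4) by positivity)
  have s6 := mul_le_mul_of_nonneg_right (sum_pow6 n) (show 0 ≤ 2*((x-y)*(x^5-y^5))/(945*(n:ℝ)^6) by positivity)
  have f2 : (n:ℝ)^3/3*((x-y)^2/(3*(n:ℝ)^2)) = n*(x-y)^2*(1/9) := by field_simp; ring
  have f4 : (n:ℝ)^5/5*((x-y)*(x^3-y^3)/(45*(n:ℝ)^4)) = n*(x-y)^2*((x^2+x*y+y^2)/225) := by field_simp; ring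
  have f6 : (n:ℝ)^7/7*(2*((x-y)*(x^5-y^5))/(945*(n:ℝ)^6)) = n*(x-y)^2*(2*(x^4+x^3*y+x^2*y^2+x*y^3+y^4)/6615) := by rw [d5]; field_simp; ring
  rw [f2] at s2; rw [f4] at s4; rw [f6] at s6
  -- the extra factor
  have kap : (x-y)*(cc (x/n)/x - cc (y/n)/y) ≤ 0 := by
    have hk : 1 ∈ Finset.Icc 1 n := by simp; omega
    have := key 1 hk
    simp only [Nat.cast_one, one_mul, one_pow] at this
    refine this.trans ?_
    have : 0 ≤ (x-y)^2/(3*(n:ℝ)^2) := by positivity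
    have : 0 ≤ (x-y)*(x^3-y^3)/(45*(n:ℝ)^4) := by positivity
    have : 0 ≤ 2*((x-y)*(x^5-y^5))/(945*(n:ℝ)^6) := by positivity
    linarith
  have kap2 := mul_nonneg (Nat.cast_nonneg (α := ℝ) κ) (neg_nonneg.2 kap)
  have hS := mul_le_mul_of_nonneg_left (Smin h0 h1) (show 0 ≤ n*(x-y)^2 by positivity)
  rw [← hy] at hS
  have hinv : (n:ℝ) * ((x-y)*(1/x-1/y)) = -(n*(x-y)^2*(1/(x*y))) := by rw [dinv]; ring
  rw [hinv] at hsum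
  have hell : (x-y)*(ell n κ x - ell n κ y) = (x-y)*((∑ k ∈ Finset.Icc 1 n, cc (k*(x/n)))/x - (∑ k ∈ Finset.Icc 1 n, cc (k*(y/n)))/y) - κ * -((x-y)*(cc (x/n)/x - cc (y/n)/y)) := by
    rw [ell, ell]; ring
  have hl := ell_xq n κ hn hn2 hκ
  rw [← hy] at hl
  have hl2 : (x-y)*ell n κ y ≤ 0.9*|x-y| := by
    refine (le_abs_self _).trans ?_
    rw [abs_mul, mul_comm]; gcongr
  have e9 : (x-y)*ell n κ x = (x-y)*(ell n κ x - ell n κ y) + (x-y)*ell n κ y := by ring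
  rw [e9, hell]
  linarith
end QP
namespace QP
open Real Set MeasureTheory

lemma w_contDiff (n κ : ℕ) : ContDiff ℝ 1 (w n κ) := by
  unfold w W
  refine ContDiff.mul (contDiff_prod fun k _ => ?_) ?_
  · fun_prop
  · fun_prop

lemma dw_cont (n κ : ℕ) : Continuous (deriv (w n κ)) := (w_contDiff n κ).continuous_deriv le_rfl

lemma dw_eq (n κ : ℕ) (hn : 1 ≤ n) {x : ℝ} (h0 : 0 < x) (h1 : x < π) : deriv (w n κ) x = ell n κ x * w n κ x :=
  (hasDerivAt_w n κ hn h0 h1).deriv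

lemma w_ibp (n κ : ℕ) (f f' : ℝ → ℝ) (hf : ∀ x, HasDerivAt f (f' x) x) (hc : Continuous f') (p q : ℝ) :
    ∫ x in p..q, (f' x * w n κ x + f x * deriv (w n κ) x) = f q * w n κ q - f p * w n κ p := by
  have hfc : Continuous f := continuous_iff_continuousAt.2 fun x => (hf x).continuousAt
  have hwc := w_cont n κ
  have hdc := dw_cont n κ
  refine intervalIntegral.integral_eq_sub_of_hasDerivAt (f := fun x => f x * w n κ x) ?_ ?_
  · intro x _
    exact (hf x).mul (((w_contDiff n κ).differentiable (by norm_num)) x).hasDerivAt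
  · exact Continuous.intervalIntegrable (by fun_prop) _ _

noncomputable def mom (n κ j : ℕ) : ℝ := ∫ x in (0:ℝ)..π, (x-xq)^j * w n κ x

lemma mom_nonneg (n κ k : ℕ) (hn : 1 ≤ n) : 0 ≤ mom n κ (2*k) := by
  refine intervalIntegral.integral_nonneg pi_pos.le fun x hx => ?_
  have := w_nonneg n κ hn hx.1 hx.2
  rw [pow_mul]; positivity

lemma z_deriv (k : ℕ) (x : ℝ) : HasDerivAt (fun x : ℝ => (x-(xq:ℝ))^(k+1)) (((k:ℝ)+1)*(x-xq)^k) x := by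
  have := ((hasDerivAt_id x).sub_const (xq:ℝ)).pow (k+1)
  refine this.congr_deriv ?_
  simp

lemma mom_step (n κ k : ℕ) (hn : 1003 ≤ n) (hn2 : n ≤ 75000) (hκ : κ ≤ 1) :
    mom n κ (2*(k+1)) ≤ (2*k+1.03)*(2.48/n) * mom n κ (2*k) := by
  have hnR : (1003:ℝ) ≤ n := by exact_mod_cast hn
  have hwc := w_cont n κ
  have hdc := dw_cont n κ
  have h := w_ibp n κ _ _ (z_deriv (2*k)) (by fun_prop) 0 π
  rw [w_pi n κ (by omega), w_zero n κ (by omega)] at h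
  have h2 : ∫ x in (0:ℝ)..π, ((((2*k:ℕ):ℝ)+1)*(x-xq)^(2*k) * w n κ x + (x-xq)^(2*k+1) * deriv (w n κ) x) ≤
     ∫ x in (0:ℝ)..π, ((2*k+1.03)*((x-xq)^(2*k) * w n κ x) - (0.41*n-6.75)*((x-xq)^(2*(k+1))*w n κ x)) := by
    refine intervalIntegral.integral_mono_on_of_le_Ioo pi_pos.le (Continuous.intervalIntegrable (by fun_prop) _ _) (Continuous.intervalIntegrable (by fun_prop) _ _) fun x hx => ?_
    rw [dw_eq n κ (by omega) hx.1 hx.2]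
    have hF := F1 n κ hn hn2 hκ hx.1 hx.2
    have hw := (w_pos n κ (by omega) hx.1 hx.2).le
    have hz : 0.9*|x-xq| ≤ 0.03 + 6.75*(x-xq)^2 := by
      rw [← sq_abs (x-(xq:ℝ))]; nlinarith [sq_nonneg (15*|x-(xq:ℝ)|-1)]
    have hp : 0 ≤ (x-(xq:ℝ))^(2*k) * w n κ x := by rw [pow_mul]; positivity
    have := mul_le_mul_of_nonneg_left (hF.trans (sub_le_sub_right hz _)) hp
    have e1 : (x-(xq:ℝ))^(2*k+1) = (x-xq)^(2*k)*(x-xq) := pow_succ _ _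
    have e2 : (x-(xq:ℝ))^(2*(k+1)) = (x-xq)^(2*k)*(x-xq)^2 := by rw [← pow_add]; ring
    rw [e1, e2]; push_cast
    nlinarith
  rw [h, intervalIntegral.integral_sub (Continuous.intervalIntegrable (by fun_prop) _ _) (Continuous.intervalIntegrable (by fun_prop) _ _),
    intervalIntegral.integral_const_mul, intervalIntegral.integral_const_mul] at h2
  change _ ≤ _ * mom n κ (2*k) - _ * mom n κ (2*(k+1)) at h2
  have hm := mom_nonneg n κ (k+1) (by omega)
  have hm0 := mom_nonneg n κ k (by omega)
  have : (0.40327*n) * mom n κ (2*(k+1)) ≤ (2*k+1.03)*mom n κ (2*k) := by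
    have : (0.40327*n) * mom n κ (2*(k+1)) ≤ (0.41*n-6.75)* mom n κ (2*(k+1)) := by gcongr; linarith
    linarith
  have hc : mom n κ (2*(k+1)) = (0.40327*n) * mom n κ (2*(k+1)) * (1/0.40327/n) := by field_simp
  rw [hc]
  calc _ ≤ ((2*k+1.03)*mom n κ (2*k)) * (1/0.40327/n) := by gcongr
    _ ≤ ((2*k+1.03)*mom n κ (2*k)) * (2.48/n) := by gcongr; norm_num
    _ = _ := by ring

noncomputable def Zw (n κ : ℕ) : ℝ := ∫ x in (0:ℝ)..π, w n κ x

lemma mom_zero (n κ : ℕ) : mom n κ 0 = Zw n κ := by simp [mom, Zw]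

lemma Zw_nonneg (n κ : ℕ) (hn : 1 ≤ n) : 0 ≤ Zw n κ := by rw [← mom_zero]; exact mom_nonneg n κ 0 hn

lemma mom_le (n κ : ℕ) (hn : 1003 ≤ n) (hn2 : n ≤ 75000) (hκ : κ ≤ 1) (k : ℕ) :
    mom n κ (2*k) ≤ (∏ j ∈ Finset.range k, (2*(j:ℝ)+1.03))*(2.48/n)^k * Zw n κ := by
  induction k with
  | zero => simp [mom_zero]
  | succ k ih =>
    refine (mom_step n κ k hn hn2 hκ).trans ?_
    rw [Finset.prod_range_succ]
    calc _ ≤ (2*k+1.03)*(2.48/n) * ((∏ j ∈ Finset.range k, (2*(j:ℝ)+1.03))*(2.48/n)^k * Zw n κ) := by gcongr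
      _ = _ := by ring

lemma mom2_le (n κ : ℕ) (hn : 1003 ≤ n) (hn2 : n ≤ 75000) (hκ : κ ≤ 1) : mom n κ 2 ≤ 2.5544/n * Zw n κ := by
  have := mom_le n κ hn hn2 hκ 1
  refine this.trans (le_of_eq ?_)
  rw [Finset.prod_range_one]; push_cast; ring
lemma mom4_le (n κ : ℕ) (hn : 1003 ≤ n) (hn2 : n ≤ 75000) (hκ : κ ≤ 1) : mom n κ 4 ≤ 19.2/n^2 * Zw n κ := by
  have h := mom_le n κ hn hn2 hκ 2
  have hZ := Zw_nonneg n κ (by omega)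
  refine h.trans ?_
  have : (∏ j ∈ Finset.range 2, (2*(j:ℝ)+1.03))*(2.48/n)^2 = (1.03*3.03*2.48^2)/n^2 := by
    norm_num [Finset.prod_range_succ]; ring
  rw [this]; gcongr; norm_num
lemma mom6_le (n κ : ℕ) (hn : 1003 ≤ n) (hn2 : n ≤ 75000) (hκ : κ ≤ 1) : mom n κ 6 ≤ 239.5/n^3 * Zw n κ := by
  have h := mom_le n κ hn hn2 hκ 3
  have hZ := Zw_nonneg n κ (by omega)
  refine h.trans ?_
  have : (∏ j ∈ Finset.range 3, (2*(j:ℝ)+1.03))*(2.48/n)^3 = (1.03*3.03*5.03*2.48^3)/n^3 := by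
    norm_num [Finset.prod_range_succ]; ring
  rw [this]; gcongr; norm_num
lemma mom24_le (n κ : ℕ) (hn : 1003 ≤ n) (hn2 : n ≤ 75000) (hκ : κ ≤ 1) : mom n κ 24 ≤ 0.3^24*(63.1/n^3) * Zw n κ := by
  have h := mom_le n κ hn hn2 hκ 12
  have hZ := Zw_nonneg n κ (by omega)
  have hnR : (1003:ℝ) ≤ n := by exact_mod_cast hn
  refine h.trans ?_
  refine mul_le_mul_of_nonneg_right ?_ hZ
  have h1 : (∏ j ∈ Finset.range 12, (2*(j:ℝ)+1.03)) ≤ 0.3^24*63.1*1003^9/2.48^12 := by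
    norm_num [Finset.prod_range_succ]
  calc _ ≤ (0.3^24*63.1*1003^9/2.48^12)*(2.48/(n:ℝ))^12 := by gcongr
    _ = 0.3^24*63.1*1003^9/((n:ℝ)^9*(n:ℝ)^3) := by rw [div_pow]; field_simp
    _ ≤ 0.3^24*63.1*(n:ℝ)^9/((n:ℝ)^9*(n:ℝ)^3) := by gcongr
    _ = _ := by field_simp

/-- the core interval -/
lemma core_lim : (0:ℝ) < xq - 0.3 ∧ ((xq:ℝ) + 0.3 < π) ∧ ((xq:ℝ)-0.3 < xq+0.3) := by
  have h1 := (xq_lt_pi (z := -0.3) (by rw [abs_le]; norm_num)).1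
  have h2 := (xq_lt_pi (z := 0.3) (by rw [abs_le]; norm_num)).2
  exact ⟨by linarith, h2, by linarith⟩

lemma tail_one (n κ : ℕ) (hn : 1 ≤ n) (φ : ℝ → ℝ) (hφ : Continuous φ) {p q : ℝ} (hp : 0 ≤ p) (hq : q ≤ π) (hpq : p ≤ q)
    (hb : ∀ x ∈ Icc p q, |φ x| ≤ 1) (hz : ∀ x ∈ Icc p q, 0.3 ≤ |x-(xq:ℝ)|) :
    |∫ x in p..q, φ x * w n κ x| ≤ (1/0.3^24) * ∫ x in p..q, (x-xq)^24 * w n κ x := by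
  have hwc := w_cont n κ
  refine (intervalIntegral.abs_integral_le_integral_abs hpq).trans ?_
  rw [← intervalIntegral.integral_const_mul]
  refine intervalIntegral.integral_mono_on hpq (Continuous.intervalIntegrable (by fun_prop) _ _) (Continuous.intervalIntegrable (by fun_prop) _ _) fun x hx => ?_
  have hw := w_nonneg n κ hn (hp.trans hx.1) (hx.2.trans hq)
  rw [abs_mul, abs_of_nonneg hw, ← mul_assoc]
  refine mul_le_mul_of_nonneg_right ((hb x hx).trans ?_) hw
  have : (0.3:ℝ)^24 ≤ |x-xq|^24 := pow_le_pow_left₀ (by norm_num) (hz x hx) _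
  rw [(show Even 24 by decide).pow_abs] at this
  rw [one_div, ← div_eq_inv_mul, le_div_iff₀ (by positivity)]
  linarith

lemma tail_le (n κ : ℕ) (hn : 1003 ≤ n) (hn2 : n ≤ 75000) (hκ : κ ≤ 1) (φ : ℝ → ℝ) (hφ : Continuous φ) (hb : ∀ x ∈ Icc 0 π, |φ x| ≤ 1) :
    |(∫ x in (0:ℝ)..π, φ x * w n κ x) - ∫ x in ((xq:ℝ)-0.3)..(xq+0.3), φ x * w n κ x| ≤ 63.1/n^3 * Zw n κ := by
  obtain ⟨c1, c2, c3⟩ := core_lim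
  have hwc := w_cont n κ
  have i1 : ∀ p q, IntervalIntegrable (fun x => φ x * w n κ x) volume p q := fun p q => Continuous.intervalIntegrable (by fun_prop) _ _
  have i2 : ∀ p q, IntervalIntegrable (fun x => (x-(xq:ℝ))^24 * w n κ x) volume p q := fun p q => Continuous.intervalIntegrable (by fun_prop) _ _
  have t1 := tail_one n κ (by omega) φ hφ (p := 0) (q := xq-0.3) le_rfl (by linarith) c1.le
    (fun x hx => hb x ⟨hx.1, by linarith [hx.2]⟩) (fun x hx => by rw [abs_of_nonpos] <;> linarith [hx.2])
  have t2 := tail_one n κ (by omega) φ hφ (p := xq+0.3) (q := π) (by linarith) le_rfl c2.le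
    (fun x hx => hb x ⟨by linarith [hx.1], hx.2⟩) (fun x hx => by rw [abs_of_nonneg] <;> linarith [hx.1])
  have s1 := intervalIntegral.integral_add_adjacent_intervals (i1 0 (xq-0.3)) (i1 (xq-0.3) (xq+0.3))
  have s2 := intervalIntegral.integral_add_adjacent_intervals (i1 0 (xq+0.3)) (i1 (xq+0.3) π)
  have s3 := intervalIntegral.integral_add_adjacent_intervals (i2 0 (xq-0.3)) (i2 (xq-0.3) (xq+0.3))
  have s4 := intervalIntegral.integral_add_adjacent_intervals (i2 0 (xq+0.3)) (i2 (xq+0.3) π)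
  have hmid : 0 ≤ ∫ x in ((xq:ℝ)-0.3)..(xq+0.3), (x-(xq:ℝ))^24 * w n κ x := by
    refine intervalIntegral.integral_nonneg c3.le fun x hx => ?_
    have := w_nonneg n κ (by omega) (show 0 ≤ x by linarith [hx.1]) (show x ≤ π by linarith [hx.2])
    rw [show 24 = 2*12 by rfl, pow_mul]; positivity
  have hm := mom24_le n κ hn hn2 hκ
  have : (∫ x in (0:ℝ)..π, φ x * w n κ x) - ∫ x in ((xq:ℝ)-0.3)..(xq+0.3), φ x * w n κ x =
     (∫ x in (0:ℝ)..(xq-0.3), φ x * w n κ x) + ∫ x in ((xq:ℝ)+0.3)..π, φ x * w n κ x := by linarith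
  rw [this]
  refine (abs_add_le _ _).trans ((add_le_add t1 t2).trans ?_)
  rw [← mul_add]
  have hm2 : (∫ x in (0:ℝ)..(xq-0.3), (x-(xq:ℝ))^24 * w n κ x) + ∫ x in ((xq:ℝ)+0.3)..π, (x-(xq:ℝ))^24 * w n κ x ≤ mom n κ 24 := by
    unfold mom; linarith
  calc _ ≤ (1/0.3^24) * (0.3^24*(63.1/n^3) * Zw n κ) := by gcongr; exact hm2.trans hm
    _ = _ := by ring

lemma core_mom (n κ : ℕ) (hn : 1003 ≤ n) (k : ℕ) : ∫ x in ((xq:ℝ)-0.3)..(xq+0.3), (x-(xq:ℝ))^(2*k) * w n κ x ≤ mom n κ (2*k) := by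
  obtain ⟨c1, c2, c3⟩ := core_lim
  have hwc := w_cont n κ
  unfold mom
  refine intervalIntegral.integral_mono_interval c1.le c3.le c2.le ?_ (Continuous.intervalIntegrable (by fun_prop) _ _)
  refine (ae_restrict_iff' measurableSet_Ioc).2 (Filter.Eventually.of_forall fun x hx => ?_)
  have := w_nonneg n κ (by omega) hx.1.le hx.2
  simp only [Pi.zero_apply]
  rw [pow_mul]; positivity

lemma bdry_le (n κ : ℕ) (hn : 1003 ≤ n) (hn2 : n ≤ 75000) (hκ : κ ≤ 1) :
    w n κ (xq+0.3) + w n κ (xq-0.3) ≤ 5320/n^3 * Zw n κ := by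
  obtain ⟨c1, c2, c3⟩ := core_lim
  have hnR : (1003:ℝ) ≤ n := by exact_mod_cast hn
  have hwc := w_cont n κ
  have hdc := dw_cont n κ
  have h := w_ibp n κ _ _ (z_deriv 24) (by fun_prop) (xq-0.3) (xq+0.3)
  have h2 : ∫ x in ((xq:ℝ)-0.3)..(xq+0.3), ((((24:ℕ):ℝ)+1)*(x-xq)^24 * w n κ x + (x-xq)^(24+1) * deriv (w n κ) x) ≤
     ∫ x in ((xq:ℝ)-0.3)..(xq+0.3), (25.27*((x-xq)^(2*12) * w n κ x)) := by
    refine intervalIntegral.integral_mono_on_of_le_Ioo c3.le (Continuous.intervalIntegrable (by fun_prop) _ _) (Continuous.intervalIntegrable (by fun_prop) _ _) fun x hx => ?_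
    have x0 : 0 < x := by linarith [hx.1]
    have x1 : x < π := by linarith [hx.2]
    rw [dw_eq n κ (by omega) x0 x1]
    have hF := F1 n κ hn hn2 hκ x0 x1
    have hw := (w_pos n κ (by omega) x0 x1).le
    have hz : |x-xq| ≤ 0.3 := by rw [abs_le]; constructor <;> linarith [hx.1, hx.2]
    have hq : 0 ≤ 0.41*(n:ℝ)*(x-xq)^2 := by positivity
    have hF2 : (x-xq)*ell n κ x ≤ 0.27 := by linarith
    have hp : 0 ≤ (x-(xq:ℝ))^(2*12) * w n κ x := by rw [pow_mul]; positivity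
    have := mul_le_mul_of_nonneg_left hF2 hp
    have e1 : (x-(xq:ℝ))^(24+1) = (x-xq)^(2*12)*(x-xq) := pow_succ _ _
    rw [e1]; push_cast
    norm_num at this ⊢
    linarith
  rw [h, intervalIntegral.integral_const_mul] at h2
  have h3 := (core_mom n κ hn 12).trans (mom24_le n κ hn hn2 hκ)
  rw [show (xq:ℝ)+0.3-xq = 0.3 by ring, show (xq:ℝ)-0.3-xq = -0.3 by ring, Odd.neg_pow (by decide)] at h2
  have h4 : (0.3:ℝ)^25*(w n κ (xq+0.3) + w n κ (xq-0.3)) ≤ 0.3^25*(5320/n^3 * Zw n κ) := by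
    have : (25.27:ℝ) * (0.3^24*(63.1/n^3) * Zw n κ) ≤ 0.3^25*(5320/n^3 * Zw n κ) := by
      have hZ : 0 ≤ Zw n κ/n^3 := div_nonneg (Zw_nonneg n κ (by omega)) (by positivity)
      calc _ = 25.27*0.3^24*63.1*(Zw n κ/n^3) := by ring
        _ ≤ 0.3^25*5320*(Zw n κ/n^3) := mul_le_mul_of_nonneg_right (by norm_num) hZ
        _ = _ := by ring
    linarith [mul_le_mul_of_nonneg_left h3 (show (0:ℝ) ≤ 25.27 by norm_num)]
  exact le_of_mul_le_mul_left h4 (by positivity)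
end QP
namespace QP
open Real Set MeasureTheory

/-- bivariate polynomials: outer variable h, inner variable z -/
noncomputable def ev2 : List (List ℚ) → ℝ → ℝ → ℝ
  | [], _, _ => 0
  | p :: P, h, z => ev p z + h * ev2 P h z
/-- sum -/
def padd2 : List (List ℚ) → List (List ℚ) → List (List ℚ)
  | [], q => q
  | p, [] => p
  | a :: p, b :: q => (padd a b) :: padd2 p q
/-- product by an inner polynomial -/
def psm2 (c : List ℚ) : List (List ℚ) → List (List ℚ)
  | [] => []
  | a :: p => (pmul c a) :: psm2 c p
/-- product -/
def pmul2 : List (List ℚ) → List (List ℚ) → List (List ℚ)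
  | [], _ => []
  | a :: p, q => padd2 (psm2 a q) ([] :: pmul2 p q)
/-- bound -/
def pb2 : List (List ℚ) → ℚ → ℚ → ℚ
  | [], _, _ => 0
  | p :: P, h, r => pb p r + h * pb2 P h r
/-- derivative -/
def pder : List ℚ → List ℚ
  | [] => []
  | _ :: p => padd p (0 :: pder p)

lemma ev2_add (p q : List (List ℚ)) (h z : ℝ) : ev2 (padd2 p q) h z = ev2 p h z + ev2 q h z := by
  induction p generalizing q with
  | nil => simp [padd2, ev2]
  | cons a p ih =>
    cases q with
    | nil => simp [padd2, ev2]
    | cons b q => simp [padd2, ev2, ih, ev_add]; ring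

lemma ev2_sm (c : List ℚ) (p : List (List ℚ)) (h z : ℝ) : ev2 (psm2 c p) h z = ev c z * ev2 p h z := by
  induction p with
  | nil => simp [psm2, ev2]
  | cons a p ih => simp [psm2, ev2, ih, ev_mul]; ring

lemma ev2_mul (p q : List (List ℚ)) (h z : ℝ) : ev2 (pmul2 p q) h z = ev2 p h z * ev2 q h z := by
  induction p with
  | nil => simp [pmul2, ev2]
  | cons a p ih => simp [pmul2, ev2, ev2_add, ev2_sm, ih, ev]; ring

lemma ev2_abs (p : List (List ℚ)) {h z : ℝ} {s r : ℚ} (hh : |h| ≤ s) (hz : |z| ≤ r) : |ev2 p h z| ≤ ((pb2 p s r : ℚ) : ℝ) := by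
  induction p with
  | nil => simp [ev2, pb2]
  | cons a p ih =>
    simp only [ev2, pb2]
    have hr : (0:ℝ) ≤ s := (abs_nonneg h).trans hh
    refine (abs_add_le _ _).trans ?_
    rw [abs_mul]
    push_cast
    have := mul_le_mul hh ih (abs_nonneg _) hr
    have := ev_abs a hz
    linarith

lemma pder_deriv (p : List ℚ) (z : ℝ) : HasDerivAt (ev p) (ev (pder p) z) z := by
  induction p with
  | nil => simpa [ev, pder] using hasDerivAt_const z (0:ℝ)
  | cons a p ih =>
    have := ((hasDerivAt_id z).mul ih).const_add (a:ℝ)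
    refine this.congr_deriv ?_
    simp [pder, ev_add, ev]

lemma pder2_deriv (P : List (List ℚ)) (h z : ℝ) : HasDerivAt (ev2 P h) (ev2 (P.map pder) h z) z := by
  induction P with
  | nil => simpa [ev2] using hasDerivAt_const z (0:ℝ)
  | cons a p ih =>
    have := (pder_deriv a z).add (ih.const_mul h)
    exact this

/-- Stein coefficients (divided by h) -/
def gL : List (List ℚ) :=
  [[1956328109262991738882433616/10^28, -2417362797424530428323184416/10^28, 560717226310540878454323251/10^28, -430791678188159439340226245/10^28, -77526441516440845378271422/10^28],
   [-7370113704922267449377312855/10^28, 3121122017640594959512224277/10^28, -2248437372459735515428167886/10^28],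
   [12437771172862367777068983450/10^28]]
def v0q : ℚ := 631930243871800229470842/10^24
def v1q : ℚ := 427769765189985439494702/10^24
def v2q : ℚ := 199861726433237347269136/10^24
/-- the phase -/
def tL : List (List ℚ) := [[0, v0q], [v1q*xq, v1q], [v2q*xq, v2q]]
def tL3 : List (List ℚ) := pmul2 tL (pmul2 tL tL)
def tL5 : List (List ℚ) := pmul2 tL3 (pmul2 tL tL)
/-- minus sine of the phase -/
def cL : List (List ℚ) := padd2 (psm2 [-1] tL) (padd2 (psm2 [1/6] tL3) (psm2 [-1/120] tL5))
/-- x (5+cc)/2 -/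
def bL : List ℚ := psmul (1/2) (pmul [xq,1] (padd [5] T4))
def dL : List ℚ := psmul (1/12) (pmul [xq,1] (padd T4 (psmul (-1) (padd (pmul [xq,1] [xq,1]) (pmul T4 T4)))))
/-- main part of the operator -/
def TgL : List (List ℚ) := padd2 ([] :: psm2 (pmul [xq,1] [xq,1]) (gL.map pder)) (padd2 (psm2 T5 gL) ([] :: padd2 (psm2 bL gL) ([] :: psm2 dL gL)))
def PPL : List (List ℚ) := padd2 cL (psm2 [-1] TgL)

lemma PP_bound {h z : ℝ} (h0 : 0 ≤ h) (h1 : h ≤ 1/1003) (h2 : 1 ≤ 75000^3*h^3) (hz : |z| ≤ 0.3) :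
    |ev2 PPL h z| ≤ 7.6*h^3+3.4*h^2*z^2+3.7*h*z^4+1.3*z^6 := by
  have hdec : PPL = PPL.getD 0 [] :: PPL.getD 1 [] :: PPL.getD 2 [] :: PPL.drop 3 := by decide +kernel
  have hz' : |z| ≤ ((3/10:ℚ):ℝ) := by norm_num at hz ⊢; exact hz
  have hh' : |h| ≤ ((1/1003:ℚ):ℝ) := by rw [abs_of_nonneg h0]; push_cast; exact h1
  have key : ∀ (p : List ℚ) (k : ℕ) (ε B : ℚ), Even k → pb (p.take k) (3/10) ≤ ε → pb (p.drop k) (3/10) ≤ B → |ev p z| ≤ ε + B*z^k := by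
    intro p k ε B hk he hB
    rw [ev_split k]
    refine (abs_add_le _ _).trans (add_le_add ((ev_abs _ hz').trans (by exact_mod_cast he)) ?_)
    rw [abs_mul, mul_comm, abs_pow, hk.pow_abs]
    exact mul_le_mul_of_nonneg_right ((ev_abs _ hz').trans (by exact_mod_cast hB)) (hk.pow_nonneg _)
  have k0 := key (PPL.getD 0 []) 6 (1/10^17) 1.3 (by decide) (by decide +kernel) (by decide +kernel)
  have k1 := key (PPL.getD 1 []) 4 (1/10^17) 3.7 (by decide) (by decide +kernel) (by decide +kernel)
  have k2 := key (PPL.getD 2 []) 2 (1/10^17) 3.4 (by decide) (by decide +kernel) (by decide +kernel)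
  have k3 : |ev2 (PPL.drop 3) h z| ≤ 7.5 := by
    refine (ev2_abs _ hh' hz').trans ?_
    have : pb2 (PPL.drop 3) (1/1003) (3/10) ≤ 7.5 := by decide +kernel
    have := (Rat.cast_le (K := ℝ)).2 this
    push_cast at this; norm_num at this ⊢; exact this
  rw [hdec]
  simp only [ev2]
  generalize ev (PPL.getD 0 []) z = e0 at *
  generalize ev (PPL.getD 1 []) z = e1 at *
  generalize ev (PPL.getD 2 []) z = e2 at *
  generalize ev2 (PPL.drop 3) h z = e3 at *
  have m1 := mul_le_mul_of_nonneg_left k1 h0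
  have m2 := mul_le_mul_of_nonneg_left k2 (pow_nonneg h0 2)
  have m3 := mul_le_mul_of_nonneg_left k3 (pow_nonneg h0 3)
  have e : e0 + h*(e1+h*(e2+h*e3)) = e0 + h*e1 + h^2*e2 + h^3*e3 := by ring
  rw [e]
  have t := abs_add_le (e0 + h*e1 + h^2*e2) (h^3*e3)
  have t2 := abs_add_le (e0 + h*e1) (h^2*e2)
  have t3 := abs_add_le e0 (h*e1)
  rw [abs_mul, abs_of_nonneg (pow_nonneg h0 3)] at t
  rw [abs_mul, abs_of_nonneg (pow_nonneg h0 2)] at t2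
  rw [abs_mul, abs_of_nonneg h0] at t3
  have hh2 : h^2 ≤ 1 := by nlinarith
  have h3 := pow_nonneg h0 3
  norm_num at k0 m1 m2 m3 h1 h2 ⊢
  nlinarith
end QP
namespace QP
open Real Set MeasureTheory

noncomputable def vs (n : ℕ) : ℝ := v0q + v1q/n + v2q/n^2

lemma v0_pi : |(v0q:ℝ)*xq - π/2| ≤ 1/10^18 := by
  have h1 := Real.pi_gt_d20
  have h2 := Real.pi_lt_d20
  have e : (v0q:ℝ)*xq = ((v0q*xq:ℚ):ℝ) := by push_cast; ring
  have k1 : v0q*xq ≤ 157079632679489661923/10^20 + 5/10^19 := by decide +kernel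
  have k2 : 157079632679489661923/10^20 - 5/10^19 ≤ v0q*xq := by decide +kernel
  have r1 := (Rat.cast_le (K := ℝ)).2 k1
  have r2 := (Rat.cast_le (K := ℝ)).2 k2
  rw [e]
  generalize v0q*xq = y at *
  push_cast at r1 r2
  norm_num at r1 r2 h1 h2
  rw [abs_le]; norm_num; constructor <;> linarith

lemma gL_bd {h z : ℝ} (h0 : 0 ≤ h) (h1 : h ≤ 1/1003) (hz : |z| ≤ 0.3) : |ev2 gL h z| ≤ 0.276 := by
  have hz' : |z| ≤ ((3/10:ℚ):ℝ) := by norm_num at hz ⊢; exact hz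
  have hh' : |h| ≤ ((1/1003:ℚ):ℝ) := by rw [abs_of_nonneg h0]; push_cast; exact h1
  refine (ev2_abs _ hh' hz').trans ?_
  have : pb2 gL (1/1003) (3/10) ≤ 0.276 := by decide +kernel
  have := (Rat.cast_le (K := ℝ)).2 this
  push_cast at this; norm_num at this ⊢; exact this

lemma tL_eq (h z : ℝ) : ev2 tL h z = v0q*z + (h*v1q + h^2*v2q)*(xq+z) := by
  simp only [tL, ev2, ev]; push_cast; ring

lemma tL_bd {h z : ℝ} (h0 : 0 ≤ h) (h1 : h ≤ 1/1003) (hz : |z| ≤ 0.3) : |ev2 tL h z| ≤ 0.632*|z| + 1.2*h := by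
  rw [tL_eq]
  have hx := xz_mem hz
  have a0 : |(v0q:ℝ)| ≤ 0.632 := by rw [abs_le]; norm_num [v0q]
  have a1 : (0:ℝ) ≤ v1q ∧ (v1q:ℝ) ≤ 0.4278 := by norm_num [v1q]
  have a2 : (0:ℝ) ≤ v2q ∧ (v2q:ℝ) ≤ 0.2 := by norm_num [v2q]
  have b1 : 0 ≤ h*v1q + h^2*v2q ∧ h*v1q + h^2*v2q ≤ 0.43*h := by
    obtain ⟨p1, p2⟩ := a1
    obtain ⟨q1, q2⟩ := a2
    refine ⟨by positivity, ?_⟩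
    have m1 := mul_le_mul_of_nonneg_left p2 h0
    have m2 := mul_le_mul_of_nonneg_left q2 (sq_nonneg h)
    nlinarith
  refine (abs_add_le _ _).trans (add_le_add ?_ ?_)
  · rw [abs_mul]; gcongr
  · rw [abs_mul, abs_of_nonneg b1.1, abs_of_pos (by linarith [hx.1])]
    nlinarith [hx.1, hx.2, b1.1, b1.2]

lemma cos_pt (n : ℕ) (hn : 1003 ≤ n) {z : ℝ} (hz : |z| ≤ 0.3) :
    |Real.cos (vs n * (xq+z)) - ev2 cL (1/n) z| ≤ 1/10^18 + 0.001*z^6 + 0.01*(1/n)^6 := by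
  have hnR : (1003:ℝ) ≤ n := by exact_mod_cast hn
  set h : ℝ := 1/n with hh
  have h0 : 0 ≤ h := by positivity
  have h1 : h ≤ 1/1003 := by rw [hh]; gcongr
  set t := ev2 tL h z with ht
  have ev1 : vs n = v0q + v1q*h + v2q*h^2 := by rw [vs, hh]; ring
  have e1 : vs n * (xq+z) = (t + (v0q*xq-π/2)) + π/2 := by rw [ht, tL_eq, ev1]; ring
  have e2 : Real.cos (vs n * (xq+z)) = -Real.sin (t + (v0q*xq-π/2)) := by rw [e1, Real.cos_add_pi_div_two]
  have e3 : ev2 cL h z = -(t - t^3/6 + t^5/120) := by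
    simp only [cL, tL3, tL5, ev2_add, ev2_sm, ev2_mul, ev, ← ht]; push_cast; ring
  have s := sin_abs 2 t
  have e4 : ev (sinL 2) t = t - t^3/6 + t^5/120 := by
    have : sinL 2 = [0, 1, 0, -1/6, 0, 1/120] := by decide +kernel
    rw [this]; simp only [ev]; push_cast; ring
  rw [e4] at s
  have d : |Real.sin (t + (v0q*xq-π/2)) - Real.sin t| ≤ 1/10^18 := by
    refine (Real.abs_sin_sub_sin_le _ _).trans ?_
    rw [add_sub_cancel_left]; exact v0_pi
  have tb := tL_bd h0 h1 hz
  rw [← ht] at tb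
  have t7 : |t|^7/5040 ≤ 0.001*z^6 + 0.01*h^6 := by
    have u1 : |t| ≤ 0.2 := by linarith
    have u2 : |t|^6 ≤ (0.632*|z| + 1.2*h)^6 := by gcongr
    have u3 := add_pow_le (show 0 ≤ 0.632*|z| by positivity) (show 0 ≤ 1.2*h by positivity) 6
    rw [mul_pow, mul_pow, (show Even 6 by decide).pow_abs] at u3
    have u4 : |t|^7 ≤ |t|^6*0.2 := by rw [pow_succ]; gcongr
    have hz6 : 0 ≤ z^6 := by positivity
    have hh6 : 0 ≤ h^6 := by positivity
    norm_num at u2 u3 u4 ⊢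
    linarith
  have : (2*2+3).factorial = 5040 := by decide
  rw [this] at s
  norm_num at s
  rw [e2, e3]
  rw [show -Real.sin (t + (v0q*xq-π/2)) - -(t - t^3/6 + t^5/120) = -((Real.sin (t + (v0q*xq-π/2)) - Real.sin t) + (Real.sin t - (t - t^3/6 + t^5/120))) by ring, abs_neg]
  refine (abs_add_le _ _).trans ?_
  linarith

lemma stein_pt (n : ℕ) (hn : 1003 ≤ n) (hn2 : n ≤ 75000) {z : ℝ} (hz : |z| ≤ 0.3) :
    |Real.cos (vs n * (xq+z)) - (1/n*(2*(xq+z)*ev2 gL (1/n) z + (xq+z)^2*ev2 (gL.map pder) (1/n) z) + 1/n*((xq+z)^2*ev2 gL (1/n) z)*ell n 1 (xq+z))|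
      ≤ 124*(1/n)^3+5.9*(1/n)^2*z^2+12.6*(1/n)*z^4+4.9*z^6 := by
  have hnR : (1003:ℝ) ≤ n := by exact_mod_cast hn
  have hnR2 : (n:ℝ) ≤ 75000 := by exact_mod_cast hn2
  have hem := em_core n 1 hn le_rfl hz
  have hcos := cos_pt n hn hz
  have hp := xq_lt_pi hz
  have hx := xz_mem hz
  have hc := cc_core hz
  have hc1 := c1_eq hp.1 hp.2
  have hP := Psi_taylor hz
  have hC := cc_taylor hz
  have e146 : (146:ℝ)/(n:ℝ)^2 = 146*(1/n)^2 := by ring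
  rw [e146] at hem
  rw [show (n:ℝ)*Psi (xq+z)/(xq+z) = Psi (xq+z)/(xq+z)/(1/n) by field_simp, show ((xq:ℝ)+z)*c1 (xq+z)/(12*n) = (xq+z)*c1 (xq+z)/12*(1/n) by ring] at hem
  have h0p : (0:ℝ) < 1/n := by positivity
  have h1 : (1:ℝ)/n ≤ 1/1003 := by gcongr
  have h2 : 1 ≤ 75000^3*((1:ℝ)/n)^3 := by
    have : 1 ≤ 75000*((1:ℝ)/n) := by rw [mul_one_div, le_div_iff₀ (by positivity)]; linarith
    rw [← mul_pow]; exact one_le_pow₀ this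
  generalize (1:ℝ)/n = h at *
  have h0 := h0p.le
  have hPP := PP_bound h0 h1 h2 hz
  have hg := gL_bd h0 h1 hz
  have hT : |ev T4 z| ≤ 10 := by
    refine (ev_abs T4 (r := 3/10) (by norm_num at hz ⊢; exact hz)).trans ?_
    have : pb T4 (3/10) ≤ 10 := by decide +kernel
    exact_mod_cast this
  have eT : ev2 PPL h z = ev2 cL h z - (h*((xq+z)^2*ev2 (gL.map pder) h z) + ev T5 z*ev2 gL h z + h*((1/2*((xq+z)*(5+ev T4 z)))*ev2 gL h z + h*((1/12*((xq+z)*(ev T4 z - ((xq+z)^2+ev T4 z^2))))*ev2 gL h z))) := by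
    simp only [PPL, TgL, bL, dL, ev2_add, ev2_sm, ev2, ev_mul, ev_smul, ev_add, ev]; push_cast; ring
  generalize hgg : ev2 gL h z = g at *
  generalize ev2 (gL.map pder) h z = g' at *
  generalize hvv : Real.cos (vs n * (xq+z)) = CO at *
  generalize ev2 cL h z = cl at *
  generalize ev2 PPL h z = pp at *
  generalize ev T4 z = t4 at *
  generalize ev T5 z = t5 at *
  generalize cc (xq+z) = c at *
  generalize c1 (xq+z) = d1 at *
  generalize ell n 1 (xq+z) = l at *
  generalize Psi (xq+z) = ps at *
  generalize hxe : (xq:ℝ)+z = x at *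
  obtain ⟨R, hR⟩ : ∃ R, R = x*l - (ps/x/h + (c-1)/2 + ((1:ℕ):ℝ) + x*d1/12*h) := ⟨_, rfl⟩
  rw [← hR] at hem
  have hl : x*l = R + (ps/x/h + (c-1)/2 + ((1:ℕ):ℝ) + x*d1/12*h) := by rw [hR]; ring
  have hxp : 0 < x := by linarith [hx.1]
  have key : CO - (h*(2*x*g + x^2*g') + h*(x^2*g)*l) = (CO - cl) + pp - g*((ps-t5) + h*x/2*(c-t4) + h^2*(x/12)*((c-t4)*(1-c-t4)) + h*x*R) := by
    have e1 : h*(x^2*g)*l = h*x*g*(x*l) := by ring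
    rw [e1, hl, eT]
    have e2 : h*x*g*(R + (ps/x/h + (c-1)/2 + ((1:ℕ):ℝ) + x*d1/12*h)) = h*x*g*R + g*ps + h*x*g*((c+1)/2) + h^2*x*g/12*(x*d1) := by
      push_cast; field_simp; ring
    rw [e2, hc1]; ring
  rw [key]
  have z5 : |z|^5 ≤ 0.3*z^4 := by
    rw [pow_succ, (show Even 4 by decide).pow_abs, mul_comm]; gcongr
  have z52 : |z|^5 ≤ 0.027*z^2 := by
    have := small_pow hz 3
    rw [show |z|^5 = |z|^3*|z|^2 by ring, sq_abs]
    have := mul_le_mul_of_nonneg_right this (sq_nonneg z)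
    norm_num at this ⊢; linarith
  have z6 : |z|^6 = z^6 := (show Even 6 by decide).pow_abs _
  rw [z6] at hP
  have hx2 : x ≤ 2.79 := hx.2.le
  have q1 : |h*x/2*(c-t4)| ≤ h*2.79/2*(77*|z|^5+1/10^15) := by
    rw [abs_mul, abs_of_nonneg (by positivity : 0 ≤ h*x/2)]; gcongr
  have q2 : |h^2*(x/12)*((c-t4)*(1-c-t4))| ≤ h^2*(2.79/12)*((77*|z|^5+1/10^15)*18.6) := by
    rw [abs_mul, abs_of_nonneg (by positivity : 0 ≤ h^2*(x/12)), abs_mul]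
    have : |1-c-t4| ≤ 18.6 := by
      rw [abs_le] at hT ⊢; constructor <;> linarith [hc.1, hc.2, hT.1, hT.2]
    gcongr
  have q3 : |h*x*R| ≤ h*2.79*(146*h^2) := by
    rw [abs_mul, abs_of_nonneg (by positivity : 0 ≤ h*x)]; gcongr
  have a1 := abs_add_le ((ps-t5) + h*x/2*(c-t4) + h^2*(x/12)*((c-t4)*(1-c-t4))) (h*x*R)
  have a2 := abs_add_le ((ps-t5) + h*x/2*(c-t4)) (h^2*(x/12)*((c-t4)*(1-c-t4)))
  have a3 := abs_add_le (ps-t5) (h*x/2*(c-t4))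
  set S := (ps-t5) + h*x/2*(c-t4) + h^2*(x/12)*((c-t4)*(1-c-t4)) + h*x*R with hS
  have hSb : |S| ≤ (77*z^6/6+2/10^14) + h*2.79/2*(77*|z|^5+1/10^15) + h^2*(2.79/12)*((77*|z|^5+1/10^15)*18.6) + h*2.79*(146*h^2) := by linarith
  have hgS : |g*S| ≤ 0.276*|S| := by rw [abs_mul]; gcongr
  have b1 := abs_sub ((CO-cl)+pp) (g*S)
  have b2 := abs_add_le (CO-cl) pp
  have hh2 : h^2 ≤ 1/1003*h := by rw [sq]; gcongr
  have hh6 : h^6 ≤ 1*h^3 := by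
    rw [show h^6 = h^3*h^3 by ring]; gcongr; exact pow_le_one₀ h0 (by linarith)
  have m1 := mul_le_mul_of_nonneg_left z5 h0
  have m2 := mul_le_mul_of_nonneg_left z52 (sq_nonneg h)
  clear hem hc1 hR hl key eT q1 q2 q3 a1 a2 a3
  have hz6 : 0 ≤ z^6 := by positivity
  have hz2 : 0 ≤ h^2*z^2 := by positivity
  have hz4 : 0 ≤ h*z^4 := by positivity
  norm_num at hcos hPP hSb hgS b1 b2 m1 m2 h1 h2 hh2 hh6 ⊢
  linarith
end QP
namespace QP
open Real Set MeasureTheory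

noncomputable def fS (n : ℕ) (x : ℝ) : ℝ := 1/n*(x^2*ev2 gL (1/n) (x-xq))
noncomputable def fS' (n : ℕ) (x : ℝ) : ℝ := 1/n*(2*x*ev2 gL (1/n) (x-xq) + x^2*ev2 (gL.map pder) (1/n) (x-xq))

lemma ev2_cont (P : List (List ℚ)) (h : ℝ) : Continuous (ev2 P h) :=
  continuous_iff_continuousAt.2 fun z => (pder2_deriv P h z).continuousAt

lemma fS_deriv (n : ℕ) (x : ℝ) : HasDerivAt (fS n) (fS' n x) x := by
  have h1 : HasDerivAt (fun x : ℝ => ev2 gL (1/n) (x-xq)) (ev2 (gL.map pder) (1/n) (x-xq)) x :=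
    HasDerivAt.comp_sub_const x (xq:ℝ) (pder2_deriv gL (1/n) (x-xq))
  have h2 := (((hasDerivAt_id x).pow 2).mul h1).const_mul (1/(n:ℝ))
  refine h2.congr_deriv ?_
  simp [fS']

lemma fS_bd (n : ℕ) (hn : 1003 ≤ n) {x : ℝ} (hz : |x-xq| ≤ 0.3) : |fS n x| ≤ 2.16/n := by
  have hnR : (1003:ℝ) ≤ n := by exact_mod_cast hn
  have hx := xz_mem hz
  rw [add_sub_cancel] at hx
  have hg := gL_bd (h := 1/n) (by positivity) (by gcongr) hz
  unfold fS
  rw [abs_mul, abs_mul, abs_of_nonneg (by positivity : (0:ℝ) ≤ 1/n), abs_of_nonneg (sq_nonneg x)]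
  have : x^2 ≤ 2.79^2 := by have := hx.1; have := hx.2; gcongr
  calc _ ≤ 1/(n:ℝ)*(2.79^2*0.276) := by gcongr
    _ ≤ 1/(n:ℝ)*2.16 := by gcongr; norm_num
    _ = _ := by ring

lemma stein_int (n : ℕ) (hn : 1003 ≤ n) (hn2 : n ≤ 75000) :
    |∫ x in (0:ℝ)..π, Real.cos (vs n * x) * w n 1 x| ≤ 1680/n^3 * Zw n 1 := by
  have hnR : (1003:ℝ) ≤ n := by exact_mod_cast hn
  obtain ⟨l1, l2, l3⟩ := core_lim
  have hwc := w_cont n 1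
  have hdc := dw_cont n 1
  have hg1 := ev2_cont gL (1/n)
  have hg2 := ev2_cont (gL.map pder) (1/n)
  have hfc' : Continuous (fS' n) := by unfold fS'; fun_prop
  have hfc : Continuous (fS n) := by unfold fS; fun_prop
  have hZ := Zw_nonneg n 1 (by omega)
  have tail := tail_le n 1 hn hn2 le_rfl (fun x => Real.cos (vs n * x)) (by fun_prop) (fun x _ => Real.abs_cos_le_one _)
  have ibp := w_ibp n 1 (fS n) (fS' n) (fS_deriv n) hfc' (xq-0.3) (xq+0.3)
  have hb := bdry_le n 1 hn hn2 le_rfl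
  have wb1 := w_nonneg n 1 (by omega) (show (0:ℝ) ≤ xq+0.3 by linarith) l2.le
  have wb2 := w_nonneg n 1 (by omega) l1.le (show (xq:ℝ)-0.3 ≤ π by linarith)
  have f1 := fS_bd n hn (x := xq+0.3) (by rw [add_sub_cancel_left, abs_of_nonneg] <;> norm_num)
  have f2 := fS_bd n hn (x := xq-0.3) (by rw [show (xq:ℝ)-0.3-xq = -0.3 by ring, abs_neg, abs_of_nonneg] <;> norm_num)
  have bd : |∫ x in ((xq:ℝ)-0.3)..(xq+0.3), (fS' n x * w n 1 x + fS n x * deriv (w n 1) x)| ≤ 12/n^3*Zw n 1 := by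
    rw [ibp]
    have t := abs_sub (fS n (xq+0.3) * w n 1 (xq+0.3)) (fS n (xq-0.3) * w n 1 (xq-0.3))
    rw [abs_mul, abs_mul, abs_of_nonneg wb1, abs_of_nonneg wb2] at t
    calc _ ≤ 2.16/(n:ℝ)*w n 1 (xq+0.3) + 2.16/(n:ℝ)*w n 1 (xq-0.3) := t.trans (by gcongr)
      _ = 2.16/(n:ℝ)*(w n 1 (xq+0.3) + w n 1 (xq-0.3)) := by ring
      _ ≤ 2.16/1003*(5320/n^3*Zw n 1) := by gcongr
      _ = (2.16/1003*5320)*(1/n^3*Zw n 1) := by ring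
      _ ≤ 12*(1/n^3*Zw n 1) := by gcongr; norm_num
      _ = _ := by ring
  have cm : ∀ k, IntervalIntegrable (fun x => (x-(xq:ℝ))^k * w n 1 x) volume (xq-0.3) (xq+0.3) := fun k => Continuous.intervalIntegrable (by fun_prop) _ _
  have main : |(∫ x in ((xq:ℝ)-0.3)..(xq+0.3), Real.cos (vs n * x) * w n 1 x) - ∫ x in ((xq:ℝ)-0.3)..(xq+0.3), (fS' n x * w n 1 x + fS n x * deriv (w n 1) x)| ≤ 1600/n^3*Zw n 1 := by
    rw [← intervalIntegral.integral_sub (Continuous.intervalIntegrable (by fun_prop) _ _) (Continuous.intervalIntegrable (by fun_prop) _ _)]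
    refine (intervalIntegral.abs_integral_le_integral_abs l3.le).trans ?_
    have h2 : ∫ x in ((xq:ℝ)-0.3)..(xq+0.3), |Real.cos (vs n * x) * w n 1 x - (fS' n x * w n 1 x + fS n x * deriv (w n 1) x)| ≤
      ∫ x in ((xq:ℝ)-0.3)..(xq+0.3), ((124*(1/(n:ℝ))^3)*((x-xq)^0*w n 1 x)+(5.9*(1/(n:ℝ))^2)*((x-xq)^2*w n 1 x)+(12.6*(1/(n:ℝ)))*((x-xq)^4*w n 1 x)+4.9*((x-xq)^6*w n 1 x)) := by
      refine intervalIntegral.integral_mono_on_of_le_Ioo l3.le (Continuous.intervalIntegrable (by fun_prop) _ _) (Continuous.intervalIntegrable (by fun_prop) _ _) fun x hx => ?_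
      have x0 : 0 < x := by linarith [hx.1]
      have x1 : x < π := by linarith [hx.2]
      rw [dw_eq n 1 (by omega) x0 x1]
      have hw := (w_pos n 1 (by omega) x0 x1).le
      have hz : |x-xq| ≤ 0.3 := by rw [abs_le]; constructor <;> linarith [hx.1, hx.2]
      have hs := stein_pt n hn hn2 hz
      rw [add_sub_cancel] at hs
      have e : Real.cos (vs n * x) * w n 1 x - (fS' n x * w n 1 x + fS n x * (ell n 1 x * w n 1 x)) =
        (Real.cos (vs n * x) - (1/n*(2*x*ev2 gL (1/n) (x-xq) + x^2*ev2 (gL.map pder) (1/n) (x-xq)) + 1/n*(x^2*ev2 gL (1/n) (x-xq))*ell n 1 x)) * w n 1 x := by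
        unfold fS fS'; ring
      rw [e, abs_mul, abs_of_nonneg hw]
      refine (mul_le_mul_of_nonneg_right hs hw).trans (le_of_eq (by ring))
    refine h2.trans ?_
    rw [intervalIntegral.integral_add (((cm 0).const_mul _).add ((cm 2).const_mul _) |>.add ((cm 4).const_mul _)) ((cm 6).const_mul _),
      intervalIntegral.integral_add (((cm 0).const_mul _).add ((cm 2).const_mul _)) ((cm 4).const_mul _),
      intervalIntegral.integral_add ((cm 0).const_mul _) ((cm 2).const_mul _),
      intervalIntegral.integral_const_mul, intervalIntegral.integral_const_mul, intervalIntegral.integral_const_mul, intervalIntegral.integral_const_mul]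
    have m0 := core_mom n 1 hn 0
    have m2 := (core_mom n 1 hn 1).trans (mom2_le n 1 hn hn2 le_rfl)
    have m4 := (core_mom n 1 hn 2).trans (mom4_le n 1 hn hn2 le_rfl)
    have m6 := (core_mom n 1 hn 3).trans (mom6_le n 1 hn hn2 le_rfl)
    rw [mul_zero, mom_zero] at m0
    change ∫ x in ((xq:ℝ)-0.3)..(xq+0.3), (x-(xq:ℝ))^2 * w n 1 x ≤ _ at m2
    change ∫ x in ((xq:ℝ)-0.3)..(xq+0.3), (x-(xq:ℝ))^4 * w n 1 x ≤ _ at m4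
    change ∫ x in ((xq:ℝ)-0.3)..(xq+0.3), (x-(xq:ℝ))^6 * w n 1 x ≤ _ at m6
    calc _ ≤ (124*(1/(n:ℝ))^3)*Zw n 1 + (5.9*(1/(n:ℝ))^2)*(2.5544/n*Zw n 1) + (12.6*(1/(n:ℝ)))*(19.2/n^2*Zw n 1) + 4.9*(239.5/n^3*Zw n 1) := by
          gcongr
      _ = (124+5.9*2.5544+12.6*19.2+4.9*239.5)*(1/n^3*Zw n 1) := by ring
      _ ≤ 1600*(1/n^3*Zw n 1) := by gcongr; norm_num
      _ = _ := by ring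
  have hp : 0 ≤ 1/(n:ℝ)^3*Zw n 1 := by positivity
  rw [abs_le] at *
  have r1 : ∀ c : ℝ, c/(n:ℝ)^3*Zw n 1 = c*(1/(n:ℝ)^3*Zw n 1) := fun c => by ring
  rw [r1] at *
  rw [r1] at tail main
  norm_num only at tail main bd ⊢
  constructor <;> linarith [tail.1, tail.2, main.1, main.2, bd.1, bd.2]
end QP
namespace QP
open Real Set MeasureTheory

lemma Psi_core {z : ℝ} (hz : |z| ≤ 0.3) : |Psi (xq+z)| ≤ 0.66*(xq+z)^2*|z| + 2/10^14 := by
  have h := Psi_taylor hz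
  have e : ev T5 z = z*(-323018537064249186595/10^20 + z*(-798284286444960234431/10^20/2 + z*(-1137371447837267567836/10^20/3+z*(-1700793699303760058272/10^20/4+z*(-2589307396254638529062/10^20/5))))) := by
    simp only [T5, T4, pintAux, ev]; push_cast; ring
  have hxq := xq_val
  have e6 : |z|^6 = |z| * |z|^5 := by ring
  have hb : |ev T5 z| + 77*|z|^6/6 ≤ 0.66*(xq+z)^2*|z| := by
    rw [e, abs_mul, e6]
    have : |-323018537064249186595/10^20 + z*(-798284286444960234431/10^20/2 + z*(-1137371447837267567836/10^20/3+z*(-1700793699303760058272/10^20/4+z*(-2589307396254638529062/10^20/5))))| + 77*|z|^5/6 ≤ 0.66*(xq+z)^2 := by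
      rw [hxq]
      rcases le_total 0 z with hs | hs
      · rw [abs_of_nonneg hs] at hz ⊢
        have p2 : z^2 ≤ 0.3*z := by nlinarith
        have p3 : z^3 ≤ 0.09*z := by nlinarith
        have p4 : z^4 ≤ 0.027*z := by nlinarith [pow_nonneg hs 3]
        have p5 : z^5 ≤ 0.0081*z := by nlinarith [pow_nonneg hs 4]
        have q2 := pow_nonneg hs 2
        have q3 := pow_nonneg hs 3
        have q4 := pow_nonneg hs 4
        rw [abs_of_nonpos (by norm_num; nlinarith)]
        norm_num
        nlinarith
      · rw [abs_of_nonpos hs] at hz ⊢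
        obtain ⟨u, rfl⟩ : ∃ u, z = -u := ⟨-z, by ring⟩
        rw [neg_neg] at *
        replace hs : 0 ≤ u := by linarith
        have p2 : u^2 ≤ 0.3*u := by nlinarith
        have p3 : u^3 ≤ 0.09*u := by nlinarith
        have p4 : u^4 ≤ 0.027*u := by nlinarith [pow_nonneg hs 3]
        have p5 : u^5 ≤ 0.0081*u := by nlinarith [pow_nonneg hs 4]
        have q2 := pow_nonneg hs 2
        have q3 := pow_nonneg hs 3
        have q4 := pow_nonneg hs 4
        rw [abs_of_nonpos (by norm_num; nlinarith)]
        norm_num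
        nlinarith
    have := mul_le_mul_of_nonneg_left this (abs_nonneg z)
    linarith
  have t := abs_sub_abs_le_abs_sub (Psi (xq+z)) (ev T5 z)
  linarith

lemma ell_core (n κ : ℕ) (hn : 1003 ≤ n) (hn2 : n ≤ 75000) (hκ : κ ≤ 1) {z : ℝ} (hz : |z| ≤ 0.3) : |ell n κ (xq+z)| ≤ 0.66*n*|z| + 2.1 := by
  have hnR : (1003:ℝ) ≤ n := by exact_mod_cast hn
  have hnR2 : (n:ℝ) ≤ 75000 := by exact_mod_cast hn2
  have hem := em_core n κ hn hκ hz
  have hp := xq_lt_pi hz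
  have hx := xz_mem hz
  have hc := cc_core hz
  have hc1 := c1_eq hp.1 hp.2
  have hP := Psi_core hz
  have hκ0 : (0:ℝ) ≤ κ := Nat.cast_nonneg κ
  have hκ1 : (κ:ℝ) ≤ 1 := by exact_mod_cast hκ
  rw [mul_comm] at hc1
  generalize cc (xq+z) = c at *
  generalize c1 (xq+z) = d1 at *
  generalize ell n κ (xq+z) = l at *
  generalize Psi (xq+z) = ps at *
  generalize hxe : (xq:ℝ)+z = x at *
  have hxp : 0 < x := hp.1
  have b1 : |n*ps/x| ≤ x*(0.66*n*|z|) + 0.01 := by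
    rw [abs_div, abs_mul, Nat.abs_cast, abs_of_pos hxp, div_le_iff₀ hxp]
    have := mul_le_mul_of_nonneg_left hP (show (0:ℝ) ≤ n by positivity)
    norm_num at this ⊢
    nlinarith [hx.1]
  have b2 : |x*d1/(12*n)| ≤ 0.01 := by
    rw [abs_div, abs_of_pos (show (0:ℝ) < 12*n by positivity), div_le_iff₀ (by positivity), mul_comm x, hc1, abs_le]
    have : c^2 ≤ 7.6^2 := by nlinarith
    have : x^2 ≤ 2.79^2 := by nlinarith
    constructor <;> nlinarith
  have b3 : 146/(n:ℝ)^2 ≤ 0.01 := by rw [div_le_iff₀ (by positivity)]; nlinarith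
  have b4 : |x*l| ≤ x*(0.66*n*|z|) + 4.35 := by
    rw [abs_le] at *
    obtain ⟨_, _⟩ := b1
    obtain ⟨_, _⟩ := b2
    obtain ⟨_, _⟩ := hem
    obtain ⟨_, _⟩ := hc
    constructor <;> linarith
  rw [abs_mul, abs_of_pos hxp] at b4
  have : x*|l| ≤ x*(0.66*n*|z| + 2.1) := by nlinarith [hx.1]
  exact le_of_mul_le_mul_left this hxp

noncomputable def Phi (x : ℝ) : ℝ := x*Real.log (2*Real.sin x) - Psi x

lemma hasDerivAt_Phi {x : ℝ} (h0 : 0 < x) (h1 : x < π) : HasDerivAt Phi (Real.log (2*Real.sin x)) x := by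
  have hs := sin_pos' h0 h1
  have h2 := ((hasDerivAt_id x).mul (((Real.hasDerivAt_sin x).const_mul 2).log (by positivity))).sub (hasDerivAt_Psi h0 h1)
  refine h2.congr_deriv ?_
  rw [cc_eq h0.ne']
  simp only [id]
  field_simp
  ring

lemma Phi_mid {m δ : ℝ} (hδ : 0 ≤ δ) (h0 : 0 < m - δ) (h1 : m + δ < π) : Phi (m+δ) - Phi (m-δ) ≤ 2*δ*Real.log (2*Real.sin m) := by
  have hd : ∀ t ∈ Icc 0 δ, HasDerivAt (fun t => Phi (m+t) - Phi (m-t) - 2*t*Real.log (2*Real.sin m)) (Real.log (2*Real.sin (m+t)) + Real.log (2*Real.sin (m-t)) - 2*Real.log (2*Real.sin m)) t := by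
    intro t ht
    have a1 : HasDerivAt (fun t => Phi (m+t)) (Real.log (2*Real.sin (m+t))) t := by
      exact HasDerivAt.comp_const_add m t (hasDerivAt_Phi (by linarith [ht.1]) (by linarith [ht.2]))
    have a2 : HasDerivAt (fun t => Phi (m-t)) (-Real.log (2*Real.sin (m-t))) t := by
      exact HasDerivAt.comp_const_sub m t (hasDerivAt_Phi (by linarith [ht.2]) (by linarith [ht.1]))
    have a3 : HasDerivAt (fun t => 2*t*Real.log (2*Real.sin m)) (2*1*Real.log (2*Real.sin m)) t := ((hasDerivAt_id t).const_mul 2).mul_const _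
    refine ((a1.sub a2).sub a3).congr_deriv (by ring)
  have anti : AntitoneOn (fun t => Phi (m+t) - Phi (m-t) - 2*t*Real.log (2*Real.sin m)) (Icc 0 δ) := by
    apply antitoneOn_of_deriv_nonpos (convex_Icc 0 δ)
    · exact fun t ht => (hd t ht).continuousAt.continuousWithinAt
    · intro t ht
      rw [interior_Icc] at ht
      exact (hd t ⟨ht.1.le, ht.2.le⟩).differentiableAt.differentiableWithinAt
    · intro t ht
      rw [interior_Icc] at ht
      rw [(hd t ⟨ht.1.le, ht.2.le⟩).deriv]
      have s1 := sin_pos' (show 0 < m+t by linarith [ht.1]) (by linarith [ht.2])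
      have s2 := sin_pos' (show 0 < m-t by linarith [ht.2]) (by linarith [ht.1])
      have s3 := sin_pos' (show 0 < m by linarith) (by linarith)
      rw [← Real.log_mul (by positivity) (by positivity)]
      have : 2*Real.log (2*Real.sin m) = Real.log ((2*Real.sin m)^2) := by rw [Real.log_pow]; norm_num
      rw [this, sub_nonpos]
      apply Real.log_le_log (by positivity)
      rw [Real.sin_add, Real.sin_sub]
      have e1 := Real.sin_sq_add_cos_sq m
      have e2 := Real.sin_sq_add_cos_sq t
      have c1 : Real.cos m^2 = 1 - Real.sin m^2 := by linarith
      have c2 : Real.cos t^2 = 1 - Real.sin t^2 := by linarith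
      have : 2*(Real.sin m * Real.cos t + Real.cos m * Real.sin t)*(2*(Real.sin m*Real.cos t - Real.cos m*Real.sin t)) = 4*(Real.sin m^2*Real.cos t^2 - Real.cos m^2*Real.sin t^2) := by ring
      rw [this, c1, c2]
      nlinarith [sq_nonneg (Real.sin t)]
  have := anti (show (0:ℝ) ∈ Icc 0 δ from ⟨le_rfl, hδ⟩) (show δ ∈ Icc 0 δ from ⟨hδ, le_rfl⟩) hδ
  simp only [add_zero, sub_zero, mul_zero, zero_mul, sub_self] at this
  linarith

lemma W_low (n : ℕ) (hn : 1003 ≤ n) : Real.exp (0.1986*n) ≤ W n xq := by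
  have hnR : (1003:ℝ) ≤ n := by exact_mod_cast hn
  have hn0 : (n:ℝ) ≠ 0 := by positivity
  have hxq : (2.4857:ℝ) ≤ xq ∧ (xq:ℝ) ≤ 2.4858 := by rw [xq_val]; norm_num
  have hpi := Real.pi_gt_d2
  have hq := xq_lt_pi (z := 0) (by norm_num)
  rw [add_zero] at hq
  set η : ℝ := xq/n with hη
  have hη0 : 0 < η := by rw [hη]; exact div_pos hq.1 (by positivity)
  have hη1 : η ≤ 0.0025 := by rw [hη, div_le_iff₀ (by positivity)]; linarith
  have hnη : n*η = xq := by rw [hη]; field_simp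
  have hW : Real.log (W n xq) = ∑ k ∈ Finset.Icc 1 n, Real.log (2*Real.sin (k*η)) := by
    unfold W
    rw [Real.log_prod]
    · refine Finset.sum_congr rfl fun k _ => ?_
      rw [hη, mul_div_assoc]
    · intro k hk
      have := arg_mem hk hq.1 hq.2
      have := sin_pos' this.1 this.2
      rw [mul_div_assoc]; positivity
  have hWp : 0 < W n xq := by
    have := w_pos n 0 (by omega) hq.1 hq.2
    simpa [w] using this
  have hsum : ∀ m : ℕ, m ≤ n → Phi ((m+1/2)*η) - Phi (η/2) ≤ ∑ k ∈ Finset.Icc 1 m, η*Real.log (2*Real.sin (k*η)) := by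
    intro m
    induction m with
    | zero => intro _; simp; rw [show 2⁻¹*η = η/2 by ring]
    | succ m ih =>
      intro hm
      rw [Finset.sum_Icc_succ_top (by omega)]
      have hmR : ((m:ℝ)+1) ≤ n := by exact_mod_cast hm
      have h2 : ((m:ℝ)+1)*η ≤ xq := by rw [← hnη]; gcongr
      have h3 : 0 ≤ (m:ℝ)*η := by positivity
      have := Phi_mid (m := ((m:ℝ)+1)*η) (δ := η/2) (by linarith) (by linarith) (by linarith)
      have e1 : ((m:ℝ)+1)*η+η/2 = (((m+1:ℕ):ℝ)+1/2)*η := by push_cast; ring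
      have e2 : ((m:ℝ)+1)*η-η/2 = ((m:ℝ)+1/2)*η := by ring
      rw [e1, e2] at this
      have := ih (by omega)
      push_cast at *
      linarith
  have h := hsum n le_rfl
  rw [← Finset.mul_sum, ← hW, add_mul, hnη, one_div_mul_eq_div] at h
  have p1 : Phi (η/2) ≤ 0 := by
    have := Psi_small (s := η/2) (by linarith) (by linarith)
    have hP : 0 ≤ Psi (η/2) := le_trans (mul_nonneg (by linarith) (by nlinarith)) this.1
    have hl : Real.log (2*Real.sin (η/2)) ≤ 0 := by
      have s := sin_pos' (show 0 < η/2 by linarith) (by linarith)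
      have s2 := Real.sin_le (show 0 ≤ η/2 by linarith)
      exact Real.log_nonpos (by positivity) (by linarith)
    unfold Phi; nlinarith
  have p2 : Phi xq ≤ Phi (xq+η/2) := by
    have hb : ∀ x ∈ Icc (xq:ℝ) (xq+η/2), 0 < x ∧ x < π := fun x hx => ⟨by linarith [hx.1], by linarith [hx.2]⟩
    have mono : MonotoneOn Phi (Icc xq (xq+η/2)) := by
      apply monotoneOn_of_deriv_nonneg (convex_Icc _ _)
      · exact fun x hx => (hasDerivAt_Phi (hb x hx).1 (hb x hx).2).continuousAt.continuousWithinAt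
      · intro x hx
        rw [interior_Icc] at hx
        have := hb x ⟨hx.1.le, hx.2.le⟩
        exact (hasDerivAt_Phi this.1 this.2).differentiableAt.differentiableWithinAt
      · intro x hx
        rw [interior_Icc] at hx
        have hbx := hb x ⟨hx.1.le, hx.2.le⟩
        rw [(hasDerivAt_Phi hbx.1 hbx.2).deriv]
        apply Real.log_nonneg
        have : Real.sin (π/6) ≤ Real.sin x := by
          rw [← Real.sin_pi_sub x]
          apply Real.sin_le_sin_of_le_of_le_pi_div_two <;> linarith [hx.1, hx.2, Real.pi_lt_d2]
        rw [Real.sin_pi_div_six] at this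
        linarith
    exact mono ⟨le_rfl, by linarith⟩ ⟨by linarith, le_rfl⟩ (by linarith)
  have p3 : 0.1986*xq ≤ Phi xq := by
    have l1 := log_sin_xq
    have l2 := Psi_xq
    have l3 : (0.19861:ℚ) ≤ logq := by decide +kernel
    have l4 := (Rat.cast_le (K := ℝ)).2 l3
    push_cast at l4
    rw [abs_le] at l1 l2
    have : 0.198605 ≤ Real.log (2*Real.sin xq) := by norm_num at l1 l4 ⊢; linarith [l1.1]
    unfold Phi
    have := mul_le_mul_of_nonneg_left this hq.1.le
    norm_num at this l2 ⊢
    linarith [l2.2]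
  have : η*(0.1986*n) ≤ η*Real.log (W n xq) := by
    have : η*(0.1986*n) = 0.1986*xq := by rw [← hnη]; ring
    linarith
  have := le_of_mul_le_mul_left this hη0
  rw [← Real.le_log_iff_exp_le hWp]
  exact this
end QP
namespace QP
open Real Set MeasureTheory

lemma w_grow (n κ : ℕ) (hn : 1003 ≤ n) (hn2 : n ≤ 75000) (hκ : κ ≤ 1) {x : ℝ} (h0 : (xq:ℝ) ≤ x) (h1 : x ≤ xq + 30/n) :
    0.34 * w n κ xq ≤ w n κ x := by
  have hnR : (1003:ℝ) ≤ n := by exact_mod_cast hn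
  have hn0 : (n:ℝ) ≠ 0 := by positivity
  have hr : 30/(n:ℝ) ≤ 0.3 := by rw [div_le_iff₀ (by positivity)]; linarith
  have hb : ∀ y ∈ Icc (xq:ℝ) (xq+30/n), (0 < y ∧ y < π) ∧ |ell n κ y| ≤ 21.9 := by
    intro y hy
    have hz0 : |y - xq| ≤ 30/n := by rw [abs_of_nonneg] <;> linarith [hy.1, hy.2]
    have hz : |y - xq| ≤ 0.3 := hz0.trans hr
    have a1 := xq_lt_pi hz
    have a2 := ell_core n κ hn hn2 hκ hz
    rw [add_sub_cancel] at a1 a2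
    refine ⟨a1, a2.trans ?_⟩
    have : 0.66*(n:ℝ)*|y-xq| ≤ 0.66*n*(30/n) := by gcongr
    have e : 0.66*(n:ℝ)*(30/n) = 19.8 := by field_simp; norm_num
    linarith
  have hd : ∀ y ∈ Icc (xq:ℝ) (xq+30/n), HasDerivAt (fun y => w n κ y * Real.exp (21.9*y)) ((ell n κ y + 21.9) * (w n κ y * Real.exp (21.9*y))) y := by
    intro y hy
    have := hasDerivAt_w n κ (by omega) (hb y hy).1.1 (hb y hy).1.2
    have e : HasDerivAt (fun y : ℝ => Real.exp (21.9*y)) (Real.exp (21.9*y) * (21.9*1)) y := ((hasDerivAt_id y).const_mul 21.9).exp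
    refine (this.mul e).congr_deriv (by ring)
  have mono : MonotoneOn (fun y => w n κ y * Real.exp (21.9*y)) (Icc xq (xq+30/n)) := by
    apply monotoneOn_of_deriv_nonneg (convex_Icc _ _)
    · exact fun t ht => (hd t ht).continuousAt.continuousWithinAt
    · intro t ht
      rw [interior_Icc] at ht
      exact (hd t ⟨ht.1.le, ht.2.le⟩).differentiableAt.differentiableWithinAt
    · intro t ht
      rw [interior_Icc] at ht
      have ht' : t ∈ Icc (xq:ℝ) (xq+30/n) := ⟨ht.1.le, ht.2.le⟩
      rw [(hd t ht').deriv]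
      have b := hb t ht'
      have := w_pos n κ (by omega) b.1.1 b.1.2
      have b2 := (abs_le.1 b.2).1
      have : 0 ≤ ell n κ t + 21.9 := by linarith
      positivity
  have h30 : 0 ≤ 30/(n:ℝ) := by positivity
  have m := mono (show (xq:ℝ) ∈ Icc (xq:ℝ) (xq+30/n) from ⟨le_rfl, by linarith⟩) ⟨h0, h1⟩ h0
  simp only at m
  have hx := hb x ⟨h0, h1⟩
  have hwx := w_pos n κ (by omega) hx.1.1 hx.1.2
  have hq := hb xq ⟨le_rfl, by linarith⟩
  have hwq := w_pos n κ (by omega) hq.1.1 hq.1.2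
  have e1 : Real.exp (21.9*xq) = Real.exp (21.9*x) * Real.exp (21.9*(xq-x)) := by rw [← Real.exp_add]; ring_nf
  have e2 : 0.34 ≤ Real.exp (21.9*(xq-x)) := by
    have := Real.add_one_le_exp (21.9*(xq-x))
    have : (30:ℝ)/n ≤ 0.03 := by rw [div_le_iff₀ (by positivity)]; linarith
    linarith
  rw [e1] at m
  have p := Real.exp_pos (21.9*x)
  have m2 : Real.exp (21.9*x) * (w n κ xq * Real.exp (21.9*(xq-x))) ≤ Real.exp (21.9*x) * w n κ x := by linarith
  have m3 := le_of_mul_le_mul_left m2 p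
  nlinarith

lemma Zw_low (n κ : ℕ) (hn : 1003 ≤ n) (hn2 : n ≤ 75000) (hκ : κ ≤ 1) : 10/n * w n κ xq ≤ Zw n κ := by
  have hnR : (1003:ℝ) ≤ n := by exact_mod_cast hn
  have hr : 30/(n:ℝ) ≤ 0.3 := by rw [div_le_iff₀ (by positivity)]; linarith
  have h30 : 0 ≤ 30/(n:ℝ) := by positivity
  obtain ⟨c1, c2, c3⟩ := core_lim
  have hwc := w_cont n κ
  have a1 : ∫ x in (xq:ℝ)..(xq+30/n), (0.34 * w n κ xq) ≤ ∫ x in (xq:ℝ)..(xq+30/n), w n κ x := by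
    apply intervalIntegral.integral_mono_on (by linarith) (by simp) (Continuous.intervalIntegrable (by fun_prop) _ _)
    intro x hx
    exact w_grow n κ hn hn2 hκ hx.1 hx.2
  have a2 : ∫ x in (xq:ℝ)..(xq+30/n), w n κ x ≤ Zw n κ := by
    unfold Zw
    refine intervalIntegral.integral_mono_interval (by linarith) (by linarith) (by linarith) ?_ (Continuous.intervalIntegrable (by fun_prop) _ _)
    refine (ae_restrict_iff' measurableSet_Ioc).2 (Filter.Eventually.of_forall fun x hx => ?_)
    exact w_nonneg n κ (by omega) hx.1.le hx.2
  rw [intervalIntegral.integral_const, smul_eq_mul] at a1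
  have hw := w_pos n κ (by omega) (show (0:ℝ) < xq by linarith) (by linarith)
  refine le_trans ?_ (a1.trans a2)
  have : (xq + 30/(n:ℝ) - xq) * (0.34 * w n κ xq) = 10.2/n*w n κ xq := by ring
  rw [this]
  gcongr; norm_num

lemma Zw1_low (n : ℕ) (hn : 1003 ≤ n) (hn2 : n ≤ 75000) : 24.8/n^2 * Real.exp (0.1986*n) ≤ Zw n 1 := by
  have hnR : (1003:ℝ) ≤ n := by exact_mod_cast hn
  refine le_trans ?_ (Zw_low n 1 hn hn2 le_rfl)
  have h1 := W_low n hn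
  have hxq : (2.4857:ℝ) ≤ xq ∧ (xq:ℝ) ≤ 2.4858 := by rw [xq_val]; norm_num
  have hs : 2.48/(n:ℝ) ≤ Real.sin (xq/n) := by
    have hp : 0 < (xq:ℝ)/n := div_pos (by linarith) (by positivity)
    have hl : (xq:ℝ)/n ≤ 0.0025 := by rw [div_le_iff₀ (by positivity)]; linarith
    have := Real.sin_gt_sub_cube hp
    refine le_trans ?_ this.le
    have e : (xq:ℝ)/n - (xq/n)^3/6 = xq/n*(1-(xq/n)^2/6) := by ring
    have hq0 : (xq:ℝ) ≠ 0 := by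
      intro h0
      rw [h0] at hxq
      norm_num at hxq
    have : 2.48/(n:ℝ) = 2.48/xq*(xq/n) := by field_simp
    have h5 : 2.48/(xq:ℝ) ≤ 0.998 := by rw [div_le_iff₀ (by linarith)]; linarith
    rw [e, this]
    nlinarith
  unfold w
  rw [pow_one]
  calc 24.8/(n:ℝ)^2*Real.exp (0.1986*n) = 10/n*(Real.exp (0.1986*n)*(2.48/n)) := by field_simp; norm_num
    _ ≤ _ := by
      have := Real.exp_pos (0.1986*(n:ℝ))
      have : 0 ≤ W n xq := by linarith
      gcongr

lemma Zw_pos (n κ : ℕ) (hn : 1003 ≤ n) (hn2 : n ≤ 75000) (hκ : κ ≤ 1) : 0 < Zw n κ := by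
  have hnR : (1003:ℝ) ≤ n := by exact_mod_cast hn
  obtain ⟨c1, c2, c3⟩ := core_lim
  have hw := w_pos n κ (by omega) (show (0:ℝ) < xq by linarith) (by linarith)
  exact lt_of_lt_of_le (by positivity) (Zw_low n κ hn hn2 hκ)

lemma Zw_one_le (n : ℕ) (hn : 1003 ≤ n) : Zw n 1 ≤ Zw n 0 := by
  have hwc := w_cont n 0
  have hwc1 := w_cont n 1
  have hnR : (1003:ℝ) ≤ n := by exact_mod_cast hn
  unfold Zw
  apply intervalIntegral.integral_mono_on Real.pi_pos.le (Continuous.intervalIntegrable (by fun_prop) _ _) (Continuous.intervalIntegrable (by fun_prop) _ _)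
  intro x hx
  have := w_nonneg n 0 (by omega) hx.1 hx.2
  unfold w at *
  simp only [pow_zero, mul_one, pow_one] at *
  have := Real.sin_le_one (x/n)
  nlinarith

lemma minor (n : ℕ) (hn : 1003 ≤ n) (hn2 : n ≤ 75000) (φ : ℝ → ℝ) (hφ : Continuous φ) (hb : ∀ x, |φ x| ≤ 1) :
    |(∫ x in (0:ℝ)..(n*π/2), φ x * W n x) - ∫ x in (0:ℝ)..π, φ x * W n x| ≤ 100/n^3 * Zw n 1 := by
  have hnR : (1003:ℝ) ≤ n := by exact_mod_cast hn
  have hW := W_cont n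
  have hpi := Real.pi_pos
  have i1 : ∀ p q, IntervalIntegrable (fun x => φ x * W n x) volume p q := fun p q => Continuous.intervalIntegrable (by fun_prop) _ _
  rw [intervalIntegral.integral_interval_sub_left (i1 _ _) (i1 _ _)]
  have hle : π ≤ n*π/2 := by nlinarith
  have h1 : ‖∫ x in π..(n*π/2), φ x * W n x‖ ≤ Real.exp (0.16*n+4) * |n*π/2 - π| := by
    apply intervalIntegral.norm_integral_le_of_norm_le_const
    intro x hx
    rw [uIoc_of_le hle] at hx
    have := W_minor n hn x hx.1.le hx.2
    rw [Real.norm_eq_abs, abs_mul]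
    have := hb x
    have := abs_nonneg (W n x)
    nlinarith
  rw [Real.norm_eq_abs] at h1
  refine h1.trans ?_
  have hab : |n*π/2 - π| ≤ n*1.5708 := by
    rw [abs_of_nonneg (by linarith)]
    nlinarith [Real.pi_lt_d4]
  refine le_trans ?_ (mul_le_mul_of_nonneg_left (Zw1_low n hn hn2) (by positivity))
  have key : (n:ℝ)^6*1.5708 * Real.exp (0.16*n+4) ≤ 2480 * Real.exp (0.1986*n) := by
    have e1 : (n:ℝ) ≤ 1003*Real.exp ((n:ℝ)/1003 - 1) := by
      have := Real.add_one_le_exp ((n:ℝ)/1003-1)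
      linarith
    have e2 : (n:ℝ)^6 ≤ 1003^6 * Real.exp (6*((n:ℝ)/1003-1)) := by
      calc (n:ℝ)^6 ≤ (1003*Real.exp ((n:ℝ)/1003 - 1))^6 := by gcongr
        _ = _ := by rw [mul_pow, ← Real.exp_nat_mul]; norm_num
    have e3 : 1003^6*1.5708 ≤ 2480*Real.exp 34.5 := by
      have f1 : Real.exp 34.5 = Real.exp 1^34*Real.exp 0.5 := by rw [← Real.exp_nat_mul, ← Real.exp_add]; norm_num
      have f2 := Real.exp_one_gt_d9
      have f3 := Real.add_one_le_exp (0.5:ℝ)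
      have f4 : (2.7182818283:ℝ)^34 ≤ Real.exp 1^34 := by gcongr
      rw [f1]
      calc (1003:ℝ)^6*1.5708 ≤ 2480*(2.7182818283^34*1.5) := by norm_num
        _ ≤ _ := by gcongr; linarith
    calc (n:ℝ)^6*1.5708 * Real.exp (0.16*n+4) ≤ 1003^6 * Real.exp (6*((n:ℝ)/1003-1))*1.5708 * Real.exp (0.16*n+4) := by gcongr
      _ = 1003^6*1.5708 * Real.exp (6*((n:ℝ)/1003-1) + (0.16*n+4)) := by rw [Real.exp_add _ (0.16*(n:ℝ)+4)]; ring
      _ ≤ 2480*Real.exp 34.5 * Real.exp (6*((n:ℝ)/1003-1) + (0.16*n+4)) := by gcongr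
      _ = 2480*Real.exp (34.5 + (6*((n:ℝ)/1003-1) + (0.16*n+4))) := by rw [Real.exp_add 34.5]; ring
      _ ≤ _ := by gcongr; linarith
  calc Real.exp (0.16*n+4) * |n*π/2 - π| ≤ Real.exp (0.16*n+4)*(n*1.5708) := by gcongr
    _ = ((n:ℝ)^6*1.5708 * Real.exp (0.16*n+4))/n^5 := by field_simp
    _ ≤ (2480 * Real.exp (0.1986*n))/n^5 := by gcongr
    _ = _ := by field_simp; norm_num

lemma core_mono (n κ : ℕ) (hn : 1003 ≤ n) (f g : ℝ → ℝ) (hf : Continuous f) (hg : Continuous g) (h : ∀ x : ℝ, |x-(xq:ℝ)| ≤ 0.3 → f x ≤ g x) :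
    ∫ x in ((xq:ℝ)-0.3)..(xq+0.3), f x * w n κ x ≤ ∫ x in ((xq:ℝ)-0.3)..(xq+0.3), g x * w n κ x := by
  have hwc := w_cont n κ
  obtain ⟨c1, c2, c3⟩ := core_lim
  apply intervalIntegral.integral_mono_on c3.le (Continuous.intervalIntegrable (by fun_prop) _ _) (Continuous.intervalIntegrable (by fun_prop) _ _)
  intro x hx
  have := w_nonneg n κ (by omega) (show 0 ≤ x by linarith [hx.1]) (by linarith [hx.2])
  have := h x (by rw [abs_le]; constructor <;> linarith [hx.1, hx.2])
  gcongr

lemma core_const (n κ : ℕ) (c : ℝ) : ∫ x in ((xq:ℝ)-0.3)..(xq+0.3), c * w n κ x = c * ∫ x in ((xq:ℝ)-0.3)..(xq+0.3), w n κ x :=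
  intervalIntegral.integral_const_mul _ _

lemma core_mass (n κ : ℕ) (hn : 1003 ≤ n) (hn2 : n ≤ 75000) (hκ : κ ≤ 1) :
    (1-63.1/n^3) * Zw n κ ≤ ∫ x in ((xq:ℝ)-0.3)..(xq+0.3), w n κ x := by
  have := tail_le n κ hn hn2 hκ (fun _ => 1) continuous_const (by simp)
  simp only [one_mul] at this
  have := (abs_le.1 this).2
  unfold Zw at *
  linarith

lemma core_mass_le (n κ : ℕ) (hn : 1003 ≤ n) :
    ∫ x in ((xq:ℝ)-0.3)..(xq+0.3), w n κ x ≤ Zw n κ := by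
  have := core_mom n κ hn 0
  rw [mul_zero, mom_zero] at this
  simpa using this
end QP
namespace QP
open Real Set MeasureTheory

noncomputable def Hc (n : ℕ) (v : ℝ) : ℝ := ∫ x in (0:ℝ)..π, Real.cos (v*x) * w n 1 x
noncomputable def HH (n : ℕ) (v : ℝ) : ℝ := ∫ x in (0:ℝ)..(n*π/2), W n x * Real.sin (1/n*x) * Real.cos (v*x)

lemma HH_Hc (n : ℕ) (hn : 1003 ≤ n) (hn2 : n ≤ 75000) (v : ℝ) : |HH n v - Hc n v| ≤ 100/n^3*Zw n 1 := by
  have := minor n hn hn2 (fun x => Real.sin (1/n*x)*Real.cos (v*x)) (by fun_prop) (by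
    intro x
    rw [abs_mul]
    exact mul_le_one₀ (Real.abs_sin_le_one _) (abs_nonneg _) (Real.abs_cos_le_one _))
  have e1 : HH n v = ∫ x in (0:ℝ)..(n*π/2), Real.sin (1/n*x)*Real.cos (v*x) * W n x := by
    unfold HH; congr 1; ext x; ring
  have e2 : Hc n v = ∫ x in (0:ℝ)..π, Real.sin (1/n*x)*Real.cos (v*x) * W n x := by
    unfold Hc w; congr 1; ext x; rw [pow_one, one_div_mul_eq_div]; ring
  rw [e1, e2]; exact this

lemma sin_core {v x : ℝ} (h1 : 0.528 ≤ v) (h2 : v ≤ 0.764) (hz : |x-(xq:ℝ)| ≤ 0.3) : 0.844 ≤ Real.sin (v*x) := by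
  have hxq : (2.4857:ℝ) ≤ xq ∧ (xq:ℝ) ≤ 2.4858 := by rw [xq_val]; norm_num
  rw [abs_le] at hz
  have a1 : 2.1857 ≤ x := by linarith
  have a2 : x ≤ 2.7858 := by linarith
  have b1 : 1.154 ≤ v*x := by nlinarith
  have b2 : v*x ≤ 2.1284 := by nlinarith
  have hp := Real.pi_gt_d4
  have hp2 := Real.pi_lt_d4
  have e : Real.sin (v*x) = Real.cos (v*x-π/2) := by rw [← Real.cos_pi_div_two_sub, ← Real.cos_neg]; ring_nf
  rw [e]
  have c := Real.one_sub_sq_div_two_le_cos (x := v*x-π/2)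
  have : (v*x-π/2)^2 ≤ 0.3111 := by
    have u1 : -0.4169 ≤ v*x-π/2 := by linarith
    have u2 : v*x-π/2 ≤ 0.5577 := by linarith
    nlinarith
  linarith

lemma cos_diff_abs (v v' x : ℝ) : |Real.cos (v*x) - Real.cos (v'*x)| ≤ |v-v'| * |x| := by
  rw [Real.cos_sub_cos, abs_mul, abs_mul, abs_neg, abs_two]
  have h1 := Real.abs_sin_le_one ((v*x+v'*x)/2)
  have h2 : |Real.sin ((v*x-v'*x)/2)| ≤ |(v*x-v'*x)/2| := Real.abs_sin_le_abs
  have e : |(v*x-v'*x)/2| = |v-v'| * |x| /2 := by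
    rw [← sub_mul, abs_div, abs_mul, abs_two]
  rw [e] at h2
  have := abs_nonneg (Real.sin ((v*x-v'*x)/2))
  nlinarith

lemma Hc_diff (n : ℕ) (hn : 1003 ≤ n) (hn2 : n ≤ 75000) {v v' : ℝ} (h1 : 0.528 ≤ v) (h2 : v' ≤ 0.764) (h : v < v') :
    1.81*(v'-v)*Zw n 1 ≤ Hc n v - Hc n v' := by
  have hnR : (1003:ℝ) ≤ n := by exact_mod_cast hn
  have hwc := w_cont n 1
  have hd : 0 < v' - v := by linarith
  have hZ := Zw_nonneg n 1 (by omega)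
  have t := tail_le n 1 hn hn2 le_rfl (fun x => (Real.cos (v*x) - Real.cos (v'*x))/(4*(v'-v))) (by fun_prop) (by
    intro x hx
    rw [abs_div, abs_of_pos (show 0 < 4*(v'-v) by linarith), div_le_one (by linarith)]
    refine (cos_diff_abs v v' x).trans ?_
    rw [abs_of_neg (by linarith : v - v' < 0), abs_of_nonneg hx.1]
    nlinarith [Real.pi_lt_d2, hx.2])
  have c := core_mono n 1 hn (fun _ => 1.811/4) (fun x => (Real.cos (v*x) - Real.cos (v'*x))/(4*(v'-v))) (by fun_prop) (by fun_prop) (by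
    intro x hx
    have hxq : (2.4857:ℝ) ≤ xq ∧ (xq:ℝ) ≤ 2.4858 := by rw [xq_val]; norm_num
    have hs := sin_core (v := (v+v')/2) (by linarith) (by linarith) hx
    rw [abs_le] at hx
    rw [le_div_iff₀ (by linarith), Real.cos_sub_cos]
    have e1 : (v*x+v'*x)/2 = (v+v')/2*x := by ring
    have e2 : (v*x-v'*x)/2 = -((v'-v)*x/2) := by ring
    rw [e1, e2, Real.sin_neg]
    have y0 : 0 < (v'-v)*x/2 := by
      have : 0 < x := by linarith
      positivity
    have y1 : (v'-v)*x/2 ≤ 0.3288 := by nlinarith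
    have s2 := Real.sin_gt_sub_cube y0
    have y2 : (v'-v)*x/2*0.9819 ≤ Real.sin ((v'-v)*x/2) := by
      refine le_trans ?_ s2.le
      have : ((v'-v)*x/2)^2 ≤ 0.3288^2 := by gcongr
      nlinarith
    have y3 : (v'-v)*2.1857/2*0.9819 ≤ Real.sin ((v'-v)*x/2) := by
      refine le_trans ?_ y2
      have : 2.1857 ≤ x := by linarith
      gcongr
    have y4 : 0 ≤ (v'-v)*2.1857/2*0.9819 := by positivity
    have : (0.844:ℝ)*((v'-v)*2.1857/2*0.9819) ≤ Real.sin ((v+v')/2*x)*Real.sin ((v'-v)*x/2) := by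
      apply mul_le_mul hs y3 y4 (by linarith)
    nlinarith)
  rw [core_const] at c
  have m := core_mass n 1 hn hn2 le_rfl
  have e : ∫ x in (0:ℝ)..π, (Real.cos (v*x) - Real.cos (v'*x))/(4*(v'-v)) * w n 1 x = (Hc n v - Hc n v')/(4*(v'-v)) := by
    unfold Hc
    rw [← intervalIntegral.integral_sub (Continuous.intervalIntegrable (by fun_prop) _ _) (Continuous.intervalIntegrable (by fun_prop) _ _), ← intervalIntegral.integral_div]
    congr 1; ext x; ring
  rw [e] at t
  have t1 := (abs_le.1 t).1
  have hs : 63.1/(n:ℝ)^3 ≤ 1/10^7 := by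
    rw [div_le_iff₀ (by positivity)]
    have : (1003:ℝ)^3 ≤ (n:ℝ)^3 := by gcongr
    norm_num at this ⊢
    linarith
  have hs2 : 63.1/(n:ℝ)^3 * Zw n 1 ≤ 1/10^7*Zw n 1 := by gcongr
  have : 1.81/4*Zw n 1 ≤ (Hc n v - Hc n v')/(4*(v'-v)) := by
    norm_num at hs2 t1 m c ⊢
    nlinarith
  rw [le_div_iff₀ (by linarith)] at this
  linarith

lemma vs_bd (n : ℕ) (hn : 1003 ≤ n) : 0.6319 ≤ vs n ∧ vs n ≤ 0.6324 ∧ |vs n - v0q| ≤ 0.4281/n := by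
  have hnR : (1003:ℝ) ≤ n := by exact_mod_cast hn
  have e : vs n - v0q = (v1q+v2q/n)/n := by unfold vs; field_simp; ring
  have a0 : (0.63193:ℝ) ≤ v0q ∧ (v0q:ℝ) ≤ 0.63194 := by unfold v0q; norm_num
  have a1 : (0.4277:ℝ) ≤ v1q ∧ (v1q:ℝ) ≤ 0.42777 := by unfold v1q; norm_num
  have a2 : (0.1:ℝ) ≤ v2q ∧ (v2q:ℝ) ≤ 0.2 := by unfold v2q; norm_num
  have b2 : (v2q:ℝ)/n ≤ 0.0002 := by rw [div_le_iff₀ (by positivity)]; linarith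
  have b3 : 0 ≤ (v2q:ℝ)/n := div_nonneg (by linarith) (by positivity)
  have c : 0 ≤ vs n - v0q := by rw [e]; exact div_nonneg (by linarith) (by positivity)
  have d : vs n - v0q ≤ 0.4281/n := by rw [e]; gcongr; linarith
  have f : 0.4281/(n:ℝ) ≤ 0.00043 := by rw [div_le_iff₀ (by positivity)]; linarith
  refine ⟨by linarith, by linarith, by rwa [abs_of_nonneg c]⟩

lemma HH_pos (n : ℕ) (hn : 1003 ≤ n) (hn2 : n ≤ 75000) {v : ℝ} (h1 : 0.528 ≤ v) (h2 : v ≤ vs n - 1000/n^3) : 0 < HH n v := by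
  have hnR : (1003:ℝ) ≤ n := by exact_mod_cast hn
  have hv := vs_bd n hn
  have hZ := Zw_pos n 1 hn hn2 le_rfl
  have hp : 0 < 1000/(n:ℝ)^3 := by positivity
  have a1 := (abs_le.1 (HH_Hc n hn hn2 v)).1
  have a2 := (abs_le.1 (stein_int n hn hn2)).1
  have a3 := Hc_diff n hn hn2 h1 (by linarith) (show v < vs n by linarith)
  have a4 : 1.81*(1000/n^3)*Zw n 1 ≤ 1.81*(vs n - v)*Zw n 1 := by gcongr; linarith
  change _ ≤ Hc n (vs n) at a2
  have : 0 < 30/(n:ℝ)^3*Zw n 1 := by positivity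
  have e : 1.81*(1000/n^3)*Zw n 1 = 100/n^3*Zw n 1 + 1680/n^3*Zw n 1 + 30/(n:ℝ)^3*Zw n 1 := by ring
  linarith

lemma HH_neg (n : ℕ) (hn : 1003 ≤ n) (hn2 : n ≤ 75000) {v : ℝ} (h1 : v ≤ 0.764) (h2 : vs n + 1000/n^3 ≤ v) : HH n v < 0 := by
  have hnR : (1003:ℝ) ≤ n := by exact_mod_cast hn
  have hv := vs_bd n hn
  have hZ := Zw_pos n 1 hn hn2 le_rfl
  have hp : 0 < 1000/(n:ℝ)^3 := by positivity
  have a1 := (abs_le.1 (HH_Hc n hn hn2 v)).2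
  have a2 := (abs_le.1 (stein_int n hn hn2)).2
  have a3 := Hc_diff n hn hn2 (by linarith) h1 (show vs n < v by linarith)
  have a4 : 1.81*(1000/n^3)*Zw n 1 ≤ 1.81*(v - vs n)*Zw n 1 := by gcongr; linarith
  change Hc n (vs n) ≤ _ at a2
  have : 0 < 30/(n:ℝ)^3*Zw n 1 := by positivity
  have e : 1.81*(1000/n^3)*Zw n 1 = 100/n^3*Zw n 1 + 1680/n^3*Zw n 1 + 30/(n:ℝ)^3*Zw n 1 := by ring
  linarith
end QP
namespace QP
open Real Set MeasureTheory

noncomputable def Gc (n : ℕ) (v : ℝ) : ℝ := ∫ x in (0:ℝ)..π, Real.sin (v*x) * w n 0 x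

lemma w_zero_eq (n : ℕ) (x : ℝ) : w n 0 x = W n x := by simp [w]

lemma G_Gc (n : ℕ) (hn : 1003 ≤ n) (hn2 : n ≤ 75000) (v : ℝ) : |G n v - Gc n v| ≤ 100/n^3*Zw n 0 := by
  have := minor n hn hn2 (fun x => Real.sin (v*x)) (by fun_prop) (fun x => Real.abs_sin_le_one _)
  have e1 : G n v = ∫ x in (0:ℝ)..(n*π/2), Real.sin (v*x) * W n x := by
    unfold G; congr 1; ext x; ring
  have e2 : Gc n v = ∫ x in (0:ℝ)..π, Real.sin (v*x) * W n x := by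
    unfold Gc; simp only [w_zero_eq]
  rw [e1, e2]
  refine this.trans ?_
  have := Zw_one_le n hn
  gcongr

lemma G_core (n : ℕ) (hn : 1003 ≤ n) (hn2 : n ≤ 75000) (v : ℝ) :
    |G n v - ∫ x in ((xq:ℝ)-0.3)..(xq+0.3), Real.sin (v*x) * w n 0 x| ≤ 164/n^3*Zw n 0 := by
  have hnR : (1003:ℝ) ≤ n := by exact_mod_cast hn
  have a := G_Gc n hn hn2 v
  have b := tail_le n 0 hn hn2 (by norm_num) (fun x => Real.sin (v*x)) (by fun_prop) (fun x _ => Real.abs_sin_le_one _)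
  have hZ := Zw_nonneg n 0 (by omega)
  change |Gc n v - _| ≤ _ at b
  have t := abs_sub_le (G n v) (Gc n v) (∫ x in ((xq:ℝ)-0.3)..(xq+0.3), Real.sin (v*x) * w n 0 x)
  have e : 164/(n:ℝ)^3*Zw n 0 = 100/n^3*Zw n 0 + 63.1/n^3*Zw n 0 + 0.9/n^3*Zw n 0 := by ring
  have : 0 ≤ 0.9/(n:ℝ)^3*Zw n 0 := by positivity
  linarith

lemma n3_small (n : ℕ) (hn : 1003 ≤ n) : 164/(n:ℝ)^3 ≤ 0.0002/n := by
  have hnR : (1003:ℝ) ≤ n := by exact_mod_cast hn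
  rw [div_le_div_iff₀ (by positivity) (by positivity)]
  have : (1003:ℝ)^2 ≤ (n:ℝ)^2 := by gcongr
  have : (n:ℝ)*1003^2 ≤ n*(n:ℝ)^2 := by gcongr
  nlinarith

lemma n1_small (n : ℕ) (hn : 1003 ≤ n) : 1/(n:ℝ) ≤ 0.000998 := by
  have hnR : (1003:ℝ) ≤ n := by exact_mod_cast hn
  rw [div_le_iff₀ (by positivity)]
  linarith

lemma G_near_pos (n : ℕ) (hn : 1003 ≤ n) (hn2 : n ≤ 75000) {v : ℝ} (h1 : 0.528 ≤ v) (h2 : v ≤ 0.764) : 0 < G n v := by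
  have hnR : (1003:ℝ) ≤ n := by exact_mod_cast hn
  have hZ := Zw_pos n 0 hn hn2 (by norm_num)
  have c := core_mono n 0 hn (fun _ => 0.844) (fun x => Real.sin (v*x)) (by fun_prop) (by fun_prop) (fun x hx => sin_core h1 h2 hx)
  rw [core_const] at c
  have m := core_mass n 0 hn hn2 (by norm_num)
  have g := (abs_le.1 (G_core n hn hn2 v)).1
  have s := n3_small n hn
  have s1 := n1_small n hn
  have e1 : 0.0002/(n:ℝ) = 0.0002*(1/n) := by ring
  have s2 : 63.1/(n:ℝ)^3 ≤ 164/(n:ℝ)^3 := by gcongr; norm_num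
  have p1 : 164/(n:ℝ)^3*Zw n 0 ≤ 0.001*Zw n 0 := by gcongr; linarith
  have p2 : 63.1/(n:ℝ)^3*Zw n 0 ≤ 0.001*Zw n 0 := by gcongr; linarith
  linarith

lemma G_peak (n : ℕ) (hn : 1003 ≤ n) (hn2 : n ≤ 75000) {v : ℝ} (h : |v - vs n| ≤ 1/n) : (1-0.67/n)*Zw n 0 ≤ G n v := by
  have hnR : (1003:ℝ) ≤ n := by exact_mod_cast hn
  have hZ := Zw_pos n 0 hn hn2 (by norm_num)
  have hwc := w_cont n 0
  have hv := (vs_bd n hn).2.2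
  have hd : |v - v0q| ≤ 1.4281/n := by
    have := abs_sub_le v (vs n) v0q
    have e : 1.4281/(n:ℝ) = 1/n+0.4281/n := by ring
    linarith
  have hpt : ∀ x ∈ Icc 0 π, (1 - 80.6/n^2 - 0.2282*(x-(xq:ℝ))^2)*w n 0 x ≤ Real.sin (v*x) * w n 0 x := by
    intro x hx
    have hw := w_nonneg n 0 (by omega) hx.1 hx.2
    apply mul_le_mul_of_nonneg_right _ hw
    have e : Real.sin (v*x) = Real.cos (v*x-π/2) := by rw [← Real.cos_pi_div_two_sub, ← Real.cos_neg]; ring_nf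
    rw [e]
    refine le_trans ?_ (Real.one_sub_sq_div_two_le_cos (x := v*x-π/2))
    set A := (v-v0q)*x + (v0q*xq-π/2) with hA
    have eq : v*x-π/2 = A + v0q*(x-xq) := by rw [hA]; ring
    have hAb : |A| ≤ 4.4867/n := by
      have h1 : |(v-v0q)*x| ≤ 1.4281/n*3.1416 := by
        rw [abs_mul, abs_of_nonneg hx.1]
        have := Real.pi_lt_d4
        have hx2 : x ≤ 3.1416 := by linarith [hx.2]
        have hx1 := hx.1
        gcongr
      have h2 := v0_pi
      have h3 : (1:ℝ)/10^18 ≤ 0.0001/n := by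
        rw [div_le_div_iff₀ (by positivity) (by positivity)]
        have : (n:ℝ) ≤ 75000 := by exact_mod_cast hn2
        linarith
      have h4 := abs_add_le ((v-v0q)*x) (v0q*xq-π/2)
      have h5 : 4.4867/(n:ℝ) = 1.4281/n*3.1416 + 0.0001/n + (4.4867-1.4281*3.1416-0.0001)/n := by ring
      have h6 : 0 ≤ (4.4867-1.4281*3.1416-0.0001)/(n:ℝ) := div_nonneg (by norm_num) (by positivity)
      linarith
    have hA2 : A^2 ≤ 20.14/n^2 := by
      rw [← sq_abs]
      calc |A|^2 ≤ (4.4867/(n:ℝ))^2 := by gcongr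
        _ = 4.4867^2/(n:ℝ)^2 := by ring
        _ ≤ _ := by gcongr; norm_num
    have a0 : (0:ℝ) ≤ v0q ∧ (v0q:ℝ)^2 ≤ 0.39935 := by unfold v0q; norm_num
    rw [eq]
    have b1 : (A+v0q*(x-xq))^2 ≤ 8*A^2 + 8/7*(v0q*(x-xq))^2 := by
      nlinarith [sq_nonneg (7*A - v0q*(x-xq))]
    have b2 : ((v0q:ℝ)*(x-xq))^2 ≤ 0.39935*(x-xq)^2 := by rw [mul_pow]; gcongr; exact a0.2
    have b3 : 80.6/(n:ℝ)^2 = 4*(20.14/n^2) + 0.04/n^2 := by ring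
    have b4 : 0 ≤ 0.04/(n:ℝ)^2 := by positivity
    have b5 := sq_nonneg (x-(xq:ℝ))
    linarith
  have hInt0 : ∫ x in (0:ℝ)..π, (1 - 80.6/n^2 - 0.2282*(x-(xq:ℝ))^2)*w n 0 x ≤ Gc n v := by
    unfold Gc
    exact intervalIntegral.integral_mono_on Real.pi_pos.le (Continuous.intervalIntegrable (by fun_prop) _ _) (Continuous.intervalIntegrable (by fun_prop) _ _) hpt
  have e : ∫ x in (0:ℝ)..π, (1 - 80.6/n^2 - 0.2282*(x-(xq:ℝ))^2)*w n 0 x = (1-80.6/n^2)*Zw n 0 - 0.2282*mom n 0 2 := by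
    unfold Zw mom
    rw [← intervalIntegral.integral_const_mul, ← intervalIntegral.integral_const_mul, ← intervalIntegral.integral_sub (Continuous.intervalIntegrable (by fun_prop) _ _) (Continuous.intervalIntegrable (by fun_prop) _ _)]
    congr 1; ext x; ring
  rw [e] at hInt0
  have m2 := mom2_le n 0 hn hn2 (by norm_num)
  have g := (abs_le.1 (G_Gc n hn hn2 v)).1
  have s := n3_small n hn
  have s2 : 100/(n:ℝ)^3 ≤ 164/(n:ℝ)^3 := by gcongr; norm_num
  have p1 : 100/(n:ℝ)^3*Zw n 0 ≤ 0.0002/n*Zw n 0 := mul_le_mul_of_nonneg_right (by linarith) hZ.le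
  have p2 : 80.6/(n:ℝ)^2*Zw n 0 ≤ 0.08044/n*Zw n 0 := by
    have : 80.6/(n:ℝ)^2 = 80.6*(1/n)/n := by ring
    rw [this]
    gcongr
    linarith [n1_small n hn]
  have f : (1-0.67/n)*Zw n 0 = Zw n 0 - 0.08044/n*Zw n 0 - 0.0002/n*Zw n 0 - 0.2282*(2.5544/n*Zw n 0) - (0.67-0.08044-0.0002-0.2282*2.5544)/n*Zw n 0 := by ring
  have q : 0 ≤ (0.67-0.08044-0.0002-0.2282*2.5544)/(n:ℝ)*Zw n 0 := by
    apply mul_nonneg (div_nonneg (by norm_num) (by positivity)) hZ.le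
  linarith

lemma sin_le_far {u : ℝ} (h0 : 0 ≤ u) (h1 : u ≤ 1.472) : Real.sin u ≤ 0.9952 := by
  have hp := Real.pi_gt_d4
  rw [← Real.cos_pi_div_two_sub]
  have : Real.cos (π/2-u) ≤ Real.cos 0.0987 := by
    apply Real.cos_le_cos_of_nonneg_of_le_pi <;> linarith
  have c := cos_le4 (x := 0.0987) (by norm_num)
  norm_num at this c ⊢
  linarith

lemma abs_sin_far {u : ℝ} (h1 : |u| ≤ 1.472) : |Real.sin u| ≤ 0.9952 := by
  have hp := Real.pi_gt_d4
  have : |Real.sin u| = Real.sin |u| := by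
    rcases le_total 0 u with h | h
    · rw [abs_of_nonneg h] at *
      exact abs_of_nonneg (Real.sin_nonneg_of_nonneg_of_le_pi h (by linarith))
    · rw [abs_of_nonpos h] at *
      rw [Real.sin_neg]
      exact abs_of_nonpos (Real.sin_nonpos_of_nonpos_of_neg_pi_le h (by linarith))
  rw [this]
  exact sin_le_far (abs_nonneg _) h1

lemma abs_of_both {a b : ℝ} (h : ∀ σ : ℝ, σ^2 = 1 → σ*a ≤ b) : |a| ≤ b := by
  rw [abs_le]
  have h1 := h 1 (by norm_num)
  have h2 := h (-1) (by norm_num)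
  constructor <;> linarith

lemma core_sin_le (n : ℕ) (hn : 1003 ≤ n) {v : ℝ} (hb : ∀ x : ℝ, |x-(xq:ℝ)| ≤ 0.3 → |Real.sin (v*x)| ≤ 0.9952) :
    |∫ x in ((xq:ℝ)-0.3)..(xq+0.3), Real.sin (v*x) * w n 0 x| ≤ 0.9952*Zw n 0 := by
  apply abs_of_both
  intro σ hσ
  have c := core_mono n 0 hn (fun x => σ*Real.sin (v*x)) (fun _ => 0.9952) (by fun_prop) (by fun_prop) (by
    intro x hx
    refine le_trans (le_abs_self _) ?_
    have : |σ| = 1 := by rwa [← sq_eq_sq₀ (abs_nonneg _) (by norm_num), sq_abs, one_pow]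
    rw [abs_mul, this, one_mul]
    exact hb x hx)
  rw [core_const] at c
  simp only [mul_assoc] at c
  rw [intervalIntegral.integral_const_mul] at c
  have := core_mass_le n 0 hn
  linarith

lemma G_far (n : ℕ) (hn : 1003 ≤ n) (hn2 : n ≤ 75000) {v : ℝ} (h0 : 0 ≤ v) (h1 : v ≤ 0.528 ∨ (0.764 ≤ v ∧ v ≤ 1.655)) :
    |G n v| < (1-0.67/n)*Zw n 0 := by
  have hnR : (1003:ℝ) ≤ n := by exact_mod_cast hn
  have hZ := Zw_pos n 0 hn hn2 (by norm_num)
  have hc := core_sin_le n hn (v := v) (by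
    intro x hx
    have hxq : (2.4857:ℝ) ≤ xq ∧ (xq:ℝ) ≤ 2.4858 := by rw [xq_val]; norm_num
    have hp := Real.pi_gt_d4
    have hp2 := Real.pi_lt_d4
    rw [abs_le] at hx
    have a1 : 2.1857 ≤ x := by linarith
    have a2 : x ≤ 2.7858 := by linarith
    rcases h1 with h | ⟨h, h'⟩
    · apply abs_sin_far
      rw [abs_of_nonneg (mul_nonneg h0 (by linarith))]
      nlinarith
    · have b1 : 0.764*2.1857 ≤ v*x := by gcongr
      have b2 : v*x ≤ 1.655*2.7858 := by gcongr
      have := abs_sin_far (u := v*x-π) (by rw [abs_le]; constructor <;> linarith)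
      rwa [Real.sin_sub_pi, abs_neg] at this)
  have g := G_core n hn hn2 v
  have t := abs_sub_abs_le_abs_sub (G n v) (∫ x in ((xq:ℝ)-0.3)..(xq+0.3), Real.sin (v*x) * w n 0 x)
  have s := n3_small n hn
  have s1 := n1_small n hn
  have e1 : 0.0002/(n:ℝ) = 0.0002*(1/n) := by ring
  have e2 : 0.67/(n:ℝ) = 0.67*(1/n) := by ring
  have p1 : 164/(n:ℝ)^3*Zw n 0 ≤ 0.001*Zw n 0 := by gcongr; linarith
  have p2 : 0.67/(n:ℝ)*Zw n 0 ≤ 0.0007*Zw n 0 := by gcongr; linarith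
  linarith

set_option maxHeartbeats 1000000 in
lemma core_high (n : ℕ) (hn : 1003 ≤ n) (hn2 : n ≤ 75000) {v : ℝ} (hv : 1.655 ≤ v) :
    |∫ x in ((xq:ℝ)-0.3)..(xq+0.3), Real.sin (v*x) * w n 0 x| ≤ (1-1.08/n)*Zw n 0 := by
  have hnR : (1003:ℝ) ≤ n := by exact_mod_cast hn
  have hn0 : (n:ℝ) ≠ 0 := by positivity
  have hZ := Zw_pos n 0 hn hn2 (by norm_num)
  have hwc := w_cont n 0
  have hdc := dw_cont n 0
  obtain ⟨c1, c2, c3⟩ := core_lim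
  apply abs_of_both
  intro σ hσ
  have hσa : |σ| = 1 := by rwa [← sq_eq_sq₀ (abs_nonneg _) (by norm_num), sq_abs, one_pow]
  set S := ∫ x in ((xq:ℝ)-0.3)..(xq+0.3), Real.sin (v*x) * w n 0 x with hS
  set C := ∫ x in ((xq:ℝ)-0.3)..(xq+0.3), Real.cos (v*x)^2 * w n 0 x with hC
  set Z := Zw n 0 with hZd
  have m := core_mass_le n 0 hn
  have iw : IntervalIntegrable (w n 0) volume ((xq:ℝ)-0.3) (xq+0.3) := hwc.intervalIntegrable _ _
  have iC : IntervalIntegrable (fun x => Real.cos (v*x)^2 * w n 0 x) volume ((xq:ℝ)-0.3) (xq+0.3) := Continuous.intervalIntegrable (by fun_prop) _ _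
  have iz : IntervalIntegrable (fun x => (x-(xq:ℝ))^(2*1) * w n 0 x) volume ((xq:ℝ)-0.3) (xq+0.3) := Continuous.intervalIntegrable (by fun_prop) _ _
  -- first inequality
  have k1 : σ*S ≤ Z - C/2 := by
    have c := core_mono n 0 hn (fun x => σ*Real.sin (v*x)) (fun x => 1 - Real.cos (v*x)^2/2) (by fun_prop) (by fun_prop) (by
      intro x hx
      have := Real.sin_sq_add_cos_sq (v*x)
      nlinarith [sq_nonneg (1-σ*Real.sin (v*x))])
    simp only [mul_assoc] at c
    rw [intervalIntegral.integral_const_mul] at c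
    have e : ∫ x in ((xq:ℝ)-0.3)..(xq+0.3), (1 - Real.cos (v*x)^2/2) * w n 0 x = (∫ x in ((xq:ℝ)-0.3)..(xq+0.3), w n 0 x) - C/2 := by
      rw [hC, ← intervalIntegral.integral_div, ← intervalIntegral.integral_sub iw (iC.div_const 2)]
      congr 1; ext x; ring
    rw [e, ← hS] at c
    rw [← hZd] at m
    linarith
  -- integration by parts
  have ibp := w_ibp n 0 (fun x => -Real.cos (v*x)) (fun x => v*Real.sin (v*x)) (by
    intro x
    have : HasDerivAt (fun x : ℝ => Real.cos (v*x)) (-Real.sin (v*x)*(v*1)) x := ((hasDerivAt_id x).const_mul v).cos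
    refine this.neg.congr_deriv (by ring)) (by fun_prop) ((xq:ℝ)-0.3) (xq+0.3)
  rw [intervalIntegral.integral_add (Continuous.intervalIntegrable (by fun_prop) _ _) (Continuous.intervalIntegrable (by fun_prop) _ _)] at ibp
  have e1 : ∫ x in ((xq:ℝ)-0.3)..(xq+0.3), v*Real.sin (v*x) * w n 0 x = v*S := by
    rw [hS, ← intervalIntegral.integral_const_mul]; congr 1; ext x; ring
  rw [e1] at ibp
  have k2 : -(σ*∫ x in ((xq:ℝ)-0.3)..(xq+0.3), -Real.cos (v*x) * deriv (w n 0) x) ≤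
      0.38*n*C + (17/16*(0.66*n)^2*mom n 0 2 + 17*2.1^2*Z)/(1.52*n) := by
    have a : ∫ x in ((xq:ℝ)-0.3)..(xq+0.3), σ*(Real.cos (v*x) * deriv (w n 0) x) ≤
       ∫ x in ((xq:ℝ)-0.3)..(xq+0.3), (0.38*n*Real.cos (v*x)^2 + (17/16*(0.66*n)^2*(x-(xq:ℝ))^(2*1) + 17*2.1^2)/(1.52*n))*w n 0 x := by
      apply intervalIntegral.integral_mono_on c3.le (Continuous.intervalIntegrable (by fun_prop) _ _) (Continuous.intervalIntegrable (by fun_prop) _ _)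
      intro x hx
      have hz : |x-(xq:ℝ)| ≤ 0.3 := by rw [abs_le]; constructor <;> linarith [hx.1, hx.2]
      have hl := ell_core n 0 hn hn2 (by norm_num) hz
      rw [add_sub_cancel] at hl
      have h0 : 0 < x := by linarith [hx.1]
      have h1 : x < π := by linarith [hx.2]
      rw [dw_eq n 0 (by omega) h0 h1]
      have hw := w_pos n 0 (by omega) h0 h1
      have : σ*(Real.cos (v*x)*(ell n 0 x * w n 0 x)) = σ*Real.cos (v*x)*ell n 0 x * w n 0 x := by ring
      rw [this]
      apply mul_le_mul_of_nonneg_right _ hw.le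
      generalize ell n 0 x = l at *
      generalize Real.cos (v*x) = c at *
      have l2 : l^2 ≤ 17/16*(0.66*n)^2*(x-(xq:ℝ))^(2*1) + 17*2.1^2 := by
        have : l^2 ≤ (0.66*n*|x-(xq:ℝ)|+2.1)^2 := by rw [← sq_abs l]; gcongr
        have e : (x-(xq:ℝ))^(2*1) = |x-(xq:ℝ)|^2 := by rw [sq_abs]
        rw [e]
        nlinarith [sq_nonneg (0.66*n*|x-(xq:ℝ)|-16*2.1)]
      have : σ*c*l ≤ 0.38*n*c^2 + l^2/(1.52*n) := by
        have e : 0.38*n*c^2 + l^2/(1.52*n) - σ*c*l = (0.76*n*c-σ*l)^2/(1.52*n) + (1-σ^2)*l^2/(1.52*n) := by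
          field_simp; ring
        have : 0 ≤ (0.76*n*c-σ*l)^2/(1.52*n) := by positivity
        rw [hσ] at e
        simp only [sub_self, zero_mul, zero_div, add_zero] at e
        linarith
      refine this.trans ?_
      gcongr
    have e2 : ∫ x in ((xq:ℝ)-0.3)..(xq+0.3), (0.38*n*Real.cos (v*x)^2 + (17/16*(0.66*n)^2*(x-(xq:ℝ))^(2*1) + 17*2.1^2)/(1.52*n))*w n 0 x
       = 0.38*n*C + (17/16*(0.66*n)^2*(∫ x in ((xq:ℝ)-0.3)..(xq+0.3), (x-(xq:ℝ))^(2*1) * w n 0 x) + 17*2.1^2*(∫ x in ((xq:ℝ)-0.3)..(xq+0.3), w n 0 x))/(1.52*n) := by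
      rw [hC, ← intervalIntegral.integral_const_mul, ← intervalIntegral.integral_const_mul, ← intervalIntegral.integral_const_mul,
        ← intervalIntegral.integral_add (iz.const_mul _) (iw.const_mul _), ← intervalIntegral.integral_div,
        ← intervalIntegral.integral_add (iC.const_mul _) (((iz.const_mul _).add (iw.const_mul _)).div_const _)]
      congr 1; ext x; ring
    rw [e2] at a
    have cm := core_mom n 0 hn 1
    have e3 : -(σ*∫ x in ((xq:ℝ)-0.3)..(xq+0.3), -Real.cos (v*x) * deriv (w n 0) x) = ∫ x in ((xq:ℝ)-0.3)..(xq+0.3), σ*(Real.cos (v*x) * deriv (w n 0) x) := by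
      rw [intervalIntegral.integral_const_mul, ← mul_neg, ← intervalIntegral.integral_neg]
      congr 2; ext x; ring
    rw [e3]
    refine a.trans ?_
    rw [mul_one] at cm ⊢
    gcongr
  have k3 : (17/16*(0.66*n)^2*mom n 0 2 + 17*2.1^2*Z)/(1.52*n) ≤ 0.82699*Z := by
    rw [div_le_iff₀ (by positivity)]
    have m2 := mom2_le n 0 hn hn2 (by norm_num)
    have : (n:ℝ)^2*mom n 0 2 ≤ n^2*(2.5544/n*Z) := by gcongr
    have e : (n:ℝ)^2*(2.5544/n*Z) = 2.5544*n*Z := by field_simp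
    nlinarith
  have bd := bdry_le n 0 hn hn2 (by norm_num)
  have k4 : σ*(-Real.cos (v*(xq+0.3))*w n 0 (xq+0.3) - -Real.cos (v*(xq-0.3))*w n 0 (xq-0.3)) ≤ 0.00001*Z := by
    have w1 := w_pos n 0 (by omega) (show (0:ℝ) < xq+0.3 by linarith) c2
    have w2 := w_pos n 0 (by omega) c1 (show (xq:ℝ)-0.3 < π by linarith)
    have b1 : -σ*Real.cos (v*(xq+0.3)) ≤ 1 := by
      refine (le_abs_self _).trans ?_
      rw [abs_mul, abs_neg, hσa, one_mul]
      exact Real.abs_cos_le_one _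
    have b2 : σ*Real.cos (v*(xq-0.3)) ≤ 1 := by
      refine (le_abs_self _).trans ?_
      rw [abs_mul, hσa, one_mul]
      exact Real.abs_cos_le_one _
    have : 5320/(n:ℝ)^3*Z ≤ 0.00001*Z := by
      gcongr
      rw [div_le_iff₀ (by positivity)]
      have : (1003:ℝ)^3 ≤ (n:ℝ)^3 := by gcongr
      linarith
    nlinarith
  rcases le_or_gt (σ*S) 0 with hneg | hpos
  · refine hneg.trans (mul_nonneg ?_ hZ.le)
    have : 1.08/(n:ℝ) = 1.08*(1/n) := by ring
    linarith [n1_small n hn]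
  · have k5 : v*(σ*S) ≤ 0.76*n*(Z-σ*S) + 0.827*Z := by
      have : v*(σ*S) = σ*(v*S + ∫ x in ((xq:ℝ)-0.3)..(xq+0.3), -Real.cos (v*x) * deriv (w n 0) x) + -(σ*∫ x in ((xq:ℝ)-0.3)..(xq+0.3), -Real.cos (v*x) * deriv (w n 0) x) := by ring
      rw [this, ibp]
      have : 0.38*n*C ≤ 0.38*n*(2*(Z-σ*S)) := by gcongr; linarith
      linarith
    have k6 : 1.655*(σ*S) ≤ v*(σ*S) := by gcongr
    have k7 : σ*S*(0.76*n+1.655) ≤ (0.76*n+0.827)*Z := by linarith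
    have k8 : (0.76*n+0.827)*Z ≤ (1-1.08/n)*Z*(0.76*n+1.655) := by
      have : (0.76*n+0.827) ≤ (1-1.08/n)*(0.76*(n:ℝ)+1.655) := by
        have e : (1-1.08/n)*(0.76*(n:ℝ)+1.655) = 0.76*n+1.655-0.8208-1.7874*(1/n) := by field_simp; ring
        rw [e]
        linarith [n1_small n hn]
      nlinarith
    exact le_of_mul_le_mul_right (k7.trans k8) (by positivity)

lemma G_high (n : ℕ) (hn : 1003 ≤ n) (hn2 : n ≤ 75000) {v : ℝ} (hv : 1.655 ≤ v) :
    |G n v| < (1-0.67/n)*Zw n 0 := by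
  have hnR : (1003:ℝ) ≤ n := by exact_mod_cast hn
  have hZ := Zw_pos n 0 hn hn2 (by norm_num)
  have hc := core_high n hn hn2 hv
  have g := G_core n hn hn2 v
  have t := abs_sub_abs_le_abs_sub (G n v) (∫ x in ((xq:ℝ)-0.3)..(xq+0.3), Real.sin (v*x) * w n 0 x)
  have s := n3_small n hn
  have p1 : 164/(n:ℝ)^3*Zw n 0 ≤ 0.0002/n*Zw n 0 := by gcongr
  have e : (1-0.67/n)*Zw n 0 = (1-1.08/n)*Zw n 0 + 0.0002/n*Zw n 0 + 0.4098/n*Zw n 0 := by ring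
  have : 0 < 0.4098/(n:ℝ)*Zw n 0 := by positivity
  linarith
end QP
namespace QP

def dr (n : ℕ) : ℕ := (631930243871800229470842*n^3 + 427769765189985439494702*n^2 + 199861726433237347269136*n + n/2%2*(10^24*n^2)) % (2*(10^24*n^2))

def dch (n : ℕ) : Bool := Nat.ble 75001 n || (Nat.ble (10^27) (dr n) && Nat.ble (dr n + 10^27) (2*(10^24*n^2)))

def dall : ℕ → ℕ → Bool
  | 0, k => dch (2*k+1)
  | d+1, k => dall d k && dall d (k+2^d)

lemma dall_spec (d : ℕ) : ∀ k, dall d k = true → ∀ j, k ≤ j → j < k+2^d → dch (2*j+1) = true := by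
  induction d with
  | zero =>
    intro k h j h1 h2
    have : j = k := by omega
    subst this
    simpa [dall] using h
  | succ d ih =>
    intro k h j h1 h2
    rw [dall, Bool.and_eq_true] at h
    rcases lt_or_ge j (k+2^d) with hj | hj
    · exact ih k h.1 j h1 hj
    · exact ih _ h.2 j hj (by rw [pow_succ] at h2; omega)

lemma dall_true : dall 16 501 = true := by decide +kernel

lemma dch_true (n : ℕ) (hodd : Odd n) (h1 : 1003 ≤ n) (h2 : n ≤ 75000) : 10^27 ≤ dr n ∧ dr n + 10^27 ≤ 2*(10^24*n^2) := by
  obtain ⟨j, rfl⟩ := hodd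
  have := dall_spec 16 501 dall_true j (by omega) (by norm_num; omega)
  unfold dch at this
  rw [Bool.or_eq_true, Bool.and_eq_true, Nat.ble_eq, Nat.ble_eq, Nat.ble_eq] at this
  rcases this with h | h
  · omega
  · exact h

lemma dioph (n : ℕ) (hodd : Odd n) (h1 : 1003 ≤ n) (h2 : n ≤ 75000) (m : ℤ) (hm : (m - (n/2:ℕ)) % 2 = 0) :
    1000/(n:ℝ)^3 ≤ |(m:ℝ)/n - vs n| := by
  have hnR : (1003:ℝ) ≤ n := by exact_mod_cast h1
  have hn0 : (n:ℝ) ≠ 0 := by positivity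
  obtain ⟨a1, a2⟩ := dch_true n hodd h1 h2
  have hq := Nat.div_add_mod (631930243871800229470842*n^3 + 427769765189985439494702*n^2 + 199861726433237347269136*n + n/2%2*(10^24*n^2)) (2*(10^24*n^2))
  change _ + dr n = _ at hq
  generalize dr n = r at *
  generalize (631930243871800229470842*n^3 + 427769765189985439494702*n^2 + 199861726433237347269136*n + n/2%2*(10^24*n^2)) / (2*(10^24*n^2)) = q at *
  obtain ⟨t, ht⟩ : ∃ t : ℤ, 2*(q:ℤ) - ((n/2%2:ℕ):ℤ) - m = 2*t := ⟨(2*(q:ℤ) - ((n/2%2:ℕ):ℤ) - m)/2, by omega⟩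
  have hqZ : (2*(10^24*(n:ℤ)^2))*q + r = 631930243871800229470842*(n:ℤ)^3 + 427769765189985439494702*n^2 + 199861726433237347269136*n + ((n/2%2:ℕ):ℤ)*(10^24*n^2) := by exact_mod_cast hq
  generalize ((n/2%2:ℕ):ℤ) = p at *
  have a1Z : (10^27:ℤ) ≤ r := by exact_mod_cast a1
  have a2Z : (r:ℤ) + 10^27 ≤ 2*(10^24*(n:ℤ)^2) := by exact_mod_cast a2
  have key : (631930243871800229470842*(n:ℤ)^3 + 427769765189985439494702*n^2 + 199861726433237347269136*n) - m*(10^24*n^2) = t*(2*(10^24*(n:ℤ)^2)) + r := by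
    have : m = 2*q - p - 2*t := by linarith
    rw [this]; linarith
  have hP : 0 ≤ 2*(10^24*(n:ℤ)^2) := by positivity
  have fin : (10^27:ℤ) ≤ |(631930243871800229470842*(n:ℤ)^3 + 427769765189985439494702*n^2 + 199861726433237347269136*n) - m*(10^24*n^2)| := by
    rw [key, le_abs]
    rcases le_or_gt 0 t with h | h
    · left; have := mul_nonneg h hP; linarith
    · right
      have : t*(2*(10^24*(n:ℤ)^2)) ≤ (-1)*(2*(10^24*(n:ℤ)^2)) := mul_le_mul_of_nonneg_right (by omega) hP
      linarith
  have finR : (10^27:ℝ) ≤ |(631930243871800229470842*(n:ℝ)^3 + 427769765189985439494702*n^2 + 199861726433237347269136*n) - m*(10^24*n^2)| := by exact_mod_cast fin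
  have e : (m:ℝ)/n - vs n = -((631930243871800229470842*(n:ℝ)^3 + 427769765189985439494702*n^2 + 199861726433237347269136*n) - m*(10^24*n^2))/(10^24*n^3) := by
    unfold vs v0q v1q v2q
    push_cast
    field_simp
    ring
  rw [e, abs_div, abs_neg, abs_of_pos (show (0:ℝ) < 10^24*n^3 by positivity), div_le_div_iff₀ (by positivity) (by positivity)]
  have : (0:ℝ) < n^3 := by positivity
  nlinarith
end QP
namespace QP
open Real

noncomputable def vI (n i : ℕ) : ℝ := (((n*(n+1)/2 : ℕ):ℝ) - 2*i)/n

lemma G_step (n : ℕ) (hn : 1003 ≤ n) (i : ℕ) : G n (vI n i) - G n (vI n (i+1)) = 2*HH n (vI n i - 1/n) := by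
  have := G_diff n (vI n i - 1/n) (1/n)
  have e1 : vI n i - 1/n + 1/n = vI n i := by ring
  have e2 : vI n i - 1/n - 1/n = vI n (i+1) := by unfold vI; push_cast; ring
  rw [e1, e2] at this
  exact this

lemma mid_gap (n : ℕ) (hodd : Odd n) (h1 : 1003 ≤ n) (h2 : n ≤ 75000) (i : ℕ) : 1000/(n:ℝ)^3 ≤ |vI n i - 1/n - vs n| := by
  have := dioph n hodd h1 h2 (((n*(n+1)/2 : ℕ):ℤ) - 2*i - 1) (by
    obtain ⟨k, rfl⟩ := hodd
    have e1 : (2*k+1)*(2*k+1+1)/2 = (2*k+1)*(k+1) := by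
      rw [show (2*k+1)*(2*k+1+1) = 2*((2*k+1)*(k+1)) by ring]; omega
    have e2 : (2*k+1)/2 = k := by omega
    rw [e1, e2]
    push_cast
    have : ((2*(k:ℤ)+1)*(k+1) - 2*i - 1 - k) = 2*(k^2+k-i) := by ring
    rw [this]; omega)
  have e : ((((n*(n+1)/2 : ℕ):ℤ) - 2*i - 1 : ℤ):ℝ)/n = vI n i - 1/n := by
    unfold vI; generalize n*(n+1)/2 = K; push_cast; ring
  rwa [e] at this

lemma good_large (n : ℕ) (hodd : Odd n) (hn : 1003 ≤ n) (hn2 : n ≤ 75000) : Good n := by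
  classical
  have hnR : (1003:ℝ) ≤ n := by exact_mod_cast hn
  have hn0 : (0:ℝ) < n := by linarith
  have hvs := vs_bd n hn
  have hs := n1_small n hn
  have hp3 : 0 < 1000/(n:ℝ)^3 := by positivity
  have hp1 : 0 < 1/(n:ℝ) := by positivity
  set N := n*(n+1)/2 with hN
  have hN4 : n*(n+1)/4 = N/2 := by rw [hN, Nat.div_div_eq_div_mul]
  have hex : ∃ i, vI n i - 1/n < vs n := by
    refine ⟨N/2, ?_⟩
    have : (N:ℝ) ≤ 2*((N/2:ℕ):ℝ) + 1 := by exact_mod_cast (by omega : N ≤ 2*(N/2)+1)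
    have : vI n (N/2) ≤ 1/n := by
      unfold vI
      rw [← hN]
      gcongr
      linarith
    linarith
  set i0 := Nat.find hex with hi0
  have h0 : vI n i0 - 1/n < vs n := Nat.find_spec hex
  have hmin : ∀ i < i0, vs n ≤ vI n i - 1/n := fun i hi => not_lt.1 (Nat.find_min hex hi)
  have hle : i0 ≤ N/2 := by
    apply Nat.find_min'
    have : (N:ℝ) ≤ 2*((N/2:ℕ):ℝ) + 1 := by exact_mod_cast (by omega : N ≤ 2*(N/2)+1)
    have : vI n (N/2) ≤ 1/n := by
      unfold vI
      rw [← hN]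
      gcongr
      linarith
    linarith
  have vstep : ∀ i, vI n (i+1) = vI n i - 2/n := by intro i; unfold vI; push_cast; ring
  have vanti : ∀ i j, i ≤ j → vI n j ≤ vI n i := by
    intro i j hij
    unfold vI
    have : (i:ℝ) ≤ j := by exact_mod_cast hij
    gcongr
  have hi0pos : i0 ≠ 0 := by
    intro h
    rw [h] at h0
    have hNb : (n:ℝ)*(n+1)/2 = N := by
      have : 2*N = n*(n+1) := by
        rw [hN]
        have : 2 ∣ n*(n+1) := (Nat.even_mul_succ_self n).two_dvd
        omega
      have : (2:ℝ)*N = n*(n+1) := by exact_mod_cast this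
      linarith
    have : vI n 0 = (n+1)/2 := by
      unfold vI
      rw [← hN, ← hNb]
      push_cast
      field_simp
      ring
    linarith
  -- location of the peak
  have hpk : |vI n i0 - vs n| ≤ 1/n := by
    obtain ⟨j, hj⟩ := Nat.exists_eq_succ_of_ne_zero hi0pos
    have h3 := hmin j (by omega)
    have h4 := vstep j
    rw [← Nat.succ_eq_add_one, ← hj] at h4
    have : 2/(n:ℝ) = 1/n+1/n := by ring
    rw [abs_le]; constructor <;> linarith
  have hpeak := G_peak n hn hn2 hpk
  have hZ := Zw_pos n 0 hn hn2 (by norm_num)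
  have hGpos : 0 < G n (vI n i0) := by
    refine lt_of_lt_of_le ?_ hpeak
    apply mul_pos _ hZ
    have : 0.67/(n:ℝ) = 0.67*(1/n) := by ring
    linarith
  -- chains
  have up : ∀ d, 0.528 ≤ vI n (i0+d+1) → G n (vI n (i0+d+1)) < G n (vI n i0) := by
    intro d
    induction d with
    | zero =>
      intro h
      have st := G_step n hn i0
      have g := mid_gap n hodd hn hn2 i0
      rw [abs_of_neg (by linarith)] at g
      have vs1 := vstep i0
      have : 2/(n:ℝ) = 1/n+1/n := by ring
      rw [add_zero] at h ⊢
      have := HH_pos n hn hn2 (v := vI n i0 - 1/n) (by linarith) (by linarith)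
      linarith
    | succ d ih =>
      intro h
      have v1 := vstep (i0+d+1)
      have e : i0+(d+1)+1 = i0+d+1+1 := by ring
      rw [e] at h ⊢
      have e2 : 2/(n:ℝ) = 1/n+1/n := by ring
      have ih' := ih (by linarith)
      have st := G_step n hn (i0+d+1)
      have g := mid_gap n hodd hn hn2 (i0+d+1)
      have mono := vanti i0 (i0+d+1) (by omega)
      rw [abs_of_neg (by linarith)] at g
      have := HH_pos n hn hn2 (v := vI n (i0+d+1) - 1/n) (by linarith) (by linarith)
      linarith
  have down : ∀ d, d + 1 ≤ i0 → vI n (i0-(d+1)) ≤ 0.764 → G n (vI n (i0-(d+1))) < G n (vI n i0) := by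
    intro d
    induction d with
    | zero =>
      intro hd h
      rw [zero_add] at *
      have st := G_step n hn (i0-1)
      have g := mid_gap n hodd hn hn2 (i0-1)
      have m := hmin (i0-1) (by omega)
      rw [abs_of_nonneg (by linarith)] at g
      rw [Nat.sub_add_cancel hd] at st
      have := HH_neg n hn hn2 (v := vI n (i0-1) - 1/n) (by linarith) (by linarith)
      linarith
    | succ d ih =>
      intro hd h
      have e : i0 - (d+1) = i0-(d+1+1)+1 := by omega
      have v1 := vstep (i0-(d+1+1))
      rw [← e] at v1
      have e2 : 0 < 2/(n:ℝ) := by positivity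
      have ih' := ih (by omega) (by linarith)
      have st := G_step n hn (i0-(d+1+1))
      have g := mid_gap n hodd hn hn2 (i0-(d+1+1))
      have m := hmin (i0-(d+1+1)) (by omega)
      rw [abs_of_nonneg (by linarith)] at g
      rw [← e] at st
      have := HH_neg n hn hn2 (v := vI n (i0-(d+1+1)) - 1/n) (by linarith) (by linarith)
      linarith
  -- conclusion
  refine ⟨i0, by rw [hN4]; exact hle, ?_⟩
  intro i hi hne
  rw [hN4] at hi
  have hv0 : 0 ≤ vI n i := by
    unfold vI
    rw [← hN]
    have : 2*(i:ℝ) ≤ N := by exact_mod_cast (by omega : 2*i ≤ N)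
    exact div_nonneg (by linarith) hn0.le
  have main : |G n (vI n i)| < |G n (vI n i0)| := by
    rw [abs_of_pos hGpos]
    rcases le_or_gt (vI n i) 0.528 with c1 | c1
    · exact lt_of_lt_of_le (G_far n hn hn2 hv0 (Or.inl c1)) hpeak
    rcases le_or_gt 1.655 (vI n i) with c2 | c2
    · exact lt_of_lt_of_le (G_high n hn hn2 c2) hpeak
    rcases le_or_gt 0.764 (vI n i) with c3 | c3
    · exact lt_of_lt_of_le (G_far n hn hn2 hv0 (Or.inr ⟨c3, c2.le⟩)) hpeak
    rw [abs_of_pos (G_near_pos n hn hn2 c1.le c3.le)]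
    rcases lt_or_gt_of_ne hne with h | h
    · have e : i = i0-(i0-i-1+1) := by omega
      have hd := down (i0-i-1) (by omega) (by rw [← e]; exact c3.le)
      rwa [← e] at hd
    · obtain ⟨d, rfl⟩ : ∃ d, i = i0+d+1 := ⟨i-i0-1, by omega⟩
      exact up d c1.le
  have f1 := fourier n hodd (by omega) i (by omega)
  have f2 := fourier n hodd (by omega) i0 (by omega)
  have : |((a n i : ℤ):ℝ)| < |((a n i0 : ℤ):ℝ)| := by
    rw [f1, f2]
    have : 0 < 2/((n:ℝ)*π) := by positivity
    exact mul_lt_mul_of_pos_left main this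
  exact_mod_cast this
end QP

/-- For odd `n` with `35 ≤ n ≤ 75000`, exactly two indices `0 ≤ i ≤ n(n+1)/2`
satisfy `|a(n,i)| = M n`. -/
theorem stmt_10 (n : ℕ) (hodd : Odd n) (h1 : 35 ≤ n) (h2 : n ≤ 75000) :
    {i : ℕ | i ≤ n * (n + 1) / 2 ∧ (a n i).natAbs = M n}.ncard = 2 := by
  refine QP.good_ncard n hodd (by omega) ?_
  rcases Nat.lt_or_ge 1001 n with h | h
  · refine QP.good_large n hodd ?_ h2
    obtain ⟨k, hk⟩ := hodd
    omega
  · exact QP.good_small n hodd h1 h
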